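/- arXiv:math/0407429 — 3 statements merged into one kernel-verified Lean document; each statement's English description precedes it below -/
import Mathlib

section
/- For i, j ≥ 1 with i + j = n + 1, the quotient R^n_{i,j} = B_n/I^n_{i,j} has dimension n! over ℂ and is isomorphic as a ℂ[S_n]-module to the regular representation ℂ[S_n]. -/
open MvPolynomial

set_option maxHeartbeats 1000000
set_option synthInstance.maxHeartbeats 400000

noncomputable section

/-- the ideal `(x₁y₁, …, xₙyₙ)`. -/
abbrev Bideal (n : ℕ) : Ideal (MvPolynomial (Fin n ⊕ Fin n) ℂ) :=
  Ideal.span (Set.range fun i : Fin n => X (Sum.inl i) * X (Sum.inr i))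

/-- `B n = ℂ[x₁,…,xₙ,y₁,…,yₙ]/(x₁y₁,…,xₙyₙ)`, the `n`-th tensor power of `ℂ[x,y]/(xy)`.
The variable `x_i` is `X (Sum.inl i)` and `y_i` is `X (Sum.inr i)`. -/
abbrev B (n : ℕ) : Type := MvPolynomial (Fin n ⊕ Fin n) ℂ ⧸ Bideal n

abbrev mkB (n : ℕ) : MvPolynomial (Fin n ⊕ Fin n) ℂ →ₐ[ℂ] B n :=
  Ideal.Quotient.mkₐ ℂ (Bideal n)

def xv (n : ℕ) (i : Fin n) : B n := mkB n (X (Sum.inl i))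
def yv (n : ℕ) (i : Fin n) : B n := mkB n (X (Sum.inr i))

/-- the action of a permutation `σ ∈ Sₙ` on `B n`: `σ·xᵢ = x_{σ i}`, `σ·yᵢ = y_{σ i}`. -/
def permB (n : ℕ) (σ : Equiv.Perm (Fin n)) : B n →ₐ[ℂ] B n :=
  Ideal.Quotient.liftₐ (Bideal n)
    ((mkB n).comp (MvPolynomial.rename (Sum.map ⇑σ ⇑σ)))
    (by
      intro a ha
      have h : Bideal n ≤ RingHom.ker ((mkB n).comp (MvPolynomial.rename (Sum.map ⇑σ ⇑σ))).toRingHom := by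
        rw [Ideal.span_le]
        rintro _ ⟨i, rfl⟩
        simp only [SetLike.mem_coe, RingHom.mem_ker, AlgHom.toRingHom_eq_coe, RingHom.coe_coe,
          AlgHom.comp_apply, map_mul, rename_X, Sum.map_inl, Sum.map_inr]
        rw [← map_mul, Ideal.Quotient.mkₐ_eq_mk, Ideal.Quotient.eq_zero_iff_mem]
        exact Ideal.subset_span ⟨σ i, rfl⟩
      exact h ha)

/-- evaluation at the origin. -/
def ev0 (n : ℕ) : B n →ₐ[ℂ] ℂ :=
  Ideal.Quotient.liftₐ (Bideal n) (aeval fun _ => (0 : ℂ))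
    (by
      intro a ha
      have h : Bideal n ≤ RingHom.ker (aeval (R := ℂ) fun _ : Fin n ⊕ Fin n => (0 : ℂ)).toRingHom := by
        rw [Ideal.span_le]
        rintro _ ⟨i, rfl⟩
        simp [RingHom.mem_ker]
      exact h ha)

/-- `Jₙ`, the ideal of `B n` generated by the `Sₙ`-invariant elements vanishing at the origin. -/
def Jn (n : ℕ) : Ideal (B n) :=
  Ideal.span {p : B n | (∀ σ : Equiv.Perm (Fin n), permB n σ p = p) ∧ ev0 n p = 0}

/-- the symmetric coinvariant algebra `Rₙ = Bₙ/Jₙ`. -/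
abbrev Rn (n : ℕ) : Type := B n ⧸ Jn n

/-- the `k`-th elementary symmetric polynomial `e_k` in the `x` variables. -/
def eX (n k : ℕ) : B n :=
  ∑ S ∈ Finset.powersetCard k (Finset.univ : Finset (Fin n)), ∏ t ∈ S, xv n t

/-- the `k`-th elementary symmetric polynomial `f_k` in the `y` variables. -/
def fY (n k : ℕ) : B n :=
  ∑ S ∈ Finset.powersetCard k (Finset.univ : Finset (Fin n)), ∏ t ∈ S, yv n t

/-- the generating set `S^n_{i,j}` of the ideal `I^n_{i,j}`:
`e₁,…,e_{i−1}`, all `x_I` with `|I| = i`, `f₁,…,f_{j−1}`, all `y_J` with `|J| = j`. -/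
def Sij (n i j : ℕ) : Set (B n) :=
  {p | ∃ k, 1 ≤ k ∧ k < i ∧ p = eX n k} ∪
  {p | ∃ I : Finset (Fin n), I.card = i ∧ p = ∏ t ∈ I, xv n t} ∪
  {p | ∃ k, 1 ≤ k ∧ k < j ∧ p = fY n k} ∪
  {p | ∃ J : Finset (Fin n), J.card = j ∧ p = ∏ t ∈ J, yv n t}

/-- the ideal `I^n_{i,j}`; `R^n_{i,j} = B n ⧸ Iij n i j`. -/
def Iij (n i j : ℕ) : Ideal (B n) := Ideal.span (Sij n i j)

/-- the subgroup `S_{n-m} ≤ Sₙ` of permutations fixing the first `m` letters. -/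
def fixLT (n m : ℕ) : Subgroup (Equiv.Perm (Fin n)) where
  carrier := {σ | ∀ k : Fin n, (k : ℕ) < m → σ k = k}
  one_mem' := fun _ _ => rfl
  mul_mem' := by
    intro a b ha hb k hk
    have : (a * b) k = a (b k) := rfl
    rw [this, hb k hk, ha k hk]
  inv_mem' := by
    intro a ha k hk
    have := ha k hk
    conv_lhs => rw [← this]
    exact a.symm_apply_apply k

/-- the left regular action of `Sₙ` on `ℂ[Sₙ]`, realized as functions on `Sₙ`. -/
def regAct (n : ℕ) (σ : Equiv.Perm (Fin n)) (f : Equiv.Perm (Fin n) → ℂ) :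
    Equiv.Perm (Fin n) → ℂ := fun τ => f (σ⁻¹ * τ)

/-- the action of `Sₙ` on the permutation module `ℂ[Sₙ/S_{n-m}]`, realized as
functions on the coset space `Sₙ/S_{n-m}`. -/
def cosetAct (n m : ℕ) (σ : Equiv.Perm (Fin n))
    (f : Equiv.Perm (Fin n) ⧸ fixLT n m → ℂ) :
    Equiv.Perm (Fin n) ⧸ fixLT n m → ℂ := fun x => f (σ⁻¹ • x)

section LaurentMonomials

variable {n : ℕ}

/-- A set of largest values of `u` has a larger sum than any other set of the same size. -/
lemma sum_lt_sum_of_forall_lt {u : Fin n → ℤ} {S T : Finset (Fin n)} (hcard : S.card = T.card)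
    (hne : S ≠ T) (hT : ∀ s ∈ T, ∀ t ∉ T, u t < u s) : ∑ t ∈ S, u t < ∑ t ∈ T, u t := by
  have hsd : (S \ T).card = (T \ S).card := by
    have h₁ := Finset.card_sdiff_add_card_inter S T
    have h₂ := Finset.card_sdiff_add_card_inter T S
    rw [Finset.inter_comm] at h₂
    omega
  have hST : (S \ T).Nonempty := by
    rw [Finset.sdiff_nonempty]
    exact fun h => hne (Finset.eq_of_subset_of_card_le h hcard.ge)
  have hTS : (T \ S).Nonempty := by
    rw [← Finset.card_pos, ← hsd, Finset.card_pos]; exact hST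
  obtain ⟨m, hm, hmin⟩ := (T \ S).exists_min_image u hTS
  have h₁ : ∑ t ∈ S \ T, u t < ∑ _t ∈ S \ T, u m :=
    Finset.sum_lt_sum_of_nonempty hST fun t ht =>
      hT m (Finset.mem_sdiff.1 hm).1 t (Finset.mem_sdiff.1 ht).2
  have h₂ : ∑ _t ∈ T \ S, u m ≤ ∑ t ∈ T \ S, u t := Finset.sum_le_sum hmin
  have h₃ := Finset.sum_inter_add_sum_sdiff S T u
  have h₄ := Finset.sum_inter_add_sum_sdiff T S u
  rw [Finset.inter_comm] at h₄
  simp only [Finset.sum_const, hsd] at h₁ h₂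
  linarith

/-- The vector `n • a`, perturbed so that its entries are distinct modulo `n`. -/
def shifted (a : Fin n → ℤ) (t : Fin n) : ℤ := n * a t - (t : ℕ)

/-- The indicator vector of `S`. -/
def indic (S : Finset (Fin n)) (t : Fin n) : ℤ := if t ∈ S then 1 else 0

/-- The quantity that decreases in the straightening procedure. -/
def energy (a : Fin n → ℤ) : ℤ := ∑ t, shifted a t ^ 2

lemma energy_nonneg (a : Fin n → ℤ) : 0 ≤ energy a :=
  Finset.sum_nonneg fun _ _ => sq_nonneg _

lemma energy_add_smul_indic (a : Fin n → ℤ) (S : Finset (Fin n)) (ε : ℤ) :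
    energy (a + ε • indic S) =
      energy a + 2 * n * ε * ∑ t ∈ S, shifted a t + n ^ 2 * ε ^ 2 * S.card := by
  have h : ∀ t, shifted (a + ε • indic S) t ^ 2 = shifted a t ^ 2 +
      (if t ∈ S then 2 * n * ε * shifted a t + n ^ 2 * ε ^ 2 else 0) := by
    intro t
    simp only [shifted, indic, Pi.add_apply, Pi.smul_apply, smul_eq_mul]
    split_ifs <;> ring
  simp only [energy, h, Finset.sum_add_distrib, Finset.sum_ite_mem, Finset.univ_inter,
    Finset.sum_const, nsmul_eq_mul, Finset.mul_sum]
  ring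

lemma shifted_injective (a : Fin n → ℤ) : Function.Injective (shifted a) := by
  intro s t h
  simp only [shifted] at h
  have hn : (0 : ℤ) < n := by have := s.pos; omega
  have hs := s.isLt
  have ht := t.isLt
  have h₁ : (n : ℤ) * (a s - a t) = (s : ℕ) - (t : ℕ) := by linarith
  have h₂ : a s - a t < 1 := by by_contra!; nlinarith
  have h₃ : -1 < a s - a t := by by_contra!; nlinarith
  have h₄ : a s - a t = 0 := by omega
  rw [h₄] at h₁
  ext
  omega

/-- `S` is separated in `a` from its complement by a gap larger than `n`. -/
def HasGap (a : Fin n → ℤ) (S : Finset (Fin n)) : Prop :=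
  ∀ s ∈ S, ∀ t ∉ S, shifted a t + n < shifted a s

/-- A vector with fewer than `i` positive and fewer than `j` negative entries, without gaps. -/
structure IsReducedExponent (i j : ℕ) (a : Fin n → ℤ) : Prop where
  pos : (Finset.univ.filter fun t => 0 < a t).card < i
  neg : (Finset.univ.filter fun t => a t < 0).card < j
  gap : ∀ S : Finset (Fin n), S.Nonempty → S ≠ Finset.univ → ¬ HasGap a S

lemma IsReducedExponent.shifted_succ_le {i j : ℕ} {a : Fin n → ℤ} (ha : IsReducedExponent i j a)
    {σ : Equiv.Perm (Fin n)} (hσ : Monotone (shifted a ∘ σ)) (k : ℕ) (hk : k + 1 < n) :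
    shifted a (σ ⟨k + 1, hk⟩) ≤ shifted a (σ ⟨k, by omega⟩) + n := by
  have hgap := ha.gap (Finset.univ.filter fun t => k < (σ.symm t : ℕ))
    ⟨σ ⟨k + 1, hk⟩, by simp⟩ (fun h => by
      have := Finset.mem_univ (σ ⟨k, by omega⟩)
      rw [← h] at this
      simp at this)
  simp only [HasGap, Finset.mem_filter, Finset.mem_univ, true_and] at hgap
  push Not at hgap
  obtain ⟨s, hs, t, ht, hst⟩ := hgap
  have h₁ : shifted a (σ ⟨k + 1, hk⟩) ≤ shifted a s := by
    simpa using hσ (show (⟨k + 1, hk⟩ : Fin n) ≤ σ.symm s from hs)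
  have h₂ : shifted a t ≤ shifted a (σ ⟨k, by omega⟩) := by
    simpa using hσ (show σ.symm t ≤ (⟨k, by omega⟩ : Fin n) from ht)
  linarith

lemma IsReducedExponent.sub_succ_eq {i j : ℕ} {a b : Fin n → ℤ} (ha : IsReducedExponent i j a)
    (hb : IsReducedExponent i j b) {σ : Equiv.Perm (Fin n)} (hσa : Monotone (shifted a ∘ σ))
    (hσb : Monotone (shifted b ∘ σ)) (k : ℕ) (hk : k + 1 < n) :
    a (σ ⟨k + 1, hk⟩) - b (σ ⟨k + 1, hk⟩) = a (σ ⟨k, by omega⟩) - b (σ ⟨k, by omega⟩) := by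
  have hle : (⟨k, by omega⟩ : Fin n) ≤ ⟨k + 1, hk⟩ := Nat.le_succ k
  have hne : σ ⟨k, by omega⟩ ≠ σ ⟨k + 1, hk⟩ := by simp
  have a₁ := ha.shifted_succ_le hσa k hk
  have b₁ := hb.shifted_succ_le hσb k hk
  have a₂ := lt_of_le_of_ne (hσa hle) ((shifted_injective a).ne hne)
  have b₂ := lt_of_le_of_ne (hσb hle) ((shifted_injective b).ne hne)
  simp only [shifted, Function.comp_apply] at a₁ b₁ a₂ b₂
  generalize σ ⟨k + 1, hk⟩ = p at *
  generalize σ ⟨k, by omega⟩ = q at *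
  have hn : (0 : ℤ) < n := by omega
  have h₁ : (n : ℤ) * (a p - b p - (a q - b q)) < n * 1 := by linarith
  have h₂ : (n : ℤ) * (-1) < n * (a p - b p - (a q - b q)) := by linarith
  have h₃ := lt_of_mul_lt_mul_left h₁ hn.le
  have h₄ := lt_of_mul_lt_mul_left h₂ hn.le
  omega

lemma IsReducedExponent.le_of_monotone {i j : ℕ} (hij : i + j = n + 1) {a b : Fin n → ℤ}
    (ha : IsReducedExponent i j a) (hb : IsReducedExponent i j b) {σ : Equiv.Perm (Fin n)}
    (hσa : Monotone (shifted a ∘ σ)) (hσb : Monotone (shifted b ∘ σ)) : a ≤ b := by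
  have hconst : ∀ k (hk : k < n),
      a (σ ⟨k, hk⟩) - b (σ ⟨k, hk⟩) = a (σ ⟨0, by omega⟩) - b (σ ⟨0, by omega⟩) := by
    intro k
    induction k with
    | zero => intro _; rfl
    | succ k ih => intro hk; rw [ha.sub_succ_eq hb hσa hσb k hk, ih]
  intro t
  by_contra! hlt
  have hall : ∀ s, b s < a s := by
    intro s
    have h₁ := hconst (σ.symm s) (σ.symm s).isLt
    have h₂ := hconst (σ.symm t) (σ.symm t).isLt
    simp only [Fin.eta, Equiv.apply_symm_apply] at h₁ h₂
    linarith [h₁.trans h₂.symm]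
  have hsub : (Finset.univ.filter fun t => ¬ 0 < a t) ⊆ Finset.univ.filter fun t => b t < 0 := by
    intro s hs
    have := hall s
    simp only [Finset.mem_filter, Finset.mem_univ, true_and] at hs ⊢
    omega
  have h₁ := Finset.card_le_card hsub
  have h₂ := Finset.card_filter_add_card_filter_not (s := (Finset.univ : Finset (Fin n)))
    (fun t => 0 < a t)
  have h₃ := ha.pos
  have h₄ := hb.neg
  simp only [Finset.card_univ, Fintype.card_fin] at h₂
  omega

variable {R : Type*} [CommRing R]

/-- The monomial in `x` and `y` with exponent vector `a`, where positive entries are exponents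
of `x` and negative ones are exponents of `y`. -/
def laurentMonomial (x y : Fin n → R) (a : Fin n → ℤ) : R :=
  ∏ t, x t ^ (a t).toNat * y t ^ (-a t).toNat

lemma prod_left_mul_laurentMonomial {x y : Fin n → R} {a : Fin n → ℤ} {S : Finset (Fin n)}
    (ha : ∀ t ∈ S, 0 ≤ a t) :
    (∏ t ∈ S, x t) * laurentMonomial x y a = laurentMonomial x y (a + (1 : ℤ) • indic S) := by
  have h : ∏ t ∈ S, x t = ∏ t, if t ∈ S then x t else 1 := by
    rw [Finset.prod_ite_mem, Finset.univ_inter]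
  rw [h, laurentMonomial, ← Finset.prod_mul_distrib, laurentMonomial]
  refine Finset.prod_congr rfl fun t _ => ?_
  simp only [indic, Pi.add_apply, Pi.smul_apply, smul_eq_mul, one_mul]
  split_ifs with ht
  · have h₀ := ha t ht
    have h₁ : (a t + 1).toNat = (a t).toNat + 1 := by omega
    have h₂ : (-(a t + 1)).toNat = 0 := by omega
    have h₃ : (-a t).toNat = 0 := by omega
    rw [h₁, h₂, h₃]
    ring
  · simp

lemma prod_left_mul_laurentMonomial_eq_zero {x y : Fin n → R} (hxy : ∀ t, x t * y t = 0)
    {a : Fin n → ℤ} {S : Finset (Fin n)} {s : Fin n} (hs : s ∈ S) (ha : a s < 0) :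
    (∏ t ∈ S, x t) * laurentMonomial x y a = 0 := by
  obtain ⟨m, hm⟩ : ∃ m, (-a s).toNat = m + 1 := ⟨(-a s).toNat - 1, by omega⟩
  have h₁ : x s ∣ ∏ t ∈ S, x t := Finset.dvd_prod_of_mem _ hs
  have h₂ : y s ∣ laurentMonomial x y a := by
    refine dvd_trans ?_ (Finset.dvd_prod_of_mem _ (Finset.mem_univ s))
    rw [hm, pow_succ]
    exact ⟨x s ^ (a s).toNat * y s ^ m, by ring⟩
  have h₃ := mul_dvd_mul h₁ h₂
  rwa [hxy, zero_dvd_iff] at h₃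

lemma laurentMonomial_swap (x y : Fin n → R) (a : Fin n → ℤ) :
    laurentMonomial y x (-a) = laurentMonomial x y a := by
  simp only [laurentMonomial, Pi.neg_apply, neg_neg]
  exact Finset.prod_congr rfl fun t _ => mul_comm _ _

lemma laurentMonomial_eq_zero_of_card {x y : Fin n → R} {i : ℕ}
    (hx : ∀ S : Finset (Fin n), S.card = i → ∏ t ∈ S, x t = 0) {a : Fin n → ℤ}
    (ha : i ≤ (Finset.univ.filter fun t => 0 < a t).card) : laurentMonomial x y a = 0 := by
  obtain ⟨S, hS, hcard⟩ := Finset.exists_subset_card_eq ha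
  have h := prod_left_mul_laurentMonomial (x := x) (y := y) (a := a + (-1 : ℤ) • indic S) (S := S)
    (fun t ht => by
      have := (Finset.mem_filter.1 (hS ht)).2
      simp only [indic, Pi.add_apply, Pi.smul_apply, smul_eq_mul, if_pos ht]
      omega)
  rw [hx S hcard, zero_mul] at h
  rw [h]
  congr 1
  ext t
  simp

variable [Algebra ℂ R]

/-- One straightening step, with an elementary symmetric polynomial in `x`. -/
lemma laurentMonomial_mem_of_esymm_eq_zero {x y : Fin n → R} (hxy : ∀ t, x t * y t = 0)
    {V : Submodule ℂ R} {a : Fin n → ℤ} {T : Finset (Fin n)} (hT : ∀ t ∈ T, 0 < a t)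
    (he : ∑ S ∈ Finset.powersetCard T.card Finset.univ, ∏ t ∈ S, x t = 0)
    (hV : ∀ S : Finset (Fin n), S.card = T.card → S ≠ T →
      laurentMonomial x y (a + (-1 : ℤ) • indic T + (1 : ℤ) • indic S) ∈ V) :
    laurentMonomial x y a ∈ V := by
  set b := a + (-1 : ℤ) • indic T with hb
  have hmem : T ∈ Finset.powersetCard T.card (Finset.univ : Finset (Fin n)) := by simp
  have h := congrArg (· * laurentMonomial x y b) he
  simp only [zero_mul, Finset.sum_mul] at h
  rw [← Finset.add_sum_erase _ _ hmem, prod_left_mul_laurentMonomial (fun t ht => by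
      have := hT t ht
      simp only [hb, indic, Pi.add_apply, Pi.smul_apply, smul_eq_mul, if_pos ht]
      omega)] at h
  have hba : b + (1 : ℤ) • indic T = a := by ext t; simp [hb]
  rw [hba] at h
  rw [eq_neg_of_add_eq_zero_left h]
  refine V.neg_mem (V.sum_mem fun S hS => ?_)
  rw [Finset.mem_erase, Finset.mem_powersetCard] at hS
  by_cases hpos : ∀ t ∈ S, 0 ≤ b t
  · rw [prod_left_mul_laurentMonomial hpos]
    exact hV S hS.2.2 hS.1
  · push Not at hpos
    obtain ⟨s, hs, hlt⟩ := hpos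
    rw [prod_left_mul_laurentMonomial_eq_zero hxy hs hlt]
    exact V.zero_mem

lemma energy_lt_of_hasGap {a : Fin n → ℤ} {S T : Finset (Fin n)} (hT : HasGap a T)
    (hcard : S.card = T.card) (hne : S ≠ T) :
    energy (a + (-1 : ℤ) • indic T + (1 : ℤ) • indic S) < energy a := by
  set b := a + (-1 : ℤ) • indic T with hb
  have hba : b + (1 : ℤ) • indic T = a := by ext t; simp [hb]
  have hn : (0 : ℤ) < n := by
    rcases n with _ | n
    · exact absurd (Subsingleton.elim S T) hne
    · positivity
  have hlt : ∑ t ∈ S, shifted b t < ∑ t ∈ T, shifted b t := by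
    refine sum_lt_sum_of_forall_lt hcard hne fun s hs t ht => ?_
    have := hT s hs t ht
    simp only [hb, shifted, indic, Pi.add_apply, Pi.smul_apply, smul_eq_mul, if_pos hs,
      if_neg ht] at this ⊢
    linarith
  have hS := energy_add_smul_indic b S 1
  have hT' := energy_add_smul_indic b T 1
  rw [hba] at hT'
  rw [hcard] at hS
  have := mul_lt_mul_of_pos_left hlt hn
  linarith

lemma energy_lt_of_hasGap_compl {a : Fin n → ℤ} {S T : Finset (Fin n)} (hT : HasGap a Tᶜ)
    (hcard : S.card = T.card) (hne : S ≠ T) :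
    energy (a + (1 : ℤ) • indic T + (-1 : ℤ) • indic S) < energy a := by
  set b := a + (1 : ℤ) • indic T with hb
  have hba : b + (-1 : ℤ) • indic T = a := by ext t; simp [hb]
  have hn : (0 : ℤ) < n := by
    rcases n with _ | n
    · exact absurd (Subsingleton.elim S T) hne
    · positivity
  have hlt : ∑ t ∈ S, -shifted b t < ∑ t ∈ T, -shifted b t := by
    refine sum_lt_sum_of_forall_lt hcard hne fun s hs t ht => ?_
    have := hT t (by simpa using ht) s (by simpa using hs)
    simp only [hb, shifted, indic, Pi.add_apply, Pi.smul_apply, smul_eq_mul, if_pos hs,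
      if_neg ht] at this ⊢
    linarith
  simp only [Finset.sum_neg_distrib] at hlt
  have hS := energy_add_smul_indic b S (-1)
  have hT' := energy_add_smul_indic b T (-1)
  rw [hba] at hT'
  rw [hcard] at hS
  have := mul_lt_mul_of_pos_left hlt hn
  linarith

/-- The reduced monomials span all monomials. -/
lemma laurentMonomial_mem_of_isReducedExponent {i j : ℕ} (hij : i + j = n + 1) {x y : Fin n → R}
    (hxy : ∀ t, x t * y t = 0)
    (hx : ∀ S : Finset (Fin n), S.card = i → ∏ t ∈ S, x t = 0)
    (hy : ∀ S : Finset (Fin n), S.card = j → ∏ t ∈ S, y t = 0)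
    (hex : ∀ k, 1 ≤ k → k < i → ∑ S ∈ Finset.powersetCard k Finset.univ, ∏ t ∈ S, x t = 0)
    (hey : ∀ k, 1 ≤ k → k < j → ∑ S ∈ Finset.powersetCard k Finset.univ, ∏ t ∈ S, y t = 0)
    {V : Submodule ℂ R} (hV : ∀ a, IsReducedExponent i j a → laurentMonomial x y a ∈ V)
    (a : Fin n → ℤ) : laurentMonomial x y a ∈ V := by
  induction hN : (energy a).toNat using Nat.strong_induction_on generalizing a with
  | _ N ih =>
  have ih' : ∀ b, energy b < energy a → laurentMonomial x y b ∈ V := fun b hb =>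
    ih (energy b).toNat (by have := energy_nonneg b; omega) b rfl
  by_cases hpos : i ≤ (Finset.univ.filter fun t => 0 < a t).card
  · rw [laurentMonomial_eq_zero_of_card hx hpos]
    exact V.zero_mem
  by_cases hneg : j ≤ (Finset.univ.filter fun t => a t < 0).card
  · rw [← laurentMonomial_swap, laurentMonomial_eq_zero_of_card hy (by simpa using hneg)]
    exact V.zero_mem
  push Not at hpos hneg
  by_cases hred : IsReducedExponent i j a
  · exact hV a hred
  obtain ⟨T, hne, huniv, hT⟩ : ∃ T : Finset (Fin n), T.Nonempty ∧ T ≠ Finset.univ ∧ HasGap a T := by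
    by_contra! h
    exact hred ⟨hpos, hneg, h⟩
  obtain ⟨z, hz⟩ : ∃ z, a z = 0 := by
    by_contra! h
    have h₁ := Finset.card_filter_add_card_filter_not (s := (Finset.univ : Finset (Fin n)))
      (fun t => 0 < a t)
    have h₂ : (Finset.univ.filter fun t => ¬ 0 < a t) = Finset.univ.filter fun t => a t < 0 := by
      refine Finset.filter_congr fun t _ => ?_
      have := h t
      omega
    rw [h₂, Finset.card_univ, Fintype.card_fin] at h₁
    omega
  have hzn := z.isLt
  by_cases hzT : z ∈ T
  · have hT' : ∀ t ∈ Tᶜ, a t < 0 := by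
      intro t ht
      have h := hT z hzT t (by simpa using ht)
      simp only [shifted, hz] at h
      have := t.isLt
      by_contra!
      nlinarith
    rw [← laurentMonomial_swap]
    refine laurentMonomial_mem_of_esymm_eq_zero (T := Tᶜ) (fun t => by rw [mul_comm, hxy])
      (by simpa using hT') (hey _ ?_ ?_) fun S hS hST => ?_
    · rw [Nat.one_le_iff_ne_zero, Finset.card_ne_zero]
      rwa [Finset.nonempty_iff_ne_empty, Ne, Finset.compl_eq_empty_iff]
    · refine lt_of_le_of_lt (Finset.card_le_card fun t ht => ?_) hneg
      simpa using hT' t ht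
    · have h := ih' _ (energy_lt_of_hasGap_compl (a := a) (T := Tᶜ) (by rwa [compl_compl]) hS hST)
      rw [← laurentMonomial_swap] at h
      convert h using 2
      ext t
      simp
      ring
  · have hT' : ∀ t ∈ T, 0 < a t := by
      intro t ht
      have h := hT t ht z hzT
      simp only [shifted, hz] at h
      by_contra!
      nlinarith
    refine laurentMonomial_mem_of_esymm_eq_zero (T := T) hxy hT' (hex _ ?_ ?_) fun S hS hST =>
      ih' _ (energy_lt_of_hasGap hT hS hST)
    · rwa [Nat.one_le_iff_ne_zero, Finset.card_ne_zero]
    · refine lt_of_le_of_lt (Finset.card_le_card fun t ht => ?_) hpos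
      simpa using hT' t ht

lemma exists_span_laurentMonomial {i j : ℕ} (hij : i + j = n + 1) {x y : Fin n → R}
    (hxy : ∀ t, x t * y t = 0)
    (hx : ∀ S : Finset (Fin n), S.card = i → ∏ t ∈ S, x t = 0)
    (hy : ∀ S : Finset (Fin n), S.card = j → ∏ t ∈ S, y t = 0)
    (hex : ∀ k, 1 ≤ k → k < i → ∑ S ∈ Finset.powersetCard k Finset.univ, ∏ t ∈ S, x t = 0)
    (hey : ∀ k, 1 ≤ k → k < j → ∑ S ∈ Finset.powersetCard k Finset.univ, ∏ t ∈ S, y t = 0) :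
    ∃ f : Equiv.Perm (Fin n) → R,
      ∀ a, laurentMonomial x y a ∈ Submodule.span ℂ (Set.range f) := by
  classical
  refine ⟨fun σ => if h : ∃ a, IsReducedExponent i j a ∧ Monotone (shifted a ∘ σ) then
    laurentMonomial x y h.choose else 0,
    laurentMonomial_mem_of_isReducedExponent hij hxy hx hy hex hey fun a ha => ?_⟩
  have hσ := Tuple.monotone_sort (shifted a)
  have h : ∃ b, IsReducedExponent i j b ∧ Monotone (shifted b ∘ Tuple.sort (shifted a)) := ⟨a, ha, hσ⟩
  refine Submodule.subset_span ⟨Tuple.sort (shifted a), ?_⟩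
  dsimp only
  rw [dif_pos h]
  obtain ⟨hr, hm⟩ := h.choose_spec
  rw [le_antisymm (hr.le_of_monotone hij ha hm hσ) (ha.le_of_monotone hij hr hσ hm)]

lemma aeval_monomial_mem_span_laurentMonomial {x y : Fin n → R} (hxy : ∀ t, x t * y t = 0)
    {V : Submodule ℂ R} (hV : ∀ a, laurentMonomial x y a ∈ V)
    (p : MvPolynomial (Fin n ⊕ Fin n) ℂ) : aeval (Sum.elim x y) p ∈ V := by
  induction p using MvPolynomial.induction_on' with
  | monomial s c =>
    rw [aeval_monomial, ← Algebra.smul_def]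
    refine V.smul_mem c ?_
    rw [Finsupp.prod_fintype _ _ (fun _ => pow_zero _), Fintype.prod_sum_type]
    simp only [Sum.elim_inl, Sum.elim_inr]
    rw [← Finset.prod_mul_distrib]
    by_cases h : ∃ t, s (Sum.inl t) ≠ 0 ∧ s (Sum.inr t) ≠ 0
    · obtain ⟨t, h₁, h₂⟩ := h
      have : x t ^ s (Sum.inl t) * y t ^ s (Sum.inr t) = 0 := by
        have h₃ := mul_dvd_mul (dvd_pow_self (x t) h₁) (dvd_pow_self (y t) h₂)
        rwa [hxy, zero_dvd_iff] at h₃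
      rw [Finset.prod_eq_zero (Finset.mem_univ t) this]
      exact V.zero_mem
    · push Not at h
      convert hV fun t => (s (Sum.inl t) : ℤ) - s (Sum.inr t) using 1
      refine Finset.prod_congr rfl fun t _ => ?_
      have := h t
      congr 2 <;> dsimp only <;> omega
  | add p q hp hq => rw [map_add]; exact V.add_mem hp hq

end LaurentMonomials

section Orbit

/-- For a finite group, an invariant subspace is the kernel of an equivariant projection. -/
lemma Representation.exists_equivariant_projection {G V : Type*} [Group G] [Fintype G]
    [AddCommGroup V] [Module ℂ V] (ρ : Representation ℂ G V) (W : Submodule ℂ V)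
    (hW : ∀ g, ∀ w ∈ W, ρ g w ∈ W) :
    ∃ q : V →ₗ[ℂ] V, (∀ w ∈ W, q w = 0) ∧ (∀ v, v - q v ∈ W) ∧
      ∀ g v, q (ρ g v) = ρ g (q v) := by
  obtain ⟨f, hf⟩ := LinearMap.exists_leftInverse_of_injective W.subtype W.ker_subtype
  have hcard : (Fintype.card G : ℂ) ≠ 0 := by simp
  have hcancel : ∀ g v, ρ g (ρ g⁻¹ v) = v := fun g v => by
    rw [← Module.End.mul_apply, ← map_mul, mul_inv_cancel, map_one, Module.End.one_apply]
  set r : V →ₗ[ℂ] V :=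
    (Fintype.card G : ℂ)⁻¹ • ∑ g, ρ g ∘ₗ W.subtype ∘ₗ f ∘ₗ ρ g⁻¹ with hr
  have hr_apply : ∀ v, r v = (Fintype.card G : ℂ)⁻¹ • ∑ g, ρ g (f (ρ g⁻¹ v)) := by
    intro v
    simp [hr]
  refine ⟨LinearMap.id - r, fun w hw => ?_, fun v => ?_, fun g v => ?_⟩
  · have h : ∀ g, ρ g (f (ρ g⁻¹ w)) = w := fun g => by
      have := LinearMap.congr_fun hf ⟨ρ g⁻¹ w, hW _ w hw⟩
      simp only [LinearMap.comp_apply, Submodule.subtype_apply, LinearMap.id_apply] at this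
      rw [this, hcancel]
    rw [LinearMap.sub_apply, hr_apply, LinearMap.id_apply]
    simp only [h, Finset.sum_const, Finset.card_univ, ← Nat.cast_smul_eq_nsmul ℂ]
    rw [smul_smul, inv_mul_cancel₀ hcard, one_smul, sub_self]
  · rw [LinearMap.sub_apply, LinearMap.id_apply, sub_sub_cancel, hr_apply]
    exact W.smul_mem _ (W.sum_mem fun g _ => hW g _ (f _).2)
  · simp only [LinearMap.sub_apply, LinearMap.id_apply, map_sub, hr_apply, map_smul, map_sum]
    congr 2
    rw [← Equiv.sum_comp (Equiv.mulLeft g)]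
    refine Finset.sum_congr rfl fun h _ => ?_
    simp only [Equiv.coe_mulLeft, mul_inv_rev, map_mul, Module.End.mul_apply]
    congr 4
    rw [← Module.End.mul_apply (ρ g⁻¹), ← map_mul, inv_mul_cancel, map_one, Module.End.one_apply]

/-- The action `regAct` as a representation. -/
def regRep (n : ℕ) : Representation ℂ (Equiv.Perm (Fin n)) (Equiv.Perm (Fin n) → ℂ) where
  toFun σ := LinearMap.funLeft ℂ ℂ (σ⁻¹ * ·)
  map_one' := by ext; simp [LinearMap.funLeft]
  map_mul' σ τ := by ext; simp [LinearMap.funLeft, mul_assoc]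

lemma regRep_apply (n : ℕ) (σ : Equiv.Perm (Fin n)) (f : Equiv.Perm (Fin n) → ℂ) :
    regRep n σ f = regAct n σ f := rfl

variable {n : ℕ}

/-- The `x`-coordinates of a point of the cross with trivial stabilizer. -/
def pointX (i : ℕ) (t : Fin n) : ℂ := if (t : ℕ) + 1 < i then (t : ℕ) + 1 else 0

/-- The `y`-coordinates of a point of the cross with trivial stabilizer. -/
def pointY (i : ℕ) (t : Fin n) : ℂ := if i ≤ (t : ℕ) then (t : ℕ) else 0

lemma pointX_mul_pointY (i : ℕ) (t : Fin n) : pointX i t * pointY i t = 0 := by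
  unfold pointX pointY
  split_ifs
  · omega
  all_goals simp

lemma pointX_sub_pointY_injective {i : ℕ} (hi : 1 ≤ i) :
    Function.Injective fun t : Fin n => pointX i t - pointY i t := by
  have key : ∀ t : Fin n, pointX i t - pointY i t =
      ((if (t : ℕ) + 1 < i then (t : ℕ) + 1 else if i ≤ (t : ℕ) then -(t : ℕ) else 0 : ℤ) : ℂ) := by
    intro t
    unfold pointX pointY
    split_ifs
    · omega
    all_goals simp
  intro s t h
  simp only [key, Int.cast_inj] at h
  ext
  split_ifs at h <;> omega

/-- Restriction of polynomials to the orbit of the point `(pointX, pointY)`. -/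
def evalOrbit (n i : ℕ) :
    MvPolynomial (Fin n ⊕ Fin n) ℂ →ₐ[ℂ] (Equiv.Perm (Fin n) → ℂ) :=
  aeval (Sum.elim (fun t τ => pointX i (τ⁻¹ t)) fun t τ => pointY i (τ⁻¹ t))

lemma evalOrbit_X_inl (i : ℕ) (t : Fin n) :
    evalOrbit n i (X (Sum.inl t)) = fun τ => pointX i (τ⁻¹ t) := by
  simp [evalOrbit]

lemma evalOrbit_X_inr (i : ℕ) (t : Fin n) :
    evalOrbit n i (X (Sum.inr t)) = fun τ => pointY i (τ⁻¹ t) := by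
  simp [evalOrbit]

lemma evalOrbit_rename (i : ℕ) (σ : Equiv.Perm (Fin n)) (p : MvPolynomial (Fin n ⊕ Fin n) ℂ) :
    evalOrbit n i (rename (Sum.map σ σ) p) = regRep n σ (evalOrbit n i p) := by
  induction p using MvPolynomial.induction_on with
  | C c => ext τ; simp [evalOrbit, regRep_apply, regAct]
  | add p q hp hq => simp only [map_add, hp, hq]
  | mul_X p v hp =>
    rw [map_mul, map_mul, map_mul, hp, rename_X]
    ext τ
    rcases v with t | t <;>
      simp [evalOrbit_X_inl, evalOrbit_X_inr, regRep_apply, regAct, ← Equiv.Perm.inv_def]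

lemma evalOrbit_surjective {i : ℕ} (hi : 1 ≤ i) : Function.Surjective (evalOrbit n i) := by
  classical
  have hsep : ∀ τ τ' : Equiv.Perm (Fin n), τ' ≠ τ →
      ∃ p, evalOrbit n i p τ = 1 ∧ evalOrbit n i p τ' = 0 := by
    intro τ τ' hne
    obtain ⟨t, ht⟩ : ∃ t, τ'⁻¹ t ≠ τ⁻¹ t := by
      by_contra! h
      exact hne (inv_injective (Equiv.ext h))
    set h : MvPolynomial (Fin n ⊕ Fin n) ℂ := X (Sum.inl t) - X (Sum.inr t) with hh
    have hval : ∀ ρ, evalOrbit n i h ρ = pointX i (ρ⁻¹ t) - pointY i (ρ⁻¹ t) := fun ρ => by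
      rw [hh, map_sub, evalOrbit_X_inl, evalOrbit_X_inr]; rfl
    have hd : evalOrbit n i h τ - evalOrbit n i h τ' ≠ 0 := by
      rw [sub_ne_zero, hval, hval]
      exact fun heq => ht (pointX_sub_pointY_injective hi heq).symm
    refine ⟨(evalOrbit n i h τ - evalOrbit n i h τ')⁻¹ •
      (h - algebraMap ℂ _ (evalOrbit n i h τ')), ?_, ?_⟩
    · simp only [map_smul, map_sub, AlgHom.commutes, Pi.smul_apply, Pi.sub_apply,
        Pi.algebraMap_apply, Algebra.algebraMap_self_apply, smul_eq_mul]
      exact inv_mul_cancel₀ hd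
    · simp
  choose! p hp₁ hp₀ using hsep
  have hsingle : ∀ τ, Pi.single τ 1 ∈ LinearMap.range (evalOrbit n i).toLinearMap := by
    intro τ
    refine ⟨∏ τ' ∈ Finset.univ.erase τ, p τ τ', ?_⟩
    ext ρ
    simp only [AlgHom.toLinearMap_apply, map_prod, Finset.prod_apply]
    by_cases h : ρ = τ
    · subst h
      rw [Pi.single_eq_same]
      exact Finset.prod_eq_one fun τ' hτ' => hp₁ _ _ (Finset.ne_of_mem_erase hτ')
    · rw [Pi.single_eq_of_ne h]
      exact Finset.prod_eq_zero (Finset.mem_erase.2 ⟨h, Finset.mem_univ ρ⟩) (hp₀ _ _ h)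
  intro f
  have hf : f ∈ LinearMap.range (evalOrbit n i).toLinearMap := by
    rw [pi_eq_sum_univ' f]
    refine Submodule.sum_mem _ fun τ _ => Submodule.smul_mem _ _ ?_
    convert hsingle τ using 1
  exact hf

/-- The functions on the orbit that are restrictions of polynomials of degree less than `d`. -/
def degreeLT (n i d : ℕ) : Submodule ℂ (Equiv.Perm (Fin n) → ℂ) :=
  Submodule.span ℂ {f | ∃ m < d, ∃ p : MvPolynomial (Fin n ⊕ Fin n) ℂ,
    p.IsHomogeneous m ∧ evalOrbit n i p = f}

lemma evalOrbit_mem_degreeLT {i m d : ℕ} (hmd : m < d) {p : MvPolynomial (Fin n ⊕ Fin n) ℂ}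
    (hp : p.IsHomogeneous m) : evalOrbit n i p ∈ degreeLT n i d :=
  Submodule.subset_span ⟨m, hmd, p, hp, rfl⟩

lemma regRep_mem_degreeLT (i d : ℕ) (σ : Equiv.Perm (Fin n)) :
    ∀ f ∈ degreeLT n i d, regRep n σ f ∈ degreeLT n i d := by
  change degreeLT n i d ≤ (degreeLT n i d).comap (regRep n σ)
  refine Submodule.span_le.2 ?_
  rintro _ ⟨m, hm, p, hp, rfl⟩
  change regRep n σ _ ∈ degreeLT n i d
  rw [← evalOrbit_rename]
  exact evalOrbit_mem_degreeLT hm hp.rename_isHomogeneous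

/-- The regular representation is an equivariant quotient of the polynomial ring, by a map that
kills the multiples of all homogeneous polynomials of positive degree constant on the orbit. -/
lemma exists_equivariant_surjection {i : ℕ} (hi : 1 ≤ i) :
    ∃ φ : MvPolynomial (Fin n ⊕ Fin n) ℂ →ₗ[ℂ] (Equiv.Perm (Fin n) → ℂ),
      Function.Surjective φ ∧
      (∀ (σ : Equiv.Perm (Fin n)) p, φ (rename (Sum.map σ σ) p) = regRep n σ (φ p)) ∧
      ∀ g k, k ≠ 0 → g.IsHomogeneous k → (∃ c, evalOrbit n i g = algebraMap ℂ _ c) →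
        ∀ p, φ (p * g) = 0 := by
  choose q hq₀ hq hqσ using fun d => (regRep n).exists_equivariant_projection (degreeLT n i d)
    (regRep_mem_degreeLT i d)
  set φ : MvPolynomial (Fin n ⊕ Fin n) ℂ →ₗ[ℂ] (Equiv.Perm (Fin n) → ℂ) :=
    (basisMonomials _ ℂ).constr ℂ fun s => q s.degree (evalOrbit n i (monomial s 1)) with hφ
  have hφm : ∀ s c, φ (monomial s c) = q s.degree (evalOrbit n i (monomial s c)) := by
    intro s c
    have h₁ : φ (monomial s 1) = q s.degree (evalOrbit n i (monomial s 1)) := by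
      have := (basisMonomials (Fin n ⊕ Fin n) ℂ).constr_basis ℂ
        (fun s => q s.degree (evalOrbit n i (monomial s 1))) s
      rwa [coe_basisMonomials] at this
    have h₂ : (monomial s c : MvPolynomial (Fin n ⊕ Fin n) ℂ) = c • monomial s 1 := by
      rw [smul_monomial, smul_eq_mul, mul_one]
    rw [h₂, map_smul, h₁, map_smul, map_smul]
  have hφd : ∀ d p, IsHomogeneous p d → φ p = q d (evalOrbit n i p) := by
    intro d p hp
    conv_lhs => rw [p.as_sum]
    conv_rhs => rw [p.as_sum]
    simp only [map_sum]
    refine Finset.sum_congr rfl fun s hs => ?_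
    have := hp (mem_support_iff.1 hs)
    rw [hφm, ← this, Finsupp.degree_eq_weight_one]
    rfl
  refine ⟨φ, ?_, fun σ p => ?_, ?_⟩
  · have hW : ∀ d, degreeLT n i d ≤ LinearMap.range φ := by
      intro d
      induction d using Nat.strong_induction_on with
      | _ d ih =>
      refine Submodule.span_le.2 ?_
      rintro _ ⟨m, hm, p, hp, rfl⟩
      have := (LinearMap.range φ).add_mem (ih m hm (hq m (evalOrbit n i p))) ⟨p, hφd m p hp⟩
      rwa [sub_add_cancel] at this
    intro f
    obtain ⟨p, rfl⟩ := evalOrbit_surjective hi f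
    rw [p.as_sum, map_sum]
    refine (LinearMap.range φ).sum_mem fun s _ => hW (s.degree + 1)
      (evalOrbit_mem_degreeLT (Nat.lt_succ_self _) (isHomogeneous_monomial _ rfl))
  · induction p using MvPolynomial.induction_on' with
    | monomial s c =>
      have h : (monomial s c : MvPolynomial (Fin n ⊕ Fin n) ℂ).IsHomogeneous s.degree :=
        isHomogeneous_monomial _ rfl
      rw [hφd _ _ h.rename_isHomogeneous, hφd _ _ h, evalOrbit_rename, hqσ]
    | add p p' hp hp' => simp only [map_add, hp, hp']
  · rintro g k hk hg ⟨c, hc⟩ p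
    induction p using MvPolynomial.induction_on' with
    | monomial s a =>
      have h : (monomial s a : MvPolynomial (Fin n ⊕ Fin n) ℂ).IsHomogeneous s.degree :=
        isHomogeneous_monomial _ rfl
      rw [hφd _ _ (h.mul hg), map_mul, hc, ← Algebra.commutes, ← Algebra.smul_def]
      exact hq₀ _ _ (Submodule.smul_mem _ _ (evalOrbit_mem_degreeLT (by omega) h))
    | add p p' hp hp' => rw [add_mul, map_add, hp, hp', add_zero]

lemma aeval_comp_perm_of_isSymmetric {p : MvPolynomial (Fin n) ℂ} (hp : p.IsSymmetric)
    (v : Fin n → ℂ) (τ : Equiv.Perm (Fin n)) : aeval (fun t => v (τ t)) p = aeval v p := by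
  conv_rhs => rw [← hp τ, aeval_rename]
  rfl

lemma evalOrbit_rename_apply {i : ℕ} (s : Fin n → Fin n ⊕ Fin n) (p : MvPolynomial (Fin n) ℂ)
    (τ : Equiv.Perm (Fin n)) :
    evalOrbit n i (rename s p) τ = aeval (fun t => evalOrbit n i (X (s t)) τ) p := by
  induction p using MvPolynomial.induction_on with
  | C c => simp [evalOrbit]
  | add p q hp hq => simp only [map_add, Pi.add_apply, hp, hq]
  | mul_X p v hp => simp only [map_mul, Pi.mul_apply, hp, rename_X, aeval_X]

lemma evalOrbit_esymm (i k : ℕ) (s : Fin n → Fin n ⊕ Fin n) (v : Fin n → ℂ)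
    (hs : ∀ t, evalOrbit n i (X (s t)) = fun τ => v (τ⁻¹ t)) :
    ∃ c, evalOrbit n i (rename s (esymm (Fin n) ℂ k)) = algebraMap ℂ _ c := by
  refine ⟨aeval v (esymm (Fin n) ℂ k), ?_⟩
  ext τ
  rw [evalOrbit_rename_apply]
  simp only [hs]
  exact aeval_comp_perm_of_isSymmetric (esymm_isSymmetric _ _ k) v τ⁻¹

lemma evalOrbit_prod (i k : ℕ) (s : Fin n → Fin n ⊕ Fin n) (v : Fin n → ℂ)
    (hs : ∀ t, evalOrbit n i (X (s t)) = fun τ => v (τ⁻¹ t))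
    (hv : (Finset.univ.filter fun t => v t ≠ 0).card < k) {S : Finset (Fin n)} (hS : S.card = k) :
    ∃ c, evalOrbit n i (∏ t ∈ S, X (s t)) = algebraMap ℂ _ c := by
  refine ⟨0, ?_⟩
  rw [map_zero]
  ext τ
  simp only [map_prod, hs, Finset.prod_apply, Pi.zero_apply]
  by_contra h
  rw [← ne_eq, Finset.prod_ne_zero_iff] at h
  have hsub : S.map τ⁻¹.toEmbedding ⊆ Finset.univ.filter fun t => v t ≠ 0 := by
    intro t ht
    obtain ⟨u, hu, rfl⟩ := Finset.mem_map.1 ht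
    simpa using h u hu
  have := Finset.card_le_card hsub
  rw [Finset.card_map] at this
  omega

lemma card_pointX_ne_zero_lt {i : ℕ} (hi : 1 ≤ i) :
    (Finset.univ.filter fun t : Fin n => pointX i t ≠ 0).card < i := by
  have hsub : (Finset.univ.filter fun t : Fin n => pointX i t ≠ 0).map Fin.valEmbedding ⊆
      Finset.range (i - 1) := by
    intro m hm
    obtain ⟨t, ht, rfl⟩ := Finset.mem_map.1 hm
    simp only [pointX, Finset.mem_filter, Finset.mem_univ, true_and, ne_eq, ite_eq_right_iff,
      not_forall] at ht
    obtain ⟨h, -⟩ := ht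
    simp only [Fin.valEmbedding_apply, Finset.mem_range]
    omega
  have := Finset.card_le_card hsub
  rw [Finset.card_map, Finset.card_range] at this
  omega

lemma card_pointY_ne_zero_lt {i j : ℕ} (hj : 1 ≤ j) (hij : i + j = n + 1) :
    (Finset.univ.filter fun t : Fin n => pointY i t ≠ 0).card < j := by
  have hsub : (Finset.univ.filter fun t : Fin n => pointY i t ≠ 0).map Fin.valEmbedding ⊆
      Finset.Ico i n := by
    intro m hm
    obtain ⟨t, ht, rfl⟩ := Finset.mem_map.1 hm
    simp only [pointY, Finset.mem_filter, Finset.mem_univ, true_and, ne_eq, ite_eq_right_iff,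
      not_forall] at ht
    obtain ⟨h, -⟩ := ht
    simp only [Fin.valEmbedding_apply, Finset.mem_Ico]
    exact ⟨h, t.isLt⟩
  have := Finset.card_le_card hsub
  rw [Finset.card_map, Nat.card_Ico] at this
  omega

end Orbit

section Quotient

/-- The largest ideal on which a linear map vanishes. -/
def LinearMap.kerIdeal {A V : Type*} [CommRing A] [Algebra ℂ A] [AddCommGroup V] [Module ℂ V]
    (φ : A →ₗ[ℂ] V) : Ideal A where
  carrier := {g | ∀ p, φ (p * g) = 0}
  zero_mem' p := by rw [mul_zero, map_zero]
  add_mem' ha hb p := by rw [mul_add, map_add, ha p, hb p, add_zero]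
  smul_mem' a g hg p := by rw [smul_eq_mul, ← mul_assoc]; exact hg _

lemma mkB_rename_esymm (n k : ℕ) (s : Fin n → Fin n ⊕ Fin n) :
    mkB n (rename s (esymm (Fin n) ℂ k)) =
      ∑ S ∈ Finset.powersetCard k Finset.univ, ∏ t ∈ S, mkB n (X (s t)) := by
  simp only [esymm, map_sum, map_prod, rename_X]

variable {n i j : ℕ}

/-- The projection from the polynomial ring to the quotient by `Iij`. -/
def mkR (n i j : ℕ) : MvPolynomial (Fin n ⊕ Fin n) ℂ →ₐ[ℂ] B n ⧸ Iij n i j :=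
  (Ideal.Quotient.mkₐ ℂ (Iij n i j)).comp (mkB n)

lemma mkR_surjective : Function.Surjective (mkR n i j) :=
  (Ideal.Quotient.mkₐ_surjective ℂ _).comp (Ideal.Quotient.mkₐ_surjective ℂ _)

lemma mkR_eq_zero {p : MvPolynomial (Fin n ⊕ Fin n) ℂ} (hp : mkB n p ∈ Sij n i j) :
    mkR n i j p = 0 :=
  Ideal.Quotient.eq_zero_iff_mem.2 (Ideal.subset_span hp)

lemma exists_span_range_perm_eq_top (hij : i + j = n + 1) :
    ∃ f : Equiv.Perm (Fin n) → B n ⧸ Iij n i j, Submodule.span ℂ (Set.range f) = ⊤ := by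
  have hxy : ∀ t : Fin n, mkR n i j (X (Sum.inl t)) * mkR n i j (X (Sum.inr t)) = 0 := by
    intro t
    have : mkB n (X (Sum.inl t) * X (Sum.inr t)) = 0 :=
      Ideal.Quotient.eq_zero_iff_mem.2 (Ideal.subset_span ⟨t, rfl⟩)
    rw [← map_mul, mkR, AlgHom.comp_apply, this, map_zero]
  obtain ⟨f, hf⟩ := exists_span_laurentMonomial (x := fun t => mkR n i j (X (Sum.inl t)))
    (y := fun t => mkR n i j (X (Sum.inr t))) hij hxy
    (fun S hS => by
      rw [← map_prod]
      exact mkR_eq_zero (Or.inl (Or.inl (Or.inr ⟨S, hS, map_prod _ _ _⟩))))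
    (fun S hS => by
      rw [← map_prod]
      exact mkR_eq_zero (Or.inr ⟨S, hS, map_prod _ _ _⟩))
    (fun k hk hki => by
      simp only [← map_prod, ← map_sum]
      refine mkR_eq_zero (Or.inl (Or.inl (Or.inl ⟨k, hk, hki, ?_⟩)))
      simp only [map_sum, map_prod]
      rfl)
    (fun k hk hkj => by
      simp only [← map_prod, ← map_sum]
      refine mkR_eq_zero (Or.inl (Or.inr ⟨k, hk, hkj, ?_⟩))
      simp only [map_sum, map_prod]
      rfl)
  refine ⟨f, eq_top_iff.2 fun r _ => ?_⟩
  obtain ⟨p, rfl⟩ := mkR_surjective r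
  have h := aeval_monomial_mem_span_laurentMonomial hxy hf p
  convert h using 1
  refine AlgHom.congr_fun (MvPolynomial.algHom_ext fun v => ?_) p
  rcases v with t | t <;> simp

lemma Iij_le_map (hi : 1 ≤ i) (hj : 1 ≤ j) (hij : i + j = n + 1)
    {K : Ideal (MvPolynomial (Fin n ⊕ Fin n) ℂ)}
    (hK : ∀ g k, k ≠ 0 → g.IsHomogeneous k → (∃ c, evalOrbit n i g = algebraMap ℂ _ c) → g ∈ K) :
    Iij n i j ≤ K.map (mkB n) := by
  have hprod : ∀ (s : Fin n → Fin n ⊕ Fin n) (S : Finset (Fin n)),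
      (∏ t ∈ S, X (s t) : MvPolynomial (Fin n ⊕ Fin n) ℂ).IsHomogeneous S.card := by
    intro s S
    have := IsHomogeneous.prod S (fun t => (X (s t) : MvPolynomial (Fin n ⊕ Fin n) ℂ)) (fun _ => 1)
      fun t _ => isHomogeneous_X _ _
    simpa using this
  have hesymm : ∀ (s : Fin n → Fin n ⊕ Fin n) (k : ℕ),
      (rename s (esymm (Fin n) ℂ k)).IsHomogeneous k := by
    intro s k
    simp only [esymm, map_sum, map_prod, rename_X]
    refine IsHomogeneous.sum _ _ _ fun S hS => ?_
    rw [← (Finset.mem_powersetCard.1 hS).2]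
    exact hprod s S
  refine Ideal.span_le.2 ?_
  rintro _ (((⟨k, hk, -, rfl⟩ | ⟨S, hS, rfl⟩) | ⟨k, hk, -, rfl⟩) | ⟨S, hS, rfl⟩)
  · have h := Ideal.mem_map_of_mem (mkB n) (hK _ k (by omega) (hesymm Sum.inl k)
      (evalOrbit_esymm i k _ _ (evalOrbit_X_inl i)))
    rwa [mkB_rename_esymm] at h
  · have h := Ideal.mem_map_of_mem (mkB n) (hK _ _ (by omega) (hprod Sum.inl S)
      (evalOrbit_prod i i _ _ (evalOrbit_X_inl i) (card_pointX_ne_zero_lt hi) hS))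
    rwa [map_prod] at h
  · have h := Ideal.mem_map_of_mem (mkB n) (hK _ k (by omega) (hesymm Sum.inr k)
      (evalOrbit_esymm i k _ _ (evalOrbit_X_inr i)))
    rwa [mkB_rename_esymm] at h
  · have h := Ideal.mem_map_of_mem (mkB n) (hK _ _ (by omega) (hprod Sum.inr S)
      (evalOrbit_prod i j _ _ (evalOrbit_X_inr i) (card_pointY_ne_zero_lt hj hij) hS))
    rwa [map_prod] at h

lemma ker_mkR_le (hi : 1 ≤ i) (hj : 1 ≤ j) (hij : i + j = n + 1)
    {K : Ideal (MvPolynomial (Fin n ⊕ Fin n) ℂ)}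
    (hK : ∀ g k, k ≠ 0 → g.IsHomogeneous k → (∃ c, evalOrbit n i g = algebraMap ℂ _ c) → g ∈ K)
    {p : MvPolynomial (Fin n ⊕ Fin n) ℂ} (hp : mkR n i j p = 0) : p ∈ K := by
  have hB : Bideal n ≤ K := by
    refine Ideal.span_le.2 ?_
    rintro _ ⟨t, rfl⟩
    refine hK _ 2 two_ne_zero ((isHomogeneous_X _ _).mul (isHomogeneous_X _ _)) ⟨0, ?_⟩
    rw [map_zero, map_mul, evalOrbit_X_inl, evalOrbit_X_inr]
    ext τ
    exact pointX_mul_pointY i _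
  have h := Iij_le_map hi hj hij hK (Ideal.Quotient.eq_zero_iff_mem.1 hp)
  obtain ⟨g, hg, hgp⟩ :=
    (Ideal.mem_map_iff_of_surjective (mkB n) (Ideal.Quotient.mkₐ_surjective ℂ _)).1 h
  have := K.add_mem (hB (Ideal.Quotient.eq.1 hgp.symm)) hg
  rwa [sub_add_cancel] at this

end Quotient

/-- For `i, j ≥ 1` with `i + j = n + 1`, the quotient
`R^n_{i,j} = Bₙ/I^n_{i,j}` has dimension `n!` over `ℂ` and is isomorphic as a
`ℂ[Sₙ]`-module to the regular representation `ℂ[Sₙ]`. -/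
theorem Rij_extreme_is_regular (n i j : ℕ) (hi : 1 ≤ i) (hj : 1 ≤ j) (hij : i + j = n + 1) :
    Module.finrank ℂ (B n ⧸ Iij n i j) = n.factorial ∧
    ∃ e : (B n ⧸ Iij n i j) ≃ₗ[ℂ] (Equiv.Perm (Fin n) → ℂ),
      ∀ (σ : Equiv.Perm (Fin n)) (P : B n),
        e (Ideal.Quotient.mk (Iij n i j) (permB n σ P)) =
          regAct n σ (e (Ideal.Quotient.mk (Iij n i j) P)) := by
  obtain ⟨φ, hφ, hφσ, hφK⟩ := exists_equivariant_surjection (n := n) hi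
  obtain ⟨f, hf⟩ := exists_span_range_perm_eq_top (n := n) hij
  have hker : LinearMap.ker (mkR n i j).toLinearMap ≤ LinearMap.ker φ := by
    intro p hp
    have h : p ∈ φ.kerIdeal := ker_mkR_le (K := φ.kerIdeal) hi hj hij hφK hp
    simpa using h 1
  obtain ⟨ψ, hψ⟩ : ∃ ψ : (B n ⧸ Iij n i j) →ₗ[ℂ] (Equiv.Perm (Fin n) → ℂ),
      ∀ p, ψ (mkR n i j p) = φ p := by
    refine ⟨(LinearMap.ker (mkR n i j).toLinearMap).liftQ φ hker ∘ₗ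
      ((mkR n i j).toLinearMap.quotKerEquivOfSurjective mkR_surjective).symm.toLinearMap,
      fun p => ?_⟩
    have h : ((mkR n i j).toLinearMap.quotKerEquivOfSurjective mkR_surjective).symm
        (mkR n i j p) = Submodule.Quotient.mk p := by
      rw [LinearEquiv.symm_apply_eq]
      rfl
    rw [LinearMap.comp_apply, LinearEquiv.coe_coe, h, Submodule.liftQ_apply]
  have hsurj : Function.Surjective ψ := fun v => by
    obtain ⟨p, rfl⟩ := hφ v
    exact ⟨_, hψ p⟩
  have hfin : Module.Finite ℂ (B n ⧸ Iij n i j) :=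
    ⟨hf ▸ Submodule.fg_span (Set.finite_range f)⟩
  have hcard : Module.finrank ℂ (Equiv.Perm (Fin n) → ℂ) = n.factorial := by
    rw [Module.finrank_fintype_fun_eq_card, Fintype.card_perm, Fintype.card_fin]
  have hle : Module.finrank ℂ (B n ⧸ Iij n i j) ≤ n.factorial := by
    have h := finrank_range_le_card (R := ℂ) f
    rwa [Set.finrank, hf, finrank_top, Fintype.card_perm, Fintype.card_fin] at h
  have heq : Module.finrank ℂ (B n ⧸ Iij n i j) = n.factorial :=
    le_antisymm hle (hcard ▸ LinearMap.finrank_le_finrank_of_surjective hsurj)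
  have hinj : Function.Injective ψ :=
    (LinearMap.injective_iff_surjective_of_finrank_eq_finrank (heq.trans hcard.symm)).2 hsurj
  refine ⟨heq, LinearEquiv.ofBijective ψ ⟨hinj, hsurj⟩, fun σ P => ?_⟩
  obtain ⟨p, rfl⟩ := Ideal.Quotient.mkₐ_surjective ℂ (Bideal n) P
  change ψ (mkR n i j (rename (Sum.map σ σ) p)) = regRep n σ (ψ (mkR n i j p))
  rw [hψ, hψ, hφσ]

end
end

section
/- For i, j ≥ 1 with i + j ≤ n, the quotient R^n_{i,j} = B_n/I^n_{i,j} has dimension n!/(n−i−j+2)! over ℂ and is isomorphic as a ℂ[S_n]-module to the permutation module ℂ[S_n/S_{n−i−j+2}] (the induction of the trivial module from the subgroup S_{n−i−j+2} fixing the first i+j−2 letters). -/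
open MvPolynomial

set_option maxHeartbeats 1000000
set_option synthInstance.maxHeartbeats 400000

noncomputable section

/-- `W` is contained in the span of at most `d` vectors. -/
def SpanLE {k M : Type*} [Semiring k] [AddCommMonoid M] [Module k M]
    (W : Submodule k M) (d : ℕ) : Prop :=
  ∃ s : Finset M, s.card ≤ d ∧ W ≤ Submodule.span k (s : Set M)

section Coinvariants

variable {k S : Type*} [Field k] [CommRing S] [Algebra k S]

lemma coeff_mem_of_X_add_C_mul {D : Subalgebra k S} {x : S} (hx : x ∈ D) {p : Polynomial S}
    (h : ∀ m, ((Polynomial.X + Polynomial.C x) * p).coeff m ∈ D) (m : ℕ) : p.coeff m ∈ D := by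
  suffices H : ∀ t m, p.natDegree < m + t → p.coeff m ∈ D from H (p.natDegree + 1) m (by omega)
  intro t
  induction t with
  | zero =>
    intro m hm
    rw [Polynomial.coeff_eq_zero_of_natDegree_lt (by simpa using hm)]
    exact D.zero_mem
  | succ t ih =>
    intro m hm
    have h1 := h (m + 1)
    rw [add_mul, Polynomial.coeff_add, Polynomial.coeff_X_mul, Polynomial.coeff_C_mul] at h1
    have h2 := D.sub_mem h1 (D.mul_mem hx (ih (m + 1) (by omega)))
    simpa using h2

open scoped Pointwise in
lemma SpanLE.sup_adjoin_root {D : Subalgebra k S} {d : ℕ} (hD : SpanLE D.toSubmodule d)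
    {p : Polynomial S} (hp : p.Monic) (hc : ∀ m, p.coeff m ∈ D) {r : S} (hr : p.eval r = 0) :
    SpanLE (D ⊔ Algebra.adjoin k {r}).toSubmodule (d * p.natDegree) := by
  classical
  obtain ⟨s, hs, hDs⟩ := hD
  set N := p.natDegree with hN
  set t : Finset S := (Finset.range N).image (fun m => r ^ m) with ht
  refine ⟨s * t, Finset.card_mul_le.trans (Nat.mul_le_mul hs
    (Finset.card_image_le.trans (by simp))), ?_⟩
  set V := D.toSubmodule * Submodule.span k (t : Set S) with hV
  have hVs : V ≤ Submodule.span k ((s * t : Finset S) : Set S) := by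
    rw [Finset.coe_mul, ← Submodule.span_mul_span]
    exact mul_le_mul_left hDs _
  refine le_trans ?_ hVs
  have hDV : ∀ a ∈ D, ∀ v ∈ V, a * v ∈ V := by
    intro a ha v hv
    have h1 : a * v ∈ D.toSubmodule * V := Submodule.mul_mem_mul ha hv
    rwa [hV, ← mul_assoc, D.isIdempotentElem_toSubmodule] at h1
  have hlow : ∀ a ∈ D, ∀ m < N, a * r ^ m ∈ V := fun a ha m hm =>
    Submodule.mul_mem_mul ha (Submodule.subset_span (by
      simp only [ht, Finset.coe_image, Finset.coe_range]; exact ⟨m, hm, rfl⟩))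
  have hrN : r ^ N ∈ V := by
    have h1 : r ^ N = - ∑ m ∈ Finset.range N, p.coeff m * r ^ m := by
      rw [Polynomial.eval_eq_sum_range, Finset.sum_range_succ, ← hN, hN,
        hp.coeff_natDegree, one_mul] at hr
      exact eq_neg_of_add_eq_zero_right hr
    rw [h1]
    exact V.neg_mem (V.sum_mem fun m hm => hlow _ (hc m) m (Finset.mem_range.1 hm))
  have hVr : ∀ v ∈ V, v * r ∈ V := by
    intro v hv
    induction hv using Submodule.mul_induction_on' with
    | mem_mul_mem a ha b hb =>
      rw [mul_assoc]
      refine hDV a ha _ ?_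
      induction hb using Submodule.span_induction with
      | mem b hb =>
        simp only [ht, Finset.coe_image, Finset.coe_range] at hb
        obtain ⟨m, hm, rfl⟩ := hb
        change r ^ m * r ∈ V
        rw [← pow_succ]
        rcases Nat.lt_or_ge (m + 1) N with h | h
        · simpa using hlow 1 D.one_mem _ h
        · have : m + 1 = N := le_antisymm hm h
          rwa [this]
      | zero => simp
      | add b c _ _ hb hc => rw [add_mul]; exact V.add_mem hb hc
      | smul a b _ hb => rw [smul_mul_assoc]; exact V.smul_mem a hb
    | add b _ c _ hb hc => rw [add_mul]; exact V.add_mem hb hc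
  have hpow : ∀ m, r ^ m ∈ V := by
    intro m
    induction m with
    | zero =>
      rcases Nat.eq_zero_or_pos N with h | h
      · rw [h] at hrN; exact hrN
      · simpa using hlow 1 D.one_mem 0 h
    | succ m ih => rw [pow_succ]; exact hVr _ ih
  rw [← Subalgebra.mul_toSubmodule, Submodule.mul_le]
  intro a ha b hb
  refine hDV a ha b ?_
  rw [Algebra.adjoin_eq_span] at hb
  refine (Submodule.span_le.2 ?_) hb
  intro z hz
  obtain ⟨m, rfl⟩ := Submonoid.mem_closure_singleton.1 hz
  exact hpow m

lemma SpanLE.sup_adjoin_roots {ι : Type*} [DecidableEq ι] (x : ι → S) (A : Finset ι)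
    {D : Subalgebra k S} {d : ℕ} (hD : SpanLE D.toSubmodule d)
    (hc : ∀ m, (∏ i ∈ A, (Polynomial.X + Polynomial.C (x i))).coeff m ∈ D) :
    SpanLE (D ⊔ Algebra.adjoin k (x '' A)).toSubmodule (d * A.card.factorial) := by
  induction A using Finset.induction_on generalizing D d with
  | empty => simpa using hD
  | insert i A hi ih =>
    rcases subsingleton_or_nontrivial S with hS | hS
    · exact ⟨∅, by simp, fun z _ => by rw [Subsingleton.elim z 0]; exact zero_mem _⟩
    have hm : (∏ i ∈ insert i A, (Polynomial.X + Polynomial.C (x i))).Monic :=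
      Polynomial.monic_prod_of_monic _ _ fun j _ => Polynomial.monic_X_add_C _
    have hdeg : (∏ i ∈ insert i A, (Polynomial.X + Polynomial.C (x i))).natDegree
        = A.card + 1 := by
      rw [Polynomial.natDegree_prod_of_monic _ _ fun j _ => Polynomial.monic_X_add_C _]
      simp [hi]
    have h1 := hD.sup_adjoin_root hm hc (r := - x i) (by
      rw [Finset.prod_insert hi]; simp)
    rw [hdeg] at h1
    have hxi : x i ∈ D ⊔ Algebra.adjoin k {-x i} := by
      have : - x i ∈ D ⊔ Algebra.adjoin k {-x i} :=
        (le_sup_right : _ ≤ D ⊔ Algebra.adjoin k {-x i}) (Algebra.subset_adjoin rfl)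
      simpa using neg_mem this
    have h2 := ih h1 (coeff_mem_of_X_add_C_mul hxi (fun m => by
      have := hc m
      rw [Finset.prod_insert hi] at this
      exact (le_sup_left : D ≤ _) this))
    obtain ⟨s, hs, hle⟩ := h2
    refine ⟨s, hs.trans (le_of_eq ?_), le_trans ?_ hle⟩
    · rw [Finset.card_insert_of_notMem hi, Nat.factorial_succ, mul_assoc]
    · refine Subalgebra.toSubmodule.monotone (sup_le (le_sup_left.trans le_sup_left) ?_)
      rw [Algebra.adjoin_le_iff]
      rintro _ ⟨j, hj, rfl⟩
      rcases Finset.mem_insert.1 hj with rfl | hj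
      · exact (le_sup_left : _ ≤ _ ⊔ Algebra.adjoin k (x '' A)) hxi
      · exact (le_sup_right : Algebra.adjoin k (x '' A) ≤ _)
          (Algebra.subset_adjoin ⟨j, hj, rfl⟩)

lemma coeff_prod_X_add_C_mem_bot {ι : Type*} (x : ι → S) (A : Finset ι)
    (h : ∀ m, 1 ≤ m → m ≤ A.card → ∑ I ∈ A.powersetCard m, ∏ i ∈ I, x i = 0) (m : ℕ) :
    (∏ i ∈ A, (Polynomial.X + Polynomial.C (x i))).coeff m ∈ (⊥ : Subalgebra k S) := by
  rcases lt_trichotomy m A.card with hm | rfl | hm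
  · rw [Finset.prod_X_add_C_coeff A x hm.le, h _ (by omega) (by omega)]
    exact Subalgebra.zero_mem _
  · rw [Finset.prod_X_add_C_coeff A x le_rfl]
    simp
  · nontriviality S
    rw [Polynomial.coeff_eq_zero_of_natDegree_lt]
    · exact Subalgebra.zero_mem _
    · rw [Polynomial.natDegree_prod_of_monic _ _ fun j _ => Polynomial.monic_X_add_C _]
      simpa using hm

lemma spanLE_top_of_esymm_eq_zero {ι : Type*} [DecidableEq ι] (x y : ι → S) (A B : Finset ι)
    (hx : ∀ m, 1 ≤ m → m ≤ A.card → ∑ I ∈ A.powersetCard m, ∏ i ∈ I, x i = 0)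
    (hy : ∀ m, 1 ≤ m → m ≤ B.card → ∑ I ∈ B.powersetCard m, ∏ i ∈ I, y i = 0)
    (hgen : Algebra.adjoin k (x '' A ∪ y '' B) = ⊤) :
    SpanLE (⊤ : Submodule k S) (A.card.factorial * B.card.factorial) := by
  have h0 : SpanLE (⊥ : Subalgebra k S).toSubmodule 1 :=
    ⟨{1}, by simp, by rw [Algebra.toSubmodule_bot]; simp [Submodule.one_eq_span]⟩
  have h1 := h0.sup_adjoin_roots x A (coeff_prod_X_add_C_mem_bot x A hx)
  have h2 := h1.sup_adjoin_roots y B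
    (fun m => SetLike.le_def.1 bot_le (coeff_prod_X_add_C_mem_bot (k := k) y B hy m))
  rw [bot_sup_eq, ← Algebra.adjoin_union, hgen, one_mul] at h2
  simpa using h2

end Coinvariants
section Shelling

variable {ι S : Type*} [Fintype ι] [DecidableEq ι] [CommRing S]

/-- The product of the `x i`, `i ∈ A`, such that some `u` outside `A ∪ B` has smaller weight, and
of the `y j`, `j ∈ B`, such that some `u` outside `A ∪ B` has larger weight. It is the minimal new
face attached by the facet `(A, B)` in a shelling of the complex of pairs of disjoint sets of
bounded sizes. -/
def restr (c : ι → ℤ) (x y : ι → S) (A B : Finset ι) : S :=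
  (∏ i ∈ A with ∃ u, u ∉ A ∧ u ∉ B ∧ c u < c i, x i) *
    ∏ j ∈ B with ∃ u, u ∉ A ∧ u ∉ B ∧ c j < c u, y j

lemma restr_swap (c : ι → ℤ) (x y : ι → S) (A B : Finset ι) :
    restr (-c) y x B A = restr c x y A B := by
  unfold restr
  rw [mul_comm]
  congr 1 <;>
  · refine Finset.prod_congr (Finset.filter_congr fun i _ => ?_) fun _ _ => rfl
    simp only [Pi.neg_apply, neg_lt_neg_iff]
    exact exists_congr fun u => by tauto

/-- The weight by which facets are ordered in the shelling. -/
def facetWeight (c : ι → ℤ) (A B : Finset ι) : ℤ := ∑ i ∈ A, c i - ∑ i ∈ B, c i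

omit [Fintype ι] [DecidableEq ι] in
lemma facetWeight_swap (c : ι → ℤ) (A B : Finset ι) :
    facetWeight (-c) B A = facetWeight c A B := by
  simp [facetWeight]; ring

lemma restr_mul_left {a b : ℕ} {c : ι → ℤ} (hc : Function.Injective c) {x y : ι → S}
    (hx : ∀ I : Finset ι, I.card = a + 1 → ∏ i ∈ I, x i = 0) (hxy : ∀ i, x i * y i = 0)
    {A B : Finset ι} (hA : A.card = a) (hB : B.card = b) (hAB : Disjoint A B)
    (hU : ∃ u, u ∉ A ∧ u ∉ B) {i : ι} (hi : i ∉ A) :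
    restr c x y A B * x i = 0 ∨ ∃ A' B' : Finset ι, A'.card = a ∧ B'.card = b ∧ Disjoint A' B' ∧
      facetWeight c A B < facetWeight c A' B' ∧
      restr c x y A' B' ∣ restr c x y A B * x i := by
  have hAB' := Finset.disjoint_left.1 hAB
  have hne : ∀ u v : ι, u ≠ v → c u ≠ c v := fun u v h h' => h (hc h')
  by_cases h1 : i ∈ B ∧ ∃ u, u ∉ A ∧ u ∉ B ∧ c i < c u
  · left
    have h2 : y i ∣ ∏ j ∈ B with ∃ u, u ∉ A ∧ u ∉ B ∧ c j < c u, y j :=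
      Finset.dvd_prod_of_mem _ (by simpa using h1)
    obtain ⟨z, hz⟩ := h2
    rw [restr, hz]
    linear_combination (∏ i ∈ A with ∃ u, u ∉ A ∧ u ∉ B ∧ c u < c i, x i) * z * hxy i
  rcases (A.filter (fun i => ¬ ∃ u, u ∉ A ∧ u ∉ B ∧ c u < c i)).eq_empty_or_nonempty with h2 | h2
  · left
    have h3 : A.filter (fun i => ∃ u, u ∉ A ∧ u ∉ B ∧ c u < c i) = A := by
      rw [Finset.filter_eq_self]
      intro j hj
      by_contra h
      exact Finset.notMem_empty j (h2 ▸ Finset.mem_filter.2 ⟨hj, h⟩)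
    have h4 := hx (insert i A) (by rw [Finset.card_insert_of_notMem hi, hA])
    rw [Finset.prod_insert hi] at h4
    rw [restr, h3]
    linear_combination (∏ j ∈ B with ∃ u, u ∉ A ∧ u ∉ B ∧ c j < c u, y j) * h4
  right
  obtain ⟨l, hl, hmax⟩ := Finset.exists_max_image _ c h2
  rw [Finset.mem_filter] at hl
  obtain ⟨hlA, hlU⟩ := hl
  have hlB := hAB' hlA
  push Not at hlU
  have hil : i ≠ l := fun h => hi (h ▸ hlA)
  have hcardA : (insert i (A.erase l)).card = a := by
    rw [Finset.card_insert_of_notMem (by simp [hi]), Finset.card_erase_add_one hlA, hA]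
  have hsumA : ∑ j ∈ insert i (A.erase l), c j = ∑ j ∈ A, c j - c l + c i := by
    rw [Finset.sum_insert (by simp [hi]), ← Finset.add_sum_erase A c hlA]; ring
  have hmax' : ∀ j ∈ A, c l < c j → ∃ u, u ∉ A ∧ u ∉ B ∧ c u < c j := by
    intro j hj hlt
    by_contra h
    exact absurd (hmax j (Finset.mem_filter.2 ⟨hj, h⟩)) (not_le.2 hlt)
  have hdvd : ∀ B' : Finset ι, (∀ u, u ∉ B' → u ≠ i → u ∉ B) →
      (∀ j ∈ B', (∃ u, u ∉ insert i (A.erase l) ∧ u ∉ B' ∧ c j < c u) →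
        j ∈ B ∧ ∃ u, u ∉ A ∧ u ∉ B ∧ c j < c u) →
      restr c x y (insert i (A.erase l)) B' ∣ restr c x y A B * x i := by
    intro B' h3 h4
    have h5 : (∏ j ∈ A with ∃ u, u ∉ A ∧ u ∉ B ∧ c u < c j, x j) * x i =
        ∏ j ∈ insert i (A.filter fun j => ∃ u, u ∉ A ∧ u ∉ B ∧ c u < c j), x j := by
      rw [Finset.prod_insert (by simp [hi]), mul_comm]
    rw [restr, restr, mul_right_comm, h5]
    refine mul_dvd_mul (Finset.prod_dvd_prod_of_subset _ _ _ ?_)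
      (Finset.prod_dvd_prod_of_subset _ _ _ ?_)
    · intro j hj
      simp only [Finset.mem_filter, Finset.mem_insert, Finset.mem_erase] at hj ⊢
      obtain ⟨hj, u, hu, huB, huj⟩ := hj
      rcases hj with rfl | ⟨hjl, hj⟩
      · exact Or.inl rfl
      refine Or.inr ⟨hj, ?_⟩
      by_cases hul : u = l
      · exact hmax' j hj (hul ▸ huj)
      · push Not at hu
        have huA : u ∉ A := fun h => hu.2 hul h
        exact ⟨u, huA, h3 u huB hu.1, huj⟩
    · intro j hj
      simp only [Finset.mem_filter] at hj ⊢
      exact h4 j hj.1 hj.2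
  by_cases hiB : i ∈ B
  · have hiU : ∀ u, u ∉ A → u ∉ B → c u < c i := by
      intro u huA huB
      by_contra h
      have := hne u i (by rintro rfl; exact huB hiB)
      exact h1 ⟨hiB, u, huA, huB, by omega⟩
    obtain ⟨v, hv, hvmax⟩ := Finset.exists_max_image
      (Finset.univ.filter fun u => u ∉ A ∧ u ∉ B) c (by simpa [Finset.Nonempty] using hU)
    simp only [Finset.mem_filter, Finset.mem_univ, true_and] at hv hvmax
    have hvi := hiU v hv.1 hv.2
    have hlv : c l < c v := lt_of_le_of_ne (hlU v hv.1 hv.2) (hne _ _ (by rintro rfl; exact hv.1 hlA))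
    have hvi' : v ≠ i := by rintro rfl; exact hv.2 hiB
    have hvB : v ∉ B.erase i := by simp [hv.2]
    refine ⟨_, insert v (B.erase i), hcardA, ?_, ?_, ?_, hdvd _ ?_ ?_⟩
    · rw [Finset.card_insert_of_notMem hvB, Finset.card_erase_add_one hiB, hB]
    · rw [Finset.disjoint_left]
      intro j hj hj'
      simp only [Finset.mem_insert, Finset.mem_erase] at hj hj'
      grind
    · simp only [facetWeight, hsumA, Finset.sum_insert hvB]
      rw [← Finset.add_sum_erase B c hiB]
      omega
    · intro u hu hui huB
      simp [hui, huB] at hu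
    · rintro j hj ⟨u, huA, huB, hju⟩
      simp only [Finset.mem_insert, Finset.mem_erase, not_or, not_and] at hj huA huB
      have huv : c u ≤ c v := by
        by_cases hul : u = l
        · rw [hul]; exact hlv.le
        · exact hvmax u ⟨huA.2 hul, huB.2 huA.1⟩
      rcases hj with rfl | hj
      · exact absurd hju (not_lt.2 huv)
      · exact ⟨hj.2, v, hv.1, hv.2, hju.trans_le huv⟩
  · have hli : c l < c i := lt_of_le_of_ne (hlU i hi hiB) (hne _ _ hil.symm)
    refine ⟨_, B, hcardA, hB, ?_, ?_, hdvd _ (fun u hu _ => hu) ?_⟩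
    · rw [Finset.disjoint_left]
      intro j hj hj'
      simp only [Finset.mem_insert, Finset.mem_erase] at hj
      grind
    · simp only [facetWeight, hsumA]
      omega
    · rintro j hj ⟨u, huA, huB, hju⟩
      refine ⟨hj, ?_⟩
      simp only [Finset.mem_insert, Finset.mem_erase, not_or, not_and] at huA
      by_cases hul : u = l
      · exact ⟨i, hi, hiB, by rw [hul] at hju; omega⟩
      · exact ⟨u, huA.2 hul, huB, hju⟩

lemma restr_mul_right {a b : ℕ} {c : ι → ℤ} (hc : Function.Injective c) {x y : ι → S}
    (hy : ∀ I : Finset ι, I.card = b + 1 → ∏ i ∈ I, y i = 0) (hxy : ∀ i, x i * y i = 0)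
    {A B : Finset ι} (hA : A.card = a) (hB : B.card = b) (hAB : Disjoint A B)
    (hU : ∃ u, u ∉ A ∧ u ∉ B) {i : ι} (hi : i ∉ B) :
    restr c x y A B * y i = 0 ∨ ∃ A' B' : Finset ι, A'.card = a ∧ B'.card = b ∧ Disjoint A' B' ∧
      facetWeight c A B < facetWeight c A' B' ∧
      restr c x y A' B' ∣ restr c x y A B * y i := by
  have h := restr_mul_left (c := -c) (neg_injective.comp hc) hy
    (fun i => by rw [mul_comm]; exact hxy i) hB hA hAB.symm
    (by obtain ⟨u, h, h'⟩ := hU; exact ⟨u, h', h⟩) hi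
  rw [restr_swap] at h
  refine h.imp id ?_
  rintro ⟨B', A', hB', hA', hd, hw, hdvd⟩
  rw [facetWeight_swap, facetWeight_swap] at hw
  rw [restr_swap] at hdvd
  exact ⟨A', B', hA', hB', hd.symm, hw, hdvd⟩

/-- The facets: pairs of disjoint sets of sizes `a` and `b`. -/
def facets (ι : Type*) [Fintype ι] [DecidableEq ι] (a b : ℕ) : Finset (Σ _ : Finset ι, Finset ι) :=
  (Finset.powersetCard a Finset.univ).sigma fun A => Finset.powersetCard b Aᶜ

lemma mem_facets {a b : ℕ} {F : Σ _ : Finset ι, Finset ι} :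
    F ∈ facets ι a b ↔ F.1.card = a ∧ F.2.card = b ∧ Disjoint F.1 F.2 := by
  simp only [facets, Finset.mem_sigma, Finset.mem_powersetCard, Finset.subset_univ, true_and,
    Finset.subset_compl_iff_disjoint_left]
  tauto

lemma card_facets (a b : ℕ) :
    (facets ι a b).card = (Fintype.card ι).choose a * (Fintype.card ι - a).choose b := by
  rw [facets, Finset.card_sigma, Finset.sum_congr rfl
    (g := fun _ => (Fintype.card ι - a).choose b)]
  · simp
  · intro A hA
    rw [Finset.card_powersetCard, Finset.card_compl, (Finset.mem_powersetCard.1 hA).2]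

lemma card_facets_mul_factorial {a b : ℕ} (h : a + b ≤ Fintype.card ι) :
    (facets ι a b).card * (a.factorial * b.factorial) =
      (Fintype.card ι).factorial / (Fintype.card ι - (a + b)).factorial := by
  rw [card_facets]
  symm
  apply Nat.div_eq_of_eq_mul_left (Nat.factorial_pos _)
  rw [← Nat.choose_mul_factorial_mul_factorial (show a ≤ Fintype.card ι by omega),
    ← Nat.choose_mul_factorial_mul_factorial (show b ≤ Fintype.card ι - a by omega),
    Nat.sub_sub]
  ring

lemma exists_restr_eq_one {a b : ℕ} (c : ι → ℤ) (x y : ι → S)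
    (hab : a + b ≤ Fintype.card ι) : ∃ F ∈ facets ι a b, restr c x y F.1 F.2 = 1 := by
  have hne : (facets ι a b).Nonempty := by
    rw [← Finset.card_pos, card_facets]
    exact Nat.mul_pos (Nat.choose_pos (by omega)) (Nat.choose_pos (by omega))
  obtain ⟨⟨A, B⟩, hF, hmin⟩ := Finset.exists_min_image _ (fun F => facetWeight c F.1 F.2) hne
  refine ⟨_, hF, ?_⟩
  obtain ⟨hA, hB, hAB⟩ := mem_facets.1 hF
  dsimp only at hA hB hAB hmin ⊢
  rw [restr, Finset.filter_false_of_mem, Finset.filter_false_of_mem]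
  · simp
  · rintro j hj ⟨u, huA, huB, hlt⟩
    have huB' : u ∉ B.erase j := by simp [huB]
    have := hmin ⟨A, insert u (B.erase j)⟩ (mem_facets.2 ⟨hA, by
      rw [Finset.card_insert_of_notMem huB', Finset.card_erase_add_one hj, hB], by
      dsimp only
      rw [Finset.disjoint_insert_right]
      exact ⟨huA, hAB.mono_right (Finset.erase_subset _ _)⟩⟩)
    simp only [facetWeight, Finset.sum_insert huB'] at this
    rw [← Finset.add_sum_erase B c hj] at this
    omega
  · rintro j hj ⟨u, huA, huB, hlt⟩
    have huA' : u ∉ A.erase j := by simp [huA]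
    have := hmin ⟨insert u (A.erase j), B⟩ (mem_facets.2 ⟨by
      rw [Finset.card_insert_of_notMem huA', Finset.card_erase_add_one hj, hA], hB, by
      dsimp only
      rw [Finset.disjoint_insert_left]
      exact ⟨huB, hAB.mono_left (Finset.erase_subset _ _)⟩⟩)
    simp only [facetWeight, Finset.sum_insert huA'] at this
    rw [← Finset.add_sum_erase A c hj] at this
    omega

end Shelling

section Bound

variable {k S : Type*} [Field k] [CommRing S] [Algebra k S]

lemma SpanLE.sup_span_singleton {K C : Ideal S} {r : S} {d m : ℕ} (hC : ∀ q ∈ C, q * r ∈ K)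
    (hQ : SpanLE (⊤ : Submodule k (S ⧸ C)) m) (hK : SpanLE (K.restrictScalars k) d) :
    SpanLE ((K ⊔ Ideal.span {r}).restrictScalars k) (d + m) := by
  classical
  obtain ⟨s, hs, hKs⟩ := hK
  obtain ⟨t, ht, hQt⟩ := hQ
  let g : S ⧸ C → S := Function.surjInv (Ideal.Quotient.mk_surjective (I := C))
  have hg : ∀ z, Ideal.Quotient.mk C (g z) = z :=
    Function.surjInv_eq (Ideal.Quotient.mk_surjective (I := C))
  refine ⟨s ∪ t.image fun z => g z * r, (Finset.card_union_le _ _).trans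
    (Nat.add_le_add hs (Finset.card_image_le.trans ht)), ?_⟩
  intro z hz
  rw [Submodule.restrictScalars_mem, Submodule.mem_sup] at hz
  obtain ⟨p, hp, q, hq, rfl⟩ := hz
  obtain ⟨q, rfl⟩ := Ideal.mem_span_singleton'.1 hq
  have hsub : Submodule.span k (s : Set S) ≤
      Submodule.span k ((s ∪ t.image fun z => g z * r : Finset S) : Set S) :=
    Submodule.span_mono (by simp)
  refine Submodule.add_mem _ (hsub (hKs hp)) ?_
  have key : ∀ z ∈ Submodule.span k (t : Set (S ⧸ C)), ∀ q, Ideal.Quotient.mk C q = z →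
      q * r ∈ Submodule.span k ((s ∪ t.image fun z => g z * r : Finset S) : Set S) := by
    intro z hz
    have aux : ∀ q q', Ideal.Quotient.mk C q = Ideal.Quotient.mk C q' →
        q' * r ∈ Submodule.span k ((s ∪ t.image fun z => g z * r : Finset S) : Set S) →
        q * r ∈ Submodule.span k ((s ∪ t.image fun z => g z * r : Finset S) : Set S) := by
      intro q q' h h'
      have := hsub (hKs (hC _ (Ideal.Quotient.eq.1 h)))
      rw [sub_mul] at this
      simpa using Submodule.add_mem _ this h'
    induction hz using Submodule.span_induction with
    | mem z hz =>
      intro q hq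
      refine aux q (g z) (by rw [hq, hg]) (Submodule.subset_span ?_)
      simp only [Finset.coe_union, Finset.coe_image]
      exact Or.inr ⟨z, hz, rfl⟩
    | zero => intro q hq; exact aux q 0 (by rw [hq, map_zero]) (by simp)
    | add z w _ _ hz hw =>
      intro q hq
      refine aux q (g z + g w) (by rw [hq, map_add, hg, hg]) ?_
      rw [add_mul]
      exact Submodule.add_mem _ (hz _ (hg z)) (hw _ (hg w))
    | smul a z _ hz =>
      intro q hq
      refine aux q (a • g z) ?_ ?_
      · rw [hq, ← Ideal.Quotient.mkₐ_eq_mk k, map_smul, Ideal.Quotient.mkₐ_eq_mk, hg]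
      · rw [smul_mul_assoc]
        exact Submodule.smul_mem _ _ (hz _ (hg z))
  exact key _ (hQt trivial) q rfl

variable {ι : Type*} [Fintype ι] [DecidableEq ι]

omit [DecidableEq ι] in
lemma esymm_eq_of_forall_notMem {x : ι → S} {A : Finset ι} (hA : ∀ i ∉ A, x i = 0) (m : ℕ) :
    ∑ I ∈ A.powersetCard m, ∏ i ∈ I, x i =
      ∑ I ∈ Finset.powersetCard m Finset.univ, ∏ i ∈ I, x i := by
  refine Finset.sum_subset (Finset.powersetCard_mono (Finset.subset_univ _)) ?_
  intro I hI hI'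
  simp only [Finset.mem_powersetCard, Finset.subset_univ, true_and, not_and] at hI hI'
  obtain ⟨i, hi, hiA⟩ := Finset.not_subset.1 fun h => hI' h hI
  exact Finset.prod_eq_zero hi (hA i hiA)

lemma spanLE_quotient {a b : ℕ} {x y : ι → S} (hgen : Algebra.adjoin k (Set.range x ∪ Set.range y) = ⊤)
    (hex : ∀ m, 1 ≤ m → m ≤ a → ∑ I ∈ Finset.powersetCard m Finset.univ, ∏ i ∈ I, x i = 0)
    (hey : ∀ m, 1 ≤ m → m ≤ b → ∑ I ∈ Finset.powersetCard m Finset.univ, ∏ i ∈ I, y i = 0)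
    {A B : Finset ι} (hA : A.card = a) (hB : B.card = b) {C : Ideal S}
    (hxC : ∀ i ∉ A, x i ∈ C) (hyC : ∀ i ∉ B, y i ∈ C) :
    SpanLE (⊤ : Submodule k (S ⧸ C)) (a.factorial * b.factorial) := by
  set π := Ideal.Quotient.mkₐ k C with hπ
  have hx0 : ∀ i ∉ A, π (x i) = 0 := fun i hi => Ideal.Quotient.eq_zero_iff_mem.2 (hxC i hi)
  have hy0 : ∀ i ∉ B, π (y i) = 0 := fun i hi => Ideal.Quotient.eq_zero_iff_mem.2 (hyC i hi)
  rw [← hA, ← hB]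
  refine spanLE_top_of_esymm_eq_zero (fun i => π (x i)) (fun i => π (y i)) A B ?_ ?_ ?_
  · intro m h1 h2
    rw [esymm_eq_of_forall_notMem hx0]
    simpa using congrArg π (hex m h1 (hA ▸ h2))
  · intro m h1 h2
    rw [esymm_eq_of_forall_notMem hy0]
    simpa using congrArg π (hey m h1 (hB ▸ h2))
  · have h1 : (Algebra.adjoin k (Set.range x ∪ Set.range y)).map π = ⊤ := by
      rw [hgen, Algebra.map_top, AlgHom.range_eq_top]
      exact Ideal.Quotient.mkₐ_surjective k C
    rw [AlgHom.map_adjoin] at h1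
    rw [eq_top_iff, ← h1, Algebra.adjoin_le_iff]
    rintro _ ⟨_, ⟨i, rfl⟩ | ⟨i, rfl⟩, rfl⟩
    · by_cases hi : i ∈ A
      · exact Algebra.subset_adjoin (Or.inl ⟨i, hi, rfl⟩)
      · rw [hx0 i hi]; exact zero_mem _
    · by_cases hi : i ∈ B
      · exact Algebra.subset_adjoin (Or.inr ⟨i, hi, rfl⟩)
      · rw [hy0 i hi]; exact zero_mem _

theorem spanLE_top_of_hook_relations {a b : ℕ} {x y : ι → S} (hab : a + b < Fintype.card ι)
    (hgen : Algebra.adjoin k (Set.range x ∪ Set.range y) = ⊤)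
    (hxy : ∀ i, x i * y i = 0)
    (hex : ∀ m, 1 ≤ m → m ≤ a → ∑ I ∈ Finset.powersetCard m Finset.univ, ∏ i ∈ I, x i = 0)
    (hey : ∀ m, 1 ≤ m → m ≤ b → ∑ I ∈ Finset.powersetCard m Finset.univ, ∏ i ∈ I, y i = 0)
    (hx : ∀ I : Finset ι, I.card = a + 1 → ∏ i ∈ I, x i = 0)
    (hy : ∀ I : Finset ι, I.card = b + 1 → ∏ i ∈ I, y i = 0) :
    SpanLE (⊤ : Submodule k S)
      ((Fintype.card ι).factorial / (Fintype.card ι - (a + b)).factorial) := by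
  let c : ι → ℤ := fun i => (Fintype.equivFin ι i : ℕ)
  have hc : Function.Injective c := fun i j h => (Fintype.equivFin ι).injective
    (Fin.ext (by simpa [c] using h))
  let r : (Σ _ : Finset ι, Finset ι) → S := fun F => restr c x y F.1 F.2
  let w : (Σ _ : Finset ι, Finset ι) → ℤ := fun F => facetWeight c F.1 F.2
  have key : ∀ T : Finset (Σ _ : Finset ι, Finset ι), T ⊆ facets ι a b →
      (∀ F ∈ T, ∀ F' ∈ facets ι a b, w F < w F' → F' ∈ T) →
      SpanLE ((Ideal.span (r '' T)).restrictScalars k)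
        (T.card * (a.factorial * b.factorial)) := by
    intro T
    induction T using Finset.induction_on_max_value (fun F => - w F) with
    | empty => exact fun _ _ => ⟨∅, by simp, by simp⟩
    | insert F T hFT hmin ih =>
      intro hsub hup
      have ih' := ih ((Finset.subset_insert _ _).trans hsub) fun G hG F' hF' hlt => by
        have h1 := hup G (Finset.mem_insert_of_mem hG) F' hF' hlt
        refine (Finset.mem_insert.1 h1).resolve_left ?_
        rintro rfl
        have := hmin G hG
        omega
      have hF := hsub (Finset.mem_insert_self F T)
      obtain ⟨hA, hB, hAB⟩ := mem_facets.1 hF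
      have hU : ∃ u, u ∉ F.1 ∧ u ∉ F.2 := by
        by_contra! h
        have h1 : Finset.univ ⊆ F.1 ∪ F.2 := fun u _ => by
          rw [Finset.mem_union]; by_contra! h'; exact h'.2 (h u h'.1)
        have h2 := (Finset.card_le_card h1).trans (Finset.card_union_le _ _)
        rw [Finset.card_univ] at h2
        omega
      have hmem : ∀ z, (z = 0 ∨ ∃ A' B' : Finset ι, A'.card = a ∧ B'.card = b ∧ Disjoint A' B' ∧
          facetWeight c F.1 F.2 < facetWeight c A' B' ∧ restr c x y A' B' ∣ z) →
          z ∈ Ideal.span (r '' T) := by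
        rintro z (rfl | ⟨A', B', hA', hB', hd, hlt, hdvd⟩)
        · exact zero_mem _
        · have h1 := hup F (Finset.mem_insert_self F T) ⟨A', B'⟩
            (mem_facets.2 ⟨hA', hB', hd⟩) hlt
          have h2 : (⟨A', B'⟩ : Σ _ : Finset ι, Finset ι) ∈ T := by
            refine (Finset.mem_insert.1 h1).resolve_left ?_
            rintro rfl
            exact lt_irrefl _ hlt
          exact Ideal.mem_of_dvd _ hdvd (Ideal.subset_span ⟨_, h2, rfl⟩)
      let C : Ideal S := Submodule.comap (LinearMap.toSpanSingleton S S (r F)) (Ideal.span (r '' T))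
      have hQ : SpanLE (⊤ : Submodule k (S ⧸ C)) (a.factorial * b.factorial) :=
        spanLE_quotient hgen hex hey hA hB
          (fun i hi => by
            have := hmem _ (restr_mul_left hc hx hxy hA hB hAB hU hi)
            rwa [mul_comm] at this)
          (fun i hi => by
            have := hmem _ (restr_mul_right hc hy hxy hA hB hAB hU hi)
            rwa [mul_comm] at this)
      have h := SpanLE.sup_span_singleton (r := r F) (fun q hq => hq) hQ ih'
      rw [← Ideal.span_union, Set.union_singleton, ← Set.image_insert_eq, ← Finset.coe_insert] at h
      rwa [Finset.card_insert_of_notMem hFT, Nat.succ_mul]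
  obtain ⟨F, hF, hF1⟩ := exists_restr_eq_one c x y hab.le
  have h := key (facets ι a b) subset_rfl fun _ _ F' hF' _ => hF'
  have h1 : Ideal.span (r '' (facets ι a b : Set _)) = ⊤ :=
    (Ideal.eq_top_iff_one _).2 (Ideal.subset_span ⟨F, hF, hF1⟩)
  rwa [card_facets_mul_factorial hab.le, h1] at h

end Bound
section OrbitHarmonics

variable {k : Type*} [Field k] [CharZero k] {G : Type*} [Group G] [Finite G]

/-- An invariant subspace is the kernel of an equivariant endomorphism `π` congruent to the identity
modulo the subspace. -/
lemma Representation.exists_equivariant_sub_mem {V : Type*} [AddCommGroup V] [Module k V]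
    (ρ : Representation k G V) (F : Submodule k V) (hF : ∀ g, ∀ f ∈ F, ρ g f ∈ F) :
    ∃ π : V →ₗ[k] V, (∀ f ∈ F, π f = 0) ∧ (∀ f, f - π f ∈ F) ∧ ∀ g f, π (ρ g f) = ρ g (π f) := by
  have := Fintype.ofFinite G
  obtain ⟨q, hq⟩ := F.subtype.exists_leftInverse_of_injective F.ker_subtype
  have hqF : ∀ f (hf : f ∈ F), (q f : V) = f := fun f hf =>
    congrArg (Subtype.val (p := (· ∈ F))) (LinearMap.congr_fun hq ⟨f, hf⟩)
  let p : V →ₗ[k] V :=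
    (Fintype.card G : k)⁻¹ • ∑ g : G, ρ g ∘ₗ F.subtype ∘ₗ q ∘ₗ ρ g⁻¹
  have hp : ∀ f, p f = (Fintype.card G : k)⁻¹ • ∑ g : G, ρ g (q (ρ g⁻¹ f)) := fun f => by
    simp [p]
  refine ⟨LinearMap.id - p, fun f hf => ?_, fun f => ?_, fun h f => ?_⟩
  · have h1 : ∀ g : G, ρ g (q (ρ g⁻¹ f)) = f := fun g => by
      rw [hqF _ (hF _ _ hf), ← Module.End.mul_apply, ← map_mul, mul_inv_cancel, map_one,
        Module.End.one_apply]
    rw [LinearMap.sub_apply, hp, Finset.sum_congr rfl fun g _ => h1 g]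
    simp [← Nat.cast_smul_eq_nsmul k, smul_smul]
  · rw [LinearMap.sub_apply, LinearMap.id_apply, sub_sub_cancel, hp]
    exact F.smul_mem _ (F.sum_mem fun g _ => hF _ _ (q _).2)
  · rw [LinearMap.sub_apply, LinearMap.sub_apply, map_sub, hp, hp, map_smul, map_sum]
    refine congrArg₂ _ rfl (congrArg _ ?_)
    refine Fintype.sum_equiv (Equiv.mulLeft h⁻¹) _ _ fun g => ?_
    have h1 : ∀ a b (v : V), ρ a (ρ b v) = ρ (a * b) v := fun a b v => by
      rw [map_mul, Module.End.mul_apply]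
    rw [Equiv.coe_mulLeft, h1, h1, mul_inv_cancel_left, mul_inv_rev, inv_inv]

variable {σ Z : Type*} [MulAction G σ] [MulAction G Z]

/-- Orbit harmonics: polynomials surject equivariantly onto functions on a finite locus `Z`, killing
the homogeneous polynomials of positive degree that are constant on `Z` and their multiples. -/
theorem exists_equivariant_surjective_of_locus (ev : MvPolynomial σ k →ₐ[k] (Z → k))
    (hsurj : Function.Surjective ev)
    (hev : ∀ (g : G) p z, ev (rename (g • ·) p) z = ev p (g⁻¹ • z)) :
    ∃ φ : MvPolynomial σ k →ₗ[k] (Z → k), Function.Surjective φ ∧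
      (∀ (g : G) p z, φ (rename (g • ·) p) z = φ p (g⁻¹ • z)) ∧
      ∀ (f : MvPolynomial σ k) (d : ℕ), f.IsHomogeneous d → 0 < d →
        (∃ c : k, ∀ z, ev f z = c) → ∀ p, φ (p * f) = 0 := by
  let ρ : Representation k G (Z → k) :=
    { toFun := fun g => LinearMap.funLeft k k (fun z => g⁻¹ • z)
      map_one' := by ext; simp [LinearMap.funLeft]
      map_mul' := fun g h => by ext; simp [LinearMap.funLeft, mul_smul] }
  have hρ : ∀ g f z, ρ g f z = f (g⁻¹ • z) := fun g f z => rfl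
  let mon : (σ →₀ ℕ) → Z → k := fun m => ev (monomial m 1)
  have hmon : ∀ m a, ev (monomial m a) = a • mon m := fun m a => by
    rw [← map_smul, smul_monomial, smul_eq_mul, mul_one]
  have hρmon : ∀ g m, ρ g (mon m) = mon (m.mapDomain (g • ·)) := fun g m => by
    ext z; simp only [mon]; rw [hρ, ← hev, rename_monomial]
  have hdeg : ∀ (g : G) (m : σ →₀ ℕ), (m.mapDomain (g • ·)).degree = m.degree := fun g m => by
    simp [Finsupp.degree_mapDomain]
  let F : ℕ → Submodule k (Z → k) := fun d => Submodule.span k (mon '' {m | m.degree < d})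
  have hFmon : ∀ m d, m.degree < d → mon m ∈ F d := fun m d h =>
    Submodule.subset_span ⟨m, h, rfl⟩
  have hFmono : ∀ {d e}, d ≤ e → F d ≤ F e := fun {d e} h =>
    Submodule.span_mono (Set.image_mono fun _ hm => lt_of_lt_of_le (Set.mem_ofPred.1 hm) h)
  have hFinv : ∀ d g, ∀ f ∈ F d, ρ g f ∈ F d := by
    intro d g f hf
    refine (Submodule.span_le (p := (F d).comap (ρ g))).2 ?_ hf
    rintro _ ⟨m, hm, rfl⟩
    change ρ g (mon m) ∈ F d
    rw [hρmon]
    exact hFmon _ _ (by rw [hdeg]; exact hm)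
  choose π hπ0 hπ1 hπ2 using fun d => ρ.exists_equivariant_sub_mem (F d) (hFinv d)
  let φ : MvPolynomial σ k →ₗ[k] (Z → k) :=
    (basisMonomials σ k).constr k fun m => π m.degree (mon m)
  have hφ1 : ∀ m, φ (monomial m 1) = π m.degree (mon m) := fun m => by
    have := (basisMonomials σ k).constr_basis k (fun m => π m.degree (mon m)) m
    rwa [coe_basisMonomials] at this
  have hφm : ∀ m a, φ (monomial m a) = a • π m.degree (mon m) := fun m a => by
    rw [← hφ1, ← map_smul, smul_monomial, smul_eq_mul, mul_one]
  have hφh : ∀ p d, p.IsHomogeneous d → φ p = π d (ev p) := by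
    intro p d hp
    conv_lhs => rw [p.as_sum]
    conv_rhs => rw [p.as_sum]
    rw [map_sum, map_sum, map_sum]
    refine Finset.sum_congr rfl fun m hm => ?_
    have : m.degree = d := by
      rw [Finsupp.degree_eq_weight_one]; exact hp (mem_support_iff.1 hm)
    rw [hφm, hmon, map_smul, this]
  refine ⟨φ, ?_, ?_, ?_⟩
  · have hle : ∀ d, F d ≤ LinearMap.range φ := by
      intro d
      induction d with
      | zero => simp [F]
      | succ d ih =>
        refine Submodule.span_le.2 ?_
        rintro _ ⟨m, hm, rfl⟩
        have h1 := ih (hFmono (Nat.lt_succ_iff.1 hm) (hπ1 m.degree (mon m)))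
        have h2 := Submodule.add_mem _ h1 ⟨_, hφ1 m⟩
        rwa [sub_add_cancel] at h2
    intro f
    obtain ⟨p, rfl⟩ := hsurj f
    change _ ∈ LinearMap.range φ
    rw [p.as_sum, map_sum]
    refine Submodule.sum_mem _ fun m _ => ?_
    rw [hmon]
    exact Submodule.smul_mem _ _ (hle (m.degree + 1) (hFmon _ _ (Nat.lt_succ_self _)))
  · intro g p z
    rw [p.as_sum, map_sum, map_sum, map_sum, Finset.sum_apply, Finset.sum_apply]
    refine Finset.sum_congr rfl fun m _ => ?_
    rw [rename_monomial, hφm, hφm, hdeg, ← hρmon, hπ2]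
    rfl
  · rintro f d hf hd ⟨c, hc⟩ p
    rw [p.as_sum, Finset.sum_mul, map_sum]
    refine Finset.sum_eq_zero fun m _ => ?_
    rw [hφh _ (m.degree + d) ((isHomogeneous_monomial _ rfl).mul hf)]
    have : ev (monomial m (coeff m p) * f) = (c * coeff m p) • mon m := by
      rw [map_mul, hmon]
      ext z
      simp [hc]; ring
    rw [this, map_smul, hπ0 _ _ (hFmon _ _ (by omega)), smul_zero]

end OrbitHarmonics
section Locus

variable {σ k Z : Type*} [Field k] [Finite Z]

/-- Polynomials whose values separate the points of a finite set interpolate all functions. -/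
lemma surjective_of_separates (ev : MvPolynomial σ k →ₐ[k] (Z → k))
    (hsep : ∀ z z', z ≠ z' → ∃ p, ev p z ≠ ev p z') : Function.Surjective ev := by
  let I : Z → Ideal (MvPolynomial σ k) := fun z =>
    RingHom.ker ((Pi.evalAlgHom k (fun _ : Z => k) z).comp ev)
  have hI : ∀ z p, p ∈ I z ↔ ev p z = 0 := fun z p => Iff.rfl
  have hco : Pairwise (Function.onFun IsCoprime I) := by
    intro z z' h
    obtain ⟨p, hp⟩ := hsep z z' h
    have hne : ev p z' - ev p z ≠ 0 := sub_ne_zero.2 hp.symm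
    refine Ideal.isCoprime_iff_exists.2 ⟨C (ev p z' - ev p z)⁻¹ * (p - C (ev p z)), ?_,
      1 - C (ev p z' - ev p z)⁻¹ * (p - C (ev p z)), ?_, by ring⟩
    · rw [hI]; simp [← algebraMap_eq]
    · rw [hI]; simp [← algebraMap_eq, hne]
  intro f
  obtain ⟨p, hp⟩ := Ideal.exists_forall_sub_mem_ideal hco fun z => C (f z)
  refine ⟨p, funext fun z => ?_⟩
  have := (hI z _).1 (hp z)
  simpa [← algebraMap_eq, sub_eq_zero] using this

end Locus

instance (n : ℕ) : MulAction (Equiv.Perm (Fin n)) (Fin n ⊕ Fin n) where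
  smul σ := Sum.map σ σ
  one_smul v := by rcases v with i | i <;> rfl
  mul_smul σ τ v := by rcases v with i | i <;> rfl

lemma mem_fixLT {n m : ℕ} {σ : Equiv.Perm (Fin n)} :
    σ ∈ fixLT n m ↔ ∀ k : Fin n, (k : ℕ) < m → σ k = k := Iff.rfl

lemma card_fixLT {n m : ℕ} (hm : m ≤ n) : Nat.card (fixLT n m) = (n - m).factorial := by
  let e := Equiv.Perm.subtypeEquivSubtypePerm fun k : Fin n => ¬ (k : ℕ) < m
  have h1 : Nat.card (fixLT n m) = Nat.card (Equiv.Perm {k : Fin n // ¬ (k : ℕ) < m}) := by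
    refine Nat.card_congr (Equiv.trans (Equiv.subtypeEquivRight fun σ => ?_) e.symm)
    simp only [not_not]
    exact mem_fixLT
  rw [h1, Nat.card_perm, Nat.card_eq_fintype_card, Fintype.card_subtype_compl, Fintype.card_fin]
  congr 2
  rw [Fintype.card_subtype]
  rw [Fin.card_filter_val_lt, min_eq_right hm]

lemma card_quotient_fixLT {n m : ℕ} (hm : m ≤ n) :
    Nat.card (Equiv.Perm (Fin n) ⧸ fixLT n m) = n.factorial / (n - m).factorial := by
  have h := Subgroup.card_eq_card_quotient_mul_card_subgroup (fixLT n m)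
  rw [Nat.card_perm, Nat.card_fin, card_fixLT hm] at h
  rw [h, Nat.mul_div_cancel _ (Nat.factorial_pos _)]

/-- Coordinates of a point with `a` distinct nonzero `x` coordinates, `b` distinct nonzero `y`
coordinates on other positions, and all others zero. -/
def basePoint (n a b : ℕ) : Fin n ⊕ Fin n → ℂ
  | Sum.inl i => if (i : ℕ) < a then (i : ℂ) + 1 else 0
  | Sum.inr i => if a ≤ (i : ℕ) ∧ (i : ℕ) < a + b then (i : ℂ) + 1 else 0

lemma basePoint_smul_of_mem {n a b : ℕ} {σ : Equiv.Perm (Fin n)} (hσ : σ ∈ fixLT n (a + b))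
    (v : Fin n ⊕ Fin n) : basePoint n a b (σ • v) = basePoint n a b v := by
  have h1 : ∀ i : Fin n, (i : ℕ) < a + b ∨ (σ i : ℕ) < a + b → σ i = i := by
    rintro i (h | h)
    · exact hσ i h
    · exact σ.injective (hσ _ h)
  rcases v with i | i
  · change basePoint n a b (Sum.inl (σ i)) = _
    by_cases h : (i : ℕ) < a + b ∨ (σ i : ℕ) < a + b
    · rw [h1 i h]
    · push Not at h
      simp only [basePoint]
      rw [if_neg (by omega), if_neg (by omega)]
  · change basePoint n a b (Sum.inr (σ i)) = _
    by_cases h : (i : ℕ) < a + b ∨ (σ i : ℕ) < a + b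
    · rw [h1 i h]
    · push Not at h
      simp only [basePoint]
      rw [if_neg (by omega), if_neg (by omega)]

lemma mem_fixLT_of_basePoint_smul {n a b : ℕ} {σ : Equiv.Perm (Fin n)}
    (h : ∀ v, basePoint n a b (σ • v) = basePoint n a b v) : σ ∈ fixLT n (a + b) := by
  intro i hi
  have hne : ((i : ℕ) : ℂ) + 1 ≠ 0 := Nat.cast_add_one_ne_zero _
  by_cases hia : (i : ℕ) < a
  · have h1 : basePoint n a b (Sum.inl (σ i)) = basePoint n a b (Sum.inl i) := h (Sum.inl i)
    simp only [basePoint, if_pos hia] at h1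
    split_ifs at h1 with h2
    · exact Fin.ext (by exact_mod_cast add_right_cancel h1)
    · exact absurd h1.symm hne
  · have h1 : basePoint n a b (Sum.inr (σ i)) = basePoint n a b (Sum.inr i) := h (Sum.inr i)
    simp only [basePoint, if_pos (show a ≤ (i : ℕ) ∧ (i : ℕ) < a + b by omega)] at h1
    split_ifs at h1 with h2
    · exact Fin.ext (by exact_mod_cast add_right_cancel h1)
    · exact absurd h1.symm hne

/-- Evaluation of polynomials on the `Sₙ`-orbit of `basePoint`, parametrized by cosets. -/
def orbitEval (n a b : ℕ) : MvPolynomial (Fin n ⊕ Fin n) ℂ →ₐ[ℂ]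
    (Equiv.Perm (Fin n) ⧸ fixLT n (a + b) → ℂ) :=
  AlgHom.pi fun z => aeval fun v => basePoint n a b (z.out⁻¹ • v)

lemma orbitEval_mk {n a b : ℕ} (p : MvPolynomial (Fin n ⊕ Fin n) ℂ) (τ : Equiv.Perm (Fin n)) :
    orbitEval n a b p (τ : Equiv.Perm (Fin n) ⧸ fixLT n (a + b)) =
      aeval (fun v => basePoint n a b (τ⁻¹ • v)) p := by
  change aeval _ p = _
  congr 2
  funext v
  obtain ⟨⟨h, hh⟩, he⟩ := QuotientGroup.mk_out_eq_mul (fixLT n (a + b)) τ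
  rw [he, mul_inv_rev, mul_smul]
  exact basePoint_smul_of_mem (inv_mem hh) _

lemma orbitEval_rename {n a b : ℕ} (σ : Equiv.Perm (Fin n))
    (p : MvPolynomial (Fin n ⊕ Fin n) ℂ) (z : Equiv.Perm (Fin n) ⧸ fixLT n (a + b)) :
    orbitEval n a b (rename (σ • ·) p) z = orbitEval n a b p (σ⁻¹ • z) := by
  obtain ⟨τ, rfl⟩ := QuotientGroup.mk_surjective z
  have h : σ⁻¹ • (τ : Equiv.Perm (Fin n) ⧸ fixLT n (a + b)) = ((σ⁻¹ * τ : _) : _ ⧸ _) := rfl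
  rw [h, orbitEval_mk, orbitEval_mk, aeval_rename]
  congr 2
  funext v
  simp [mul_smul]

lemma orbitEval_surjective (n a b : ℕ) : Function.Surjective (orbitEval n a b) := by
  refine surjective_of_separates _ fun z z' => ?_
  obtain ⟨τ, rfl⟩ := QuotientGroup.mk_surjective z
  obtain ⟨τ', rfl⟩ := QuotientGroup.mk_surjective z'
  contrapose!
  intro h
  refine QuotientGroup.eq.2 (mem_fixLT_of_basePoint_smul fun v => ?_)
  have := h (X (τ' • v))
  rw [orbitEval_mk, orbitEval_mk, aeval_X, aeval_X, inv_smul_smul] at this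
  rw [mul_smul, this]

lemma orbitEval_const_of_rename_eq {n a b : ℕ} {p : MvPolynomial (Fin n ⊕ Fin n) ℂ}
    (hp : ∀ σ : Equiv.Perm (Fin n), rename (σ • ·) p = p) : ∃ c, ∀ z, orbitEval n a b p z = c := by
  refine ⟨orbitEval n a b p (1 : Equiv.Perm (Fin n)), fun z => ?_⟩
  obtain ⟨τ, rfl⟩ := QuotientGroup.mk_surjective z
  have h := orbitEval_rename (a := a) (b := b) τ⁻¹ p (1 : Equiv.Perm (Fin n))
  rw [hp] at h
  rw [h]
  congr 1

lemma exists_mem_apply_notMem_Ico {n a b : ℕ} (σ : Equiv.Perm (Fin n)) {I : Finset (Fin n)}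
    (hI : b < I.card) : ∃ i ∈ I, ¬ (a ≤ (σ i : ℕ) ∧ (σ i : ℕ) < a + b) := by
  by_contra! h
  have := Finset.card_le_card_of_injOn (s := I) (t := Finset.Ico a (a + b)) (fun i => (σ i : ℕ))
    (fun i hi => by simpa using h i hi)
    (fun i _ j _ hij => σ.injective (Fin.ext hij))
  rw [Nat.card_Ico] at this
  omega

lemma orbitEval_prod_inl {n a b : ℕ} {I : Finset (Fin n)} (hI : a < I.card)
    (z : Equiv.Perm (Fin n) ⧸ fixLT n (a + b)) :
    orbitEval n a b (∏ i ∈ I, X (Sum.inl i)) z = 0 := by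
  obtain ⟨τ, rfl⟩ := QuotientGroup.mk_surjective z
  obtain ⟨i, hi, h⟩ := exists_mem_apply_notMem_Ico (a := 0) τ⁻¹ hI
  rw [orbitEval_mk, map_prod]
  refine Finset.prod_eq_zero hi ?_
  rw [aeval_X]
  change basePoint n a b (Sum.inl (τ⁻¹ i)) = 0
  exact if_neg (by omega)

lemma orbitEval_prod_inr {n a b : ℕ} {I : Finset (Fin n)} (hI : b < I.card)
    (z : Equiv.Perm (Fin n) ⧸ fixLT n (a + b)) :
    orbitEval n a b (∏ i ∈ I, X (Sum.inr i)) z = 0 := by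
  obtain ⟨τ, rfl⟩ := QuotientGroup.mk_surjective z
  obtain ⟨i, hi, h⟩ := exists_mem_apply_notMem_Ico (a := a) τ⁻¹ hI
  rw [orbitEval_mk, map_prod]
  refine Finset.prod_eq_zero hi ?_
  rw [aeval_X]
  exact if_neg h

lemma orbitEval_inl_mul_inr {n a b : ℕ} (i : Fin n)
    (z : Equiv.Perm (Fin n) ⧸ fixLT n (a + b)) :
    orbitEval n a b (X (Sum.inl i) * X (Sum.inr i)) z = 0 := by
  obtain ⟨τ, rfl⟩ := QuotientGroup.mk_surjective z
  rw [orbitEval_mk, map_mul, aeval_X, aeval_X]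
  change basePoint n a b (Sum.inl (τ⁻¹ i)) * basePoint n a b (Sum.inr (τ⁻¹ i)) = 0
  simp only [basePoint]
  split_ifs <;> first | omega | simp

lemma isHomogeneous_sum_powersetCard_prod_X {ι σ R : Type*} [CommSemiring R] (s : Finset ι)
    (v : ι → σ) (m : ℕ) :
    (∑ I ∈ s.powersetCard m, ∏ i ∈ I, (X (v i) : MvPolynomial σ R)).IsHomogeneous m := by
  refine IsHomogeneous.sum _ _ _ fun I hI => ?_
  have h := IsHomogeneous.prod I (fun i => (X (v i) : MvPolynomial σ R)) (fun _ => 1)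
    fun i _ => isHomogeneous_X R _
  simpa [(Finset.mem_powersetCard.1 hI).2] using h

lemma rename_sum_powersetCard_prod_X {n m : ℕ} (f : Fin n → Fin n ⊕ Fin n)
    (hf : ∀ (σ : Equiv.Perm (Fin n)) i, σ • f i = f (σ i)) (σ : Equiv.Perm (Fin n)) :
    rename (σ • ·) (∑ I ∈ Finset.powersetCard m Finset.univ, ∏ i ∈ I,
        (X (f i) : MvPolynomial (Fin n ⊕ Fin n) ℂ)) =
      ∑ I ∈ Finset.powersetCard m Finset.univ, ∏ i ∈ I, X (f i) := by
  have h : ∀ g : Fin n → Fin n ⊕ Fin n,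
      (∑ I ∈ Finset.powersetCard m Finset.univ, ∏ i ∈ I,
        (X (g i) : MvPolynomial (Fin n ⊕ Fin n) ℂ)) = rename g (esymm (Fin n) ℂ m) := fun g => by
    simp [esymm]
  rw [h, rename_rename, show (σ • ·) ∘ f = f ∘ σ from funext (hf σ), ← rename_rename,
    rename_esymm (Fin n) ℂ m σ]

lemma adjoin_range_xv_union_range_yv (n : ℕ) :
    Algebra.adjoin ℂ (Set.range (xv n) ∪ Set.range (yv n)) = ⊤ := by
  have h := congrArg (Subalgebra.map (mkB n)) (adjoin_range_X (R := ℂ) (σ := Fin n ⊕ Fin n))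
  rw [Algebra.map_top, (AlgHom.range_eq_top _).2 (Ideal.Quotient.mkₐ_surjective _ _),
    AlgHom.map_adjoin, ← Set.range_comp, Sum.range_eq] at h
  exact h

lemma spanLE_quotient_Iij {n a b : ℕ} (hab : a + b < n) :
    SpanLE (⊤ : Submodule ℂ (B n ⧸ Iij n (a + 1) (b + 1)))
      (n.factorial / (n - (a + b)).factorial) := by
  set q := Ideal.Quotient.mkₐ ℂ (Iij n (a + 1) (b + 1)) with hq
  have hq0 : ∀ p ∈ Sij n (a + 1) (b + 1), q p = 0 := fun p hp =>
    Ideal.Quotient.eq_zero_iff_mem.2 (Ideal.subset_span hp)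
  have h := spanLE_top_of_hook_relations (k := ℂ) (a := a) (b := b)
    (x := fun i => q (xv n i)) (y := fun i => q (yv n i)) (by simpa using hab) ?_ ?_ ?_ ?_ ?_ ?_
  · simpa using h
  · have h := congrArg (Subalgebra.map q) (adjoin_range_xv_union_range_yv n)
    rw [Algebra.map_top, (AlgHom.range_eq_top _).2 (Ideal.Quotient.mkₐ_surjective _ _),
      AlgHom.map_adjoin, Set.image_union, ← Set.range_comp, ← Set.range_comp] at h
    exact h
  · intro i
    have : xv n i * yv n i = 0 := by
      rw [xv, yv, ← map_mul]
      exact Ideal.Quotient.eq_zero_iff_mem.2 (Ideal.subset_span ⟨i, rfl⟩)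
    rw [← map_mul, this, map_zero]
  · intro m h1 h2
    simpa [eX] using hq0 _ (Or.inl (Or.inl (Or.inl ⟨m, h1, by omega, rfl⟩)))
  · intro m h1 h2
    simpa [fY] using hq0 _ (Or.inl (Or.inr ⟨m, h1, by omega, rfl⟩))
  · intro I hI
    simpa using hq0 _ (Or.inl (Or.inl (Or.inr ⟨I, hI, rfl⟩)))
  · intro I hI
    simpa using hq0 _ (Or.inr ⟨I, hI, rfl⟩)

lemma exists_surjective_quotient_Iij (n a b : ℕ) :
    ∃ Φ : (B n ⧸ Iij n (a + 1) (b + 1)) →ₗ[ℂ] (Equiv.Perm (Fin n) ⧸ fixLT n (a + b) → ℂ),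
      Function.Surjective Φ ∧ ∀ (σ : Equiv.Perm (Fin n)) (P : B n),
        Φ (Ideal.Quotient.mk _ (permB n σ P)) =
          cosetAct n (a + b) σ (Φ (Ideal.Quotient.mk _ P)) := by
  obtain ⟨φ, hsurj, hφ, hker⟩ := exists_equivariant_surjective_of_locus
    (orbitEval n a b) (orbitEval_surjective n a b) orbitEval_rename
  let K : Ideal (MvPolynomial (Fin n ⊕ Fin n) ℂ) :=
    { carrier := {f | ∀ p, φ (p * f) = 0}
      add_mem' := fun {f g} hf hg p => by rw [mul_add, map_add, hf, hg, add_zero]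
      zero_mem' := fun p => by simp
      smul_mem' := fun g f hf p => by rw [smul_eq_mul, ← mul_assoc]; exact hf _ }
  have hBK : Bideal n ≤ K := by
    refine Ideal.span_le.2 ?_
    rintro _ ⟨i, rfl⟩
    exact hker _ 2 ((isHomogeneous_X ℂ _).mul (isHomogeneous_X ℂ _)) two_pos
      ⟨0, orbitEval_inl_mul_inr i⟩
  have hprod : ∀ (f : Fin n → Fin n ⊕ Fin n) (I : Finset (Fin n)), 0 < I.card →
      (∀ z, orbitEval n a b (∏ i ∈ I, X (f i)) z = 0) → ∏ i ∈ I, X (f i) ∈ K := by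
    intro f I hI h
    refine hker _ I.card ?_ hI ⟨0, h⟩
    simpa using IsHomogeneous.prod I (fun i => (X (f i) : MvPolynomial (Fin n ⊕ Fin n) ℂ))
      (fun _ => 1) fun i _ => isHomogeneous_X ℂ _
  have hIK : Iij n (a + 1) (b + 1) ≤ K.map (Ideal.Quotient.mk (Bideal n)) := by
    refine Ideal.span_le.2 ?_
    rintro _ (((⟨m, h1, -, rfl⟩ | ⟨I, hI, rfl⟩) | ⟨m, h1, -, rfl⟩) | ⟨I, hI, rfl⟩)
    · have := Ideal.mem_map_of_mem (Ideal.Quotient.mk (Bideal n)) (show _ ∈ K from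
        hker _ m (isHomogeneous_sum_powersetCard_prod_X Finset.univ Sum.inl m) h1
          (orbitEval_const_of_rename_eq
            (rename_sum_powersetCard_prod_X Sum.inl fun _ _ => rfl)))
      simpa [eX, xv] using this
    · have := Ideal.mem_map_of_mem (Ideal.Quotient.mk (Bideal n))
        (hprod Sum.inl I (by omega) (orbitEval_prod_inl (by omega)))
      simpa [xv] using this
    · have := Ideal.mem_map_of_mem (Ideal.Quotient.mk (Bideal n)) (show _ ∈ K from
        hker _ m (isHomogeneous_sum_powersetCard_prod_X Finset.univ Sum.inr m) h1
          (orbitEval_const_of_rename_eq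
            (rename_sum_powersetCard_prod_X Sum.inr fun _ _ => rfl)))
      simpa [fY, yv] using this
    · have := Ideal.mem_map_of_mem (Ideal.Quotient.mk (Bideal n))
        (hprod Sum.inr I (by omega) (orbitEval_prod_inr (by omega)))
      simpa [yv] using this
  let q : MvPolynomial (Fin n ⊕ Fin n) ℂ →ₐ[ℂ] B n ⧸ Iij n (a + 1) (b + 1) :=
    (Ideal.Quotient.mkₐ ℂ (Iij n (a + 1) (b + 1))).comp (mkB n)
  have hq : Function.Surjective q :=
    (Ideal.Quotient.mkₐ_surjective ℂ (Iij n (a + 1) (b + 1))).comp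
      (Ideal.Quotient.mkₐ_surjective ℂ (Bideal n))
  have hqφ : ∀ p, q p = 0 → φ p = 0 := by
    intro p hp
    have h1 : Ideal.Quotient.mk (Bideal n) p ∈ Iij n (a + 1) (b + 1) :=
      Ideal.Quotient.eq_zero_iff_mem.1 hp
    have h2 : p ∈ (K.map (Ideal.Quotient.mk (Bideal n))).comap _ := hIK h1
    rw [Ideal.comap_map_mk hBK] at h2
    simpa using h2 1
  obtain ⟨s, hs⟩ := q.toLinearMap.exists_rightInverse_of_surjective
    (LinearMap.range_eq_top.2 hq)
  have hΦ : ∀ p, (φ ∘ₗ s) (q p) = φ p := fun p => by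
    have h1 : q (s (q p)) = q p := LinearMap.congr_fun hs (q p)
    have h2 := hqφ (s (q p) - p) (by rw [map_sub, h1, sub_self])
    rwa [map_sub, sub_eq_zero] at h2
  refine ⟨φ ∘ₗ s, fun f => ?_, fun σ P => ?_⟩
  · obtain ⟨p, rfl⟩ := hsurj f
    exact ⟨q p, hΦ p⟩
  · obtain ⟨p, rfl⟩ := Ideal.Quotient.mkₐ_surjective ℂ (Bideal n) P
    change (φ ∘ₗ s) (q (rename (σ • ·) p)) = cosetAct n (a + b) σ ((φ ∘ₗ s) (q p))
    rw [hΦ, hΦ]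
    exact funext (hφ σ p)

/-- For `i, j ≥ 1` with `i + j ≤ n`, the quotient
`R^n_{i,j} = bₙ/I^n_{i,j}` has dimension `n!/(n−i−j+2)!` over `ℂ` and is isomorphic as
a `ℂ[Sₙ]`-module to the permutation module `ℂ[Sₙ/S_{n−i−j+2}]`. -/
theorem Rij_is_permutation_module (n i j : ℕ) (hi : 1 ≤ i) (hj : 1 ≤ j) (hij : i + j ≤ n) :
    Module.finrank ℂ (B n ⧸ Iij n i j) = n.factorial / (n + 2 - (i + j)).factorial ∧
    ∃ e : (B n ⧸ Iij n i j) ≃ₗ[ℂ] ((Equiv.Perm (Fin n) ⧸ fixLT n (i + j - 2)) → ℂ),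
      ∀ (σ : Equiv.Perm (Fin n)) (P : B n),
        e (Ideal.Quotient.mk (Iij n i j) (permB n σ P)) =
          cosetAct n (i + j - 2) σ (e (Ideal.Quotient.mk (Iij n i j) P)) := by
  obtain ⟨a, rfl⟩ := Nat.exists_eq_add_of_le' hi
  obtain ⟨b, rfl⟩ := Nat.exists_eq_add_of_le' hj
  rw [show a + 1 + (b + 1) - 2 = a + b by omega,
    show n + 2 - (a + 1 + (b + 1)) = n - (a + b) by omega]
  obtain ⟨s, hs, hle⟩ := spanLE_quotient_Iij (n := n) (a := a) (b := b) (by omega)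
  have hspan := eq_top_iff.2 hle
  have hfin : Module.Finite ℂ (B n ⧸ Iij n (a + 1) (b + 1)) := ⟨s, hspan⟩
  have hub : Module.finrank ℂ (B n ⧸ Iij n (a + 1) (b + 1)) ≤ s.card := by
    have := finrank_span_finset_le_card (R := ℂ) s
    rwa [Set.finrank, hspan, finrank_top] at this
  obtain ⟨Φ, hΦ, hΦσ⟩ := exists_surjective_quotient_Iij n a b
  have := Fintype.ofFinite (Equiv.Perm (Fin n) ⧸ fixLT n (a + b))
  have hcard : Module.finrank ℂ (Equiv.Perm (Fin n) ⧸ fixLT n (a + b) → ℂ) =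
      n.factorial / (n - (a + b)).factorial := by
    rw [Module.finrank_fintype_fun_eq_card, ← Nat.card_eq_fintype_card,
      card_quotient_fixLT (by omega)]
  have hlb := LinearMap.finrank_le_finrank_of_surjective hΦ
  have heq : Module.finrank ℂ (B n ⧸ Iij n (a + 1) (b + 1)) =
      n.factorial / (n - (a + b)).factorial := by omega
  exact ⟨heq, LinearEquiv.ofBijective Φ
    ⟨(LinearMap.injective_iff_surjective_of_finrank_eq_finrank (heq.trans hcard.symm)).2 hΦ, hΦ⟩,
    hΦσ⟩

end
end

section
/- For n ≥ 2 and 1 ≤ i ≤ n−1, one has the inclusion F^i B_n ∩ I^n_{n−i,i+1} ⊆ J_n + F^{i+1} B_n; equivalently, the natural S_n-module homomorphism φ : R_n^{(i)} → R^n_{n−i,i+1} induced by the inclusion F^i J_n + F^{i+1} B_n ⊆ I^n_{n−i,i+1} is injective. -/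
open MvPolynomial

set_option maxHeartbeats 1000000
set_option synthInstance.maxHeartbeats 400000

noncomputable section

/-- the filtration `F^p Bₙ = Σ_{|J|=p} y_J Bₙ`. -/
def FB (n p : ℕ) : Ideal (B n) :=
  Ideal.span {b | ∃ J : Finset (Fin n), J.card = p ∧ b = ∏ t ∈ J, yv n t}

section Koszul
variable {ι A : Type*} [CommRing A]

/-- Modulo the ideal `N`, every syzygy of the family `(θ k)`, `k ∈ s`, is a combination of the
Koszul syzygies `θ l · θ k - θ k · θ l = 0`. -/
def TrivialSyzygies (θ : ι → A) (s : Finset ι) (N : Ideal A) : Prop :=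
  ∀ a : ι → A, ∑ k ∈ s, θ k * a k ∈ N →
    ∃ d : ι → ι → A, ∀ k ∈ s, a k - ∑ l ∈ s, (d k l - d l k) * θ l ∈ N

/-- `TrivialSyzygies` for the family `(θ k)`, `k ∈ s`, extended by one more element `g`. -/
def TrivialSyzygiesWith (θ : ι → A) (s : Finset ι) (g : A) (N : Ideal A) : Prop :=
  ∀ (a : ι → A) (v : A), ∑ k ∈ s, θ k * a k + g * v ∈ N →
    ∃ (d : ι → ι → A) (w : ι → A),
      (∀ k ∈ s, a k - ∑ l ∈ s, (d k l - d l k) * θ l - w k * g ∈ N) ∧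
      v + ∑ k ∈ s, w k * θ k ∈ N

theorem sum_koszul_eq_zero (θ : ι → A) (s : Finset ι) (d : ι → ι → A) :
    ∑ k ∈ s, θ k * ∑ l ∈ s, (d k l - d l k) * θ l = 0 := by
  have h : ∑ k ∈ s, ∑ l ∈ s, θ k * (d k l * θ l) = ∑ k ∈ s, ∑ l ∈ s, θ k * (d l k * θ l) := by
    rw [Finset.sum_comm]
    exact Finset.sum_congr rfl fun k _ => Finset.sum_congr rfl fun l _ => by ring
  simp only [Finset.mul_sum, sub_mul, mul_sub, Finset.sum_sub_distrib]
  rw [h, sub_self]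

theorem sum_mul_sub_koszul (θ : ι → A) (s : Finset ι) (d : ι → ι → A) (a : ι → A) :
    ∑ k ∈ s, θ k * (a k - ∑ l ∈ s, (d k l - d l k) * θ l) = ∑ k ∈ s, θ k * a k := by
  simp only [mul_sub, Finset.sum_sub_distrib]
  rw [sum_koszul_eq_zero θ s d, sub_zero]

theorem trivialSyzygies_top (θ : ι → A) (s : Finset ι) : TrivialSyzygies θ s ⊤ :=
  fun _ _ => ⟨0, fun _ _ => trivial⟩

theorem trivialSyzygies_empty (θ : ι → A) (N : Ideal A) : TrivialSyzygies θ ∅ N :=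
  fun _ _ => ⟨0, by simp⟩

/-- Trivial syzygies modulo `N₁ = N : g` and modulo `N₂ = N + (g)` give trivial syzygies
modulo `N`. -/
theorem TrivialSyzygies.of_colon_of_sup {θ : ι → A} {s : Finset ι} {N N₁ N₂ : Ideal A} {g : A}
    (h₁ : TrivialSyzygies θ s N₁) (h₂ : TrivialSyzygies θ s N₂)
    (hcolon : ∀ b, g * b ∈ N ↔ b ∈ N₁) (hle : N ≤ N₂) (hsup : ∀ b ∈ N₂, ∃ c, b - g * c ∈ N) :
    TrivialSyzygies θ s N := by
  intro a ha
  obtain ⟨d, hd⟩ := h₂ a (hle ha)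
  have hex : ∀ k, ∃ c, k ∈ s → a k - ∑ l ∈ s, (d k l - d l k) * θ l - g * c ∈ N := fun k => by
    by_cases hk : k ∈ s
    · obtain ⟨c, hc⟩ := hsup _ (hd k hk)
      exact ⟨c, fun _ => hc⟩
    · exact ⟨0, fun h => absurd h hk⟩
  choose b hb using hex
  have hgb : g * ∑ k ∈ s, θ k * b k ∈ N := by
    have h := N.sub_mem ha (N.sum_mem fun k hk => N.mul_mem_left (θ k) (hb k hk))
    rw [← sum_mul_sub_koszul θ s d a, ← Finset.sum_sub_distrib] at h
    rw [Finset.mul_sum]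
    convert h using 2 with k
    ring
  obtain ⟨d', hd'⟩ := h₁ b ((hcolon _).1 hgb)
  refine ⟨fun k l => d k l + g * d' k l, fun k hk => ?_⟩
  have h := N.add_mem (hb k hk) ((hcolon _).2 (hd' k hk))
  convert h using 1
  have : ∑ l ∈ s, (d k l + g * d' k l - (d l k + g * d' l k)) * θ l =
      ∑ l ∈ s, (d k l - d l k) * θ l + g * ∑ l ∈ s, (d' k l - d' l k) * θ l := by
    rw [Finset.mul_sum, ← Finset.sum_add_distrib]
    exact Finset.sum_congr rfl fun l _ => by ring
  rw [this]
  ring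

theorem TrivialSyzygies.with_nonZeroDivisor {θ : ι → A} {s : Finset ι} {N N₂ : Ideal A} {g : A}
    (h₂ : TrivialSyzygies θ s N₂) (hcolon : ∀ b, g * b ∈ N → b ∈ N) (hle : N ≤ N₂)
    (hg : g ∈ N₂) (hsup : ∀ b ∈ N₂, ∃ c, b - g * c ∈ N) :
    TrivialSyzygiesWith θ s g N := by
  intro a v ha
  obtain ⟨d, hd⟩ := h₂ a <| by
    simpa using N₂.sub_mem (hle ha) (N₂.mul_mem_right v hg)
  have hex : ∀ k, ∃ c, k ∈ s → a k - ∑ l ∈ s, (d k l - d l k) * θ l - g * c ∈ N := fun k => by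
    by_cases hk : k ∈ s
    · obtain ⟨c, hc⟩ := hsup _ (hd k hk)
      exact ⟨c, fun _ => hc⟩
    · exact ⟨0, fun h => absurd h hk⟩
  choose b hb using hex
  refine ⟨d, b, fun k hk => by simpa only [mul_comm] using hb k hk, hcolon _ ?_⟩
  have h := N.sub_mem ha (N.sum_mem fun k hk => N.mul_mem_left (θ k) (hb k hk))
  rw [← sum_mul_sub_koszul θ s d a, add_sub_right_comm, ← Finset.sum_sub_distrib] at h
  rw [mul_add, Finset.mul_sum, add_comm]
  convert h using 3 with k
  ring

theorem trivialSyzygiesWith_one (θ : ι → A) (s : Finset ι) (N : Ideal A) :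
    TrivialSyzygiesWith θ s 1 N := by
  intro a v ha
  refine ⟨0, a, fun k _ => by simp, ?_⟩
  convert ha using 1
  simp only [mul_comm, mul_one]
  ring

theorem TrivialSyzygiesWith.mul {θ : ι → A} {s : Finset ι} {N : Ideal A} {g h : A}
    (hg : TrivialSyzygiesWith θ s g N) (hh : TrivialSyzygiesWith θ s h N) :
    TrivialSyzygiesWith θ s (g * h) N := by
  intro a v ha
  obtain ⟨d, w, hd, hw⟩ := hg a (h * v) (by rwa [← mul_assoc])
  obtain ⟨d', w', hd', hw'⟩ := hh w v (by
    rw [add_comm]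
    simpa only [mul_comm] using hw)
  refine ⟨fun k l => d k l + g * d' k l, w', fun k hk => ?_, hw'⟩
  have H := N.add_mem (hd k hk) (N.mul_mem_left g (hd' k hk))
  convert H using 1
  have : ∑ l ∈ s, (d k l + g * d' k l - (d l k + g * d' l k)) * θ l =
      ∑ l ∈ s, (d k l - d l k) * θ l + g * ∑ l ∈ s, (d' k l - d' l k) * θ l := by
    rw [Finset.mul_sum, ← Finset.sum_add_distrib]
    exact Finset.sum_congr rfl fun l _ => by ring
  rw [this]
  ring

theorem TrivialSyzygiesWith.prod {κ : Type*} {θ : ι → A} {s : Finset ι} {N : Ideal A}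
    {g : κ → A} {V : Finset κ} (h : ∀ v ∈ V, TrivialSyzygiesWith θ s (g v) N) :
    TrivialSyzygiesWith θ s (∏ v ∈ V, g v) N :=
  Finset.prod_induction g (fun x => TrivialSyzygiesWith θ s x N) (fun _ _ => .mul)
    (trivialSyzygiesWith_one θ s N) h

theorem TrivialSyzygiesWith.insert [DecidableEq ι] {θ : ι → A} {s : Finset ι} {N : Ideal A}
    {g : A} {m : ι} (h : TrivialSyzygiesWith θ s g N) (hm : m ∉ s) (hg : θ m - g ∈ N) :
    TrivialSyzygies θ (insert m s) N := by
  intro a ha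
  rw [Finset.sum_insert hm] at ha
  obtain ⟨d, w, hd, hw⟩ := h a (a m) (by
    have := N.sub_mem ha (N.mul_mem_right (a m) hg)
    convert this using 1
    ring)
  classical
  have hne : ∀ l ∈ s, l ≠ m := fun l hl h => hm (h ▸ hl)
  refine ⟨fun k l => if k = m then 0 else if l = m then w k else d k l, fun k hk => ?_⟩
  rw [Finset.sum_insert hm]
  rcases Finset.mem_insert.1 hk with rfl | hk
  · have : ∑ l ∈ s, ((if k = k then 0 else if l = k then w k else d k l) -
        (if l = k then 0 else if k = k then w l else d l k)) * θ l = - ∑ l ∈ s, w l * θ l := by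
      rw [← Finset.sum_neg_distrib]
      exact Finset.sum_congr rfl fun l hl => by simp [hne l hl]
    rw [this]
    simpa using hw
  · have : ∑ l ∈ s, ((if k = m then 0 else if l = m then w k else d k l) -
        (if l = m then 0 else if k = m then w l else d l k)) * θ l =
          ∑ l ∈ s, (d k l - d l k) * θ l :=
      Finset.sum_congr rfl fun l hl => by simp [hne l hl, hne k hk]
    rw [this]
    have H := N.sub_mem (hd k hk) (N.mul_mem_left (w k) hg)
    convert H using 1
    simp [hne k hk]
    ring

end Koszul

section FaceIdeal
variable {σ K : Type*} [CommRing K]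

/-- The ideal spanned by the monomials whose support violates `Δ`. If `Δ` is a simplicial
complex, this is its Stanley–Reisner ideal. -/
def faceIdeal (K : Type*) [CommRing K] (Δ : Finset σ → Prop) : Ideal (MvPolynomial σ K) :=
  Ideal.span ((fun m => monomial m (1 : K)) '' {m | ¬ Δ m.support})

/-- The property `Δ` passes to subsets. -/
def DownClosed (Δ : Finset σ → Prop) : Prop := ∀ F G, F ⊆ G → Δ G → Δ F

theorem mem_faceIdeal {Δ : Finset σ → Prop} (hΔ : DownClosed Δ) {f : MvPolynomial σ K} :
    f ∈ faceIdeal K Δ ↔ ∀ m ∈ f.support, ¬ Δ m.support := by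
  rw [faceIdeal, mem_ideal_span_monomial_image]
  refine forall₂_congr fun m _ => ⟨?_, fun h => ⟨m, h, le_rfl⟩⟩
  rintro ⟨m', h', hle⟩ h
  exact h' (hΔ _ _ (Finsupp.support_mono hle) h)

theorem faceIdeal_le {Δ : Finset σ → Prop} {N : Ideal (MvPolynomial σ K)}
    (h : ∀ m : σ →₀ ℕ, ¬ Δ m.support → monomial m 1 ∈ N) : faceIdeal K Δ ≤ N := by
  rw [faceIdeal, Ideal.span_le]
  rintro _ ⟨m, hm, rfl⟩
  exact h m hm

theorem monomial_mem_faceIdeal {Δ : Finset σ → Prop} {m : σ →₀ ℕ} (h : ¬ Δ m.support) :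
    monomial m (1 : K) ∈ faceIdeal K Δ :=
  Ideal.subset_span ⟨m, h, rfl⟩

theorem faceIdeal_mono {Δ Δ' : Finset σ → Prop} (h : ∀ F, Δ F → Δ' F) :
    faceIdeal K Δ' ≤ faceIdeal K Δ :=
  faceIdeal_le fun _ hm => monomial_mem_faceIdeal fun h' => hm (h _ h')

theorem faceIdeal_false {Δ : Finset σ → Prop} (h : ∀ F, ¬ Δ F) : faceIdeal K Δ = ⊤ :=
  (Ideal.eq_top_iff_one _).2 (monomial_mem_faceIdeal (m := 0) (h _))

theorem DownClosed.deletion {Δ : Finset σ → Prop} (hΔ : DownClosed Δ) (R : Finset σ) :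
    DownClosed fun F => Δ F ∧ ¬ R ⊆ F :=
  fun _ _ h h' => ⟨hΔ _ _ h h'.1, fun hR => h'.2 (hR.trans h)⟩

theorem faceIdeal_inf_le (Δ Δ' : Finset σ → Prop) (hΔ : DownClosed Δ) (hΔ' : DownClosed Δ') :
    faceIdeal K Δ ⊓ faceIdeal K Δ' ≤ faceIdeal K fun F => Δ F ∨ Δ' F := by
  rintro f ⟨h, h'⟩
  rw [SetLike.mem_coe, mem_faceIdeal hΔ] at h
  rw [SetLike.mem_coe, mem_faceIdeal hΔ'] at h'
  rw [mem_faceIdeal fun F G hFG => Or.imp (hΔ _ _ hFG) (hΔ' _ _ hFG)]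
  exact fun m hm => not_or.2 ⟨h m hm, h' m hm⟩

theorem faceIdeal_and_le (Δ Δ' : Finset σ → Prop) :
    (faceIdeal K fun F => Δ F ∧ Δ' F) ≤ faceIdeal K Δ ⊔ faceIdeal K Δ' :=
  faceIdeal_le fun m hm => by
    by_cases h : Δ m.support
    · exact Ideal.mem_sup_right (monomial_mem_faceIdeal fun h' => hm ⟨h, h'⟩)
    · exact Ideal.mem_sup_left (monomial_mem_faceIdeal h)

variable [DecidableEq σ]

/-- The exponent of the squarefree monomial with support `R`. -/
def sqfree (R : Finset σ) : σ →₀ ℕ := Finsupp.indicator R fun _ _ => 1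

theorem sqfree_apply (R : Finset σ) (v : σ) : sqfree R v = if v ∈ R then 1 else 0 := by
  simp [sqfree, Finsupp.indicator_apply]

theorem support_sqfree (R : Finset σ) : (sqfree R).support = R := by
  ext v
  simp [sqfree_apply]

theorem support_sqfree_add (R : Finset σ) (m : σ →₀ ℕ) :
    (sqfree R + m).support = R ∪ m.support := by
  ext v
  simp [sqfree_apply, imp_iff_not_or]

theorem sqfree_le_iff (R : Finset σ) (m : σ →₀ ℕ) : sqfree R ≤ m ↔ R ⊆ m.support := by
  refine ⟨fun h => by simpa [support_sqfree] using Finsupp.support_mono h, fun h v => ?_⟩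
  rw [sqfree_apply]
  split_ifs with hv
  · exact Nat.one_le_iff_ne_zero.2 (Finsupp.mem_support_iff.1 (h hv))
  · exact Nat.zero_le _

theorem prod_X_eq_monomial (R : Finset σ) :
    ∏ v ∈ R, (X v : MvPolynomial σ K) = monomial (sqfree R) 1 := by
  have : sqfree R = ∑ v ∈ R, Finsupp.single v 1 := by
    ext w
    simp [sqfree_apply, Finsupp.finsetSum_apply, Finsupp.single_apply]
  rw [this, monomial_sum_one]
  rfl

theorem prod_X_mem_faceIdeal {Δ : Finset σ → Prop} {R : Finset σ} (h : ¬ Δ R) :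
    ∏ v ∈ R, (X v : MvPolynomial σ K) ∈ faceIdeal K Δ := by
  rw [prod_X_eq_monomial]
  exact monomial_mem_faceIdeal (by rwa [support_sqfree])

theorem DownClosed.star {Δ : Finset σ → Prop} (hΔ : DownClosed Δ) (R : Finset σ) :
    DownClosed fun F => Δ (R ∪ F) :=
  fun _ _ h => hΔ _ _ (Finset.union_subset_union_right h)

theorem monomial_mul_mem_faceIdeal {Δ : Finset σ → Prop} (hΔ : DownClosed Δ) (R : Finset σ)
    (f : MvPolynomial σ K) :
    monomial (sqfree R) 1 * f ∈ faceIdeal K Δ ↔ f ∈ faceIdeal K fun F => Δ (R ∪ F) := by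
  rw [mem_faceIdeal hΔ, mem_faceIdeal (hΔ.star R)]
  constructor
  · intro h m hm
    rw [← support_sqfree_add]
    refine h _ ?_
    rw [mem_support_iff] at hm ⊢
    rwa [coeff_monomial_mul, one_mul]
  · intro h m hm
    rw [mem_support_iff, coeff_monomial_mul'] at hm
    split_ifs at hm with hle
    · obtain ⟨m', rfl⟩ := exists_add_of_le hle
      rw [support_sqfree_add]
      refine h _ ?_
      rw [add_tsub_cancel_left, one_mul] at hm
      rwa [mem_support_iff]
    · exact absurd rfl hm

theorem exists_sub_monomial_mul_mem {Δ : Finset σ → Prop} (hΔ : DownClosed Δ) (R : Finset σ)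
    (f : MvPolynomial σ K) (hf : f ∈ faceIdeal K fun F => Δ F ∧ ¬ R ⊆ F) :
    ∃ c, f - monomial (sqfree R) 1 * c ∈ faceIdeal K Δ := by
  refine ⟨f.divMonomial (sqfree R), ?_⟩
  have h : f - monomial (sqfree R) 1 * (f.divMonomial (sqfree R)) = f.modMonomial (sqfree R) := by
    rw [sub_eq_iff_eq_add', divMonomial_add_modMonomial]
  rw [h, mem_faceIdeal hΔ]
  rw [mem_faceIdeal (hΔ.deletion R)] at hf
  intro m hm hm'
  rw [mem_support_iff] at hm
  by_cases hle : sqfree R ≤ m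
  · exact hm (coeff_modMonomial_of_le f hle)
  · rw [coeff_modMonomial_of_not_le f hle] at hm
    exact hf m (mem_support_iff.2 hm) ⟨hm', fun h => hle ((sqfree_le_iff R m).2 h)⟩

variable {ι : Type*} {θ : ι → MvPolynomial σ K} {s : Finset ι}

/-- A complex inherits trivial syzygies from the star and the deletion of a face. -/
theorem TrivialSyzygies.of_star_of_deletion {Δ : Finset σ → Prop} (hΔ : DownClosed Δ)
    (R : Finset σ) (hstar : TrivialSyzygies θ s (faceIdeal K fun F => Δ (R ∪ F)))
    (hdel : TrivialSyzygies θ s (faceIdeal K fun F => Δ F ∧ ¬ R ⊆ F)) :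
    TrivialSyzygies θ s (faceIdeal K Δ) :=
  hstar.of_colon_of_sup hdel (monomial_mul_mem_faceIdeal hΔ R)
    (faceIdeal_mono fun _ h => h.1) (exists_sub_monomial_mul_mem hΔ R)

/-- Version of `TrivialSyzygies.of_star_of_deletion` deleting a family of faces no two of which
lie in a common face. -/
theorem TrivialSyzygies.of_stars_of_deletion {Δ : Finset σ → Prop} (hΔ : DownClosed Δ)
    (𝓡 : Finset (Finset σ))
    (hdisj : ∀ R ∈ 𝓡, ∀ R' ∈ 𝓡, R ≠ R' → ¬ Δ (R ∪ R'))
    (hstar : ∀ R ∈ 𝓡, TrivialSyzygies θ s (faceIdeal K fun F => Δ (R ∪ F)))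
    (hdel : TrivialSyzygies θ s (faceIdeal K fun F => Δ F ∧ ∀ R ∈ 𝓡, ¬ R ⊆ F)) :
    TrivialSyzygies θ s (faceIdeal K Δ) := by
  induction 𝓡 using Finset.induction_on generalizing Δ with
  | empty => simpa using hdel
  | insert R 𝓡 hR ih =>
    refine .of_star_of_deletion hΔ R (hstar R (Finset.mem_insert_self _ _)) ?_
    refine ih (hΔ.deletion R) ?_ ?_ ?_
    · intro R₁ h₁ R₂ h₂ hne h
      exact hdisj R₁ (Finset.mem_insert_of_mem h₁) R₂ (Finset.mem_insert_of_mem h₂) hne h.1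
    · intro R' hR'
      have hne : R ≠ R' := fun h => hR (h ▸ hR')
      convert hstar R' (Finset.mem_insert_of_mem hR') using 3 with F
      refine and_iff_left_of_imp fun h hsub => ?_
      exact hdisj R (Finset.mem_insert_self _ _) R' (Finset.mem_insert_of_mem hR') hne
        (hΔ _ _ (Finset.union_subset hsub Finset.subset_union_left) h)
    · convert hdel using 3 with F
      simp [and_assoc]

theorem TrivialSyzygies.simplex_insert [DecidableEq ι] {G V : Finset σ} {m : ι} (hm : m ∉ s)
    (hV : V ⊆ G) (hθ : θ m - ∏ v ∈ V, X v ∈ faceIdeal K (· ⊆ G))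
    (h : ∀ v ∈ V, TrivialSyzygies θ s (faceIdeal K (· ⊆ G.erase v))) :
    TrivialSyzygies θ (insert m s) (faceIdeal K (· ⊆ G)) := by
  have hG : DownClosed (· ⊆ G) := fun _ _ h h' => h.trans h'
  refine (TrivialSyzygiesWith.prod (g := X) fun v hv => ?_).insert hm hθ
  have hdel : (· ⊆ G.erase v) = fun F => F ⊆ G ∧ ¬ {v} ⊆ F := by
    ext F
    rw [Finset.subset_erase, Finset.singleton_subset_iff]
  have hX : (X v : MvPolynomial σ K) = monomial (sqfree {v}) 1 := by
    rw [← prod_X_eq_monomial, Finset.prod_singleton]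
  have hv' := h v hv
  rw [hdel] at hv'
  rw [hX]
  refine hv'.with_nonZeroDivisor (fun b hb => ?_) (faceIdeal_mono fun _ h => h.1) ?_
    (exists_sub_monomial_mul_mem hG {v})
  · rw [monomial_mul_mem_faceIdeal hG] at hb
    refine faceIdeal_mono (fun F hF => ?_) hb
    exact Finset.union_subset (Finset.singleton_subset_iff.2 (hV hv)) hF
  · exact monomial_mem_faceIdeal (by simp [support_sqfree])

end FaceIdeal

section BiFace
variable {α : Type*} [DecidableEq α]

/-- The complex of pairs `(L, R)` with `L ⊆ W ∪ A` and `R ⊆ W ∪ B` that are disjoint on `W` and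
meet `W` in at most `p`, respectively at most `q`, elements. -/
structure BiFace (W A B : Finset α) (p q : ℕ) (L R : Finset α) : Prop where
  left : L ⊆ W ∪ A
  right : R ⊆ W ∪ B
  disj : ∀ t ∈ W, t ∈ L → t ∉ R
  card_left : (W ∩ L).card ≤ p
  card_right : (W ∩ R).card ≤ q

theorem BiFace.mono {W A B : Finset α} {p q : ℕ} {L R L' R' : Finset α}
    (h : BiFace W A B p q L R) (hL : L' ⊆ L) (hR : R' ⊆ R) : BiFace W A B p q L' R' where
  left := hL.trans h.left
  right := hR.trans h.right
  disj t ht hl hr := h.disj t ht (hL hl) (hR hr)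
  card_left := (Finset.card_le_card (Finset.inter_subset_inter_left hL)).trans h.card_left
  card_right := (Finset.card_le_card (Finset.inter_subset_inter_left hR)).trans h.card_right

theorem card_insert_inter {t : α} {W L : Finset α} (ht : t ∉ W) :
    (insert t W ∩ L).card = (W ∩ L).card + if t ∈ L then 1 else 0 := by
  split_ifs with h
  · rw [Finset.insert_inter_of_mem h, Finset.card_insert_of_notMem (by simp [ht])]
  · rw [Finset.insert_inter_of_notMem h, add_zero]

theorem biFace_insert_left {t : α} {W A B L R : Finset α} {p q : ℕ} (ht : t ∉ W) (htB : t ∉ B) :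
    BiFace (insert t W) A B (p + 1) q (insert t L) R ↔ BiFace W (insert t A) B p q L R := by
  constructor
  · rintro ⟨h1, h2, h3, h4, h5⟩
    have hR : t ∉ R := h3 t (by simp) (by simp)
    rw [card_insert_inter ht] at h4 h5
    have h6 : W ∩ insert t L = W ∩ L := by grind
    rw [h6] at h4
    refine ⟨by grind, by grind, by grind, by grind, by grind⟩
  · rintro ⟨h1, h2, h3, h4, h5⟩
    have hR : t ∉ R := by grind
    have h6 : W ∩ insert t L = W ∩ L := by grind
    refine ⟨by grind, by grind, by grind, ?_, ?_⟩
    · rw [card_insert_inter ht, h6]; grind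
    · rw [card_insert_inter ht]; grind

theorem biFace_insert_right {t : α} {W A B L R : Finset α} {p q : ℕ} (ht : t ∉ W)
    (htA : t ∉ A) :
    BiFace (insert t W) A B p (q + 1) L (insert t R) ↔ BiFace W A (insert t B) p q L R := by
  constructor
  · rintro ⟨h1, h2, h3, h4, h5⟩
    have hL : t ∉ L := fun h => h3 t (by simp) h (by simp)
    rw [card_insert_inter ht] at h4 h5
    have h6 : W ∩ insert t R = W ∩ R := by grind
    rw [h6] at h5
    refine ⟨by grind, by grind, by grind, by grind, by grind⟩
  · rintro ⟨h1, h2, h3, h4, h5⟩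
    have hL : t ∉ L := by grind
    have h6 : W ∩ insert t R = W ∩ R := by grind
    refine ⟨by grind, by grind, by grind, ?_, ?_⟩
    · rw [card_insert_inter ht]; grind
    · rw [card_insert_inter ht, h6]; grind

theorem biFace_deletion {t : α} {W A B L R : Finset α} {p q : ℕ} (ht : t ∉ W)
    (htA : t ∉ A) (htB : t ∉ B) :
    BiFace (insert t W) A B p q L R ∧ t ∉ L ∧ t ∉ R ↔ BiFace W A B p q L R := by
  constructor
  · rintro ⟨⟨h1, h2, h3, h4, h5⟩, hL, hR⟩
    rw [card_insert_inter ht] at h4 h5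
    exact ⟨by grind, by grind, by grind, by grind, by grind⟩
  · rintro ⟨h1, h2, h3, h4, h5⟩
    have hL : t ∉ L := by grind
    have hR : t ∉ R := by grind
    refine ⟨⟨by grind, by grind, by grind, ?_, ?_⟩, hL, hR⟩ <;>
      rw [card_insert_inter ht] <;> grind

/-- The star of a maximal left face `I`, once `inr t` has been deleted. -/
theorem biFace_union_left {t : α} {W A B I L R : Finset α} {p q : ℕ} (ht : t ∉ W)
    (htA : t ∉ A) (htB : t ∉ B) (hA : Disjoint W A) (hB : Disjoint W B) (hI : I ⊆ W)
    (hp : I.card = p) (hq : p + q = W.card) :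
    BiFace (insert t W) A B p q (I ∪ L) R ∧ t ∉ R ↔ L ⊆ A ∪ I ∧ R ⊆ B ∪ (W \ I) := by
  have hc : (W \ I).card = q := by rw [Finset.card_sdiff_of_subset hI]; omega
  constructor
  · rintro ⟨⟨h1, h2, h3, h4, h5⟩, hR⟩
    have h6 : I = insert t W ∩ (I ∪ L) :=
      Finset.eq_of_subset_of_card_le (by grind) (by omega)
    exact ⟨by grind, by grind⟩
  · rintro ⟨h1, h2⟩
    have h7 : insert t W ∩ (I ∪ L) = I := by
      have := Finset.disjoint_left.1 hA
      grind
    have h8 : insert t W ∩ R ⊆ W \ I := by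
      have := Finset.disjoint_left.1 hB
      grind
    refine ⟨⟨by grind, by grind, ?_, by rw [h7, hp], hc ▸ Finset.card_le_card h8⟩, by grind⟩
    have := Finset.disjoint_left.1 hA
    grind

/-- What remains after deleting `inr t` and all left faces of size `p + 1` is a cone over
`inl t`. -/
theorem biFace_cone {t : α} {W A B L R : Finset α} {p q : ℕ} (ht : t ∉ W) (htB : t ∉ B) :
    BiFace (insert t W) A B (p + 1) q L R ∧ t ∉ R ∧ (W ∩ L).card ≤ p ↔
      BiFace W (insert t A) B p q L R := by
  constructor
  · rintro ⟨⟨h1, h2, h3, h4, h5⟩, hR, h⟩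
    rw [card_insert_inter ht] at h5
    exact ⟨by grind, by grind, by grind, by grind, by grind⟩
  · rintro ⟨h1, h2, h3, h4, h5⟩
    have hR : t ∉ R := by grind
    refine ⟨⟨by grind, by grind, by grind, ?_, ?_⟩, hR, h4⟩ <;>
      rw [card_insert_inter ht] <;> grind

end BiFace

section Bicolored
variable {α K : Type*} [Fintype α] [DecidableEq α] [CommRing K]

/-- The elementary symmetric polynomials of positive degree in the variables `X (inl t)`,
and those in the variables `X (inr t)`; the index `k` has degree `k + 1`. -/
def biEsymm (α K : Type*) [Fintype α] [CommRing K] : ℕ ⊕ ℕ → MvPolynomial (α ⊕ α) K :=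
  Sum.elim
    (fun k => ∑ S ∈ Finset.powersetCard (k + 1) Finset.univ, ∏ t ∈ S, X (Sum.inl t))
    (fun k => ∑ S ∈ Finset.powersetCard (k + 1) Finset.univ, ∏ t ∈ S, X (Sum.inr t))

/-- The indices of `e₁, …, e_p` and `f₁, …, f_q`. -/
def biIndex (p q : ℕ) : Finset (ℕ ⊕ ℕ) := (Finset.range p).disjSum (Finset.range q)

theorem biIndex_succ_left (p q : ℕ) :
    biIndex (p + 1) q = insert (Sum.inl p) (biIndex p q) := by
  ext (k | k) <;> simp [biIndex, Nat.le_iff_lt_or_eq, or_comm]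

theorem biIndex_succ_right (p q : ℕ) :
    biIndex p (q + 1) = insert (Sum.inr q) (biIndex p q) := by
  ext (k | k) <;> simp [biIndex, Nat.le_iff_lt_or_eq, or_comm]

theorem sum_prod_X_sub_mem {Δ : Finset (α ⊕ α) → Prop} (c : α ↪ α ⊕ α) {V : Finset α} {k : ℕ}
    (hV : V.card = k) (h : ∀ S : Finset α, S.card = k → S ≠ V → ¬ Δ (S.map c)) :
    ∑ S ∈ Finset.powersetCard k Finset.univ, ∏ t ∈ S, (X (c t) : MvPolynomial (α ⊕ α) K)
      - ∏ v ∈ V.map c, X v ∈ faceIdeal K Δ := by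
  rw [← Finset.add_sum_erase _ _
    (Finset.mem_powersetCard.2 ⟨Finset.subset_univ V, hV⟩), Finset.prod_map, add_sub_cancel_left]
  refine Ideal.sum_mem _ fun S hS => ?_
  rw [Finset.mem_erase, Finset.mem_powersetCard] at hS
  rw [← Finset.prod_map S c]
  exact prod_X_mem_faceIdeal (h S hS.2.2 hS.1)

theorem trivialSyzygies_simplex (A B : Finset α) :
    TrivialSyzygies (biEsymm α K) (biIndex A.card B.card) (faceIdeal K (· ⊆ A.disjSum B)) := by
  induction hN : A.card + B.card generalizing A B with
  | zero =>
    obtain ⟨hA, hB⟩ := Nat.add_eq_zero_iff.1 hN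
    rw [hA, hB]
    exact trivialSyzygies_empty _ _
  | succ N ih =>
    rcases Nat.eq_zero_or_eq_succ_pred A.card with hA | hA
    · obtain ⟨q, hq⟩ : ∃ q, B.card = q + 1 := ⟨N, by omega⟩
      rw [hq, biIndex_succ_right]
      refine .simplex_insert (V := B.map .inr) (by simp [biIndex]) ?_ ?_ ?_
      · intro v hv
        obtain ⟨t, ht, rfl⟩ := Finset.mem_map.1 hv
        simpa using ht
      · refine sum_prod_X_sub_mem (.inr) hq fun S hS hne hsub => hne ?_
        refine Finset.eq_of_subset_of_card_le (fun t ht => ?_) (by omega)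
        simpa using hsub (Finset.mem_map_of_mem _ ht)
      · intro v hv
        obtain ⟨t, ht, rfl⟩ := Finset.mem_map.1 hv
        have hc : (B.erase t).card = q := by rw [Finset.card_erase_of_mem ht]; omega
        have he : (A.disjSum B).erase (Sum.inr t) = A.disjSum (B.erase t) := by
          ext (u | u) <;> simp
        have := ih A (B.erase t) (by omega)
        rw [hc] at this
        simpa [he] using this
    · obtain ⟨p, hp⟩ : ∃ p, A.card = p + 1 := ⟨_, hA⟩
      rw [hp, biIndex_succ_left]
      refine .simplex_insert (V := A.map .inl) (by simp [biIndex]) ?_ ?_ ?_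
      · intro v hv
        obtain ⟨t, ht, rfl⟩ := Finset.mem_map.1 hv
        simpa using ht
      · refine sum_prod_X_sub_mem (.inl) hp fun S hS hne hsub => hne ?_
        refine Finset.eq_of_subset_of_card_le (fun t ht => ?_) (by omega)
        simpa using hsub (Finset.mem_map_of_mem _ ht)
      · intro v hv
        obtain ⟨t, ht, rfl⟩ := Finset.mem_map.1 hv
        have hc : (A.erase t).card = p := by rw [Finset.card_erase_of_mem ht]; omega
        have he : (A.disjSum B).erase (Sum.inl t) = (A.erase t).disjSum B := by
          ext (u | u) <;> simp
        have := ih (A.erase t) B (by omega)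
        rw [hc] at this
        simpa [he] using this

/-- The family `e₁, …, f₁, …` has only trivial syzygies on the Stanley–Reisner ring of the complex
of disjoint pairs of size at most `(p, q)` in `W`, joined with two simplices, if `p + q < |W|`. -/
theorem trivialSyzygies_biFace (W A B : Finset α) (p q : ℕ) (hA : Disjoint W A)
    (hB : Disjoint W B) (hW : p + q < W.card) :
    TrivialSyzygies (biEsymm α K) (biIndex (p + A.card) (q + B.card))
      (faceIdeal K fun F => BiFace W A B p q F.toLeft F.toRight) := by
  induction W using Finset.induction_on generalizing A B p q with
  | empty => simp at hW
  | insert t W ht ih =>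
    rw [Finset.card_insert_of_notMem ht] at hW
    obtain ⟨htA, hA⟩ := Finset.disjoint_insert_left.1 hA
    obtain ⟨htB, hB⟩ := Finset.disjoint_insert_left.1 hB
    have hA' : Disjoint W (insert t A) := Finset.disjoint_insert_right.2 ⟨ht, hA⟩
    have hB' : Disjoint W (insert t B) := Finset.disjoint_insert_right.2 ⟨ht, hB⟩
    have hmono : ∀ P Q, DownClosed fun F : Finset (α ⊕ α) =>
        BiFace (insert t W) A B P Q F.toLeft F.toRight := fun P Q F G hFG hG =>
      hG.mono (Finset.toLeft_subset_toLeft hFG) (Finset.toRight_subset_toRight hFG)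
    have hfalse : ∀ {Δ : Finset (α ⊕ α) → Prop}, (∀ F, ¬ Δ F) → TrivialSyzygies (biEsymm α K)
        (biIndex (p + A.card) (q + B.card)) (faceIdeal K Δ) := fun h => by
      rw [faceIdeal_false h]
      exact trivialSyzygies_top _ _
    rcases (Nat.lt_succ_iff.1 hW).lt_or_eq with hlt | heq
    · refine .of_star_of_deletion (hmono p q) {Sum.inl t} ?_ ?_
      · rcases p with _ | p
        · refine hfalse fun F hF => ?_
          have := hF.card_left
          rw [card_insert_inter ht] at this
          simp at this
        · have := ih (insert t A) B p q hA' hB (by omega)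
          rw [Finset.card_insert_of_notMem htA, ← add_assoc, add_right_comm] at this
          convert this using 3 with F
          rw [← biFace_insert_left ht htB, ← Finset.insert_eq, Finset.toLeft_insert_inl,
            Finset.toRight_insert_inl]
      refine .of_star_of_deletion ((hmono p q).deletion _) {Sum.inr t} ?_ ?_
      · rcases q with _ | q
        · refine hfalse fun F hF => ?_
          have := hF.1.card_right
          rw [card_insert_inter ht] at this
          simp at this
        · have := ih A (insert t B) p q hA hB' (by omega)
          rw [Finset.card_insert_of_notMem htB, ← add_assoc, add_right_comm q] at this
          convert this using 3 with F
          rw [← biFace_insert_right ht htA, ← Finset.insert_eq, Finset.toLeft_insert_inr,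
            Finset.toRight_insert_inr]
          refine and_iff_left_of_imp fun h h' => ?_
          exact h.disj t (by simp) (by simpa using h') (by simp)
      · convert ih A B p q hA hB (by omega) using 3 with F
        rw [← biFace_deletion ht htA htB]
        simp [and_assoc]
    · refine .of_star_of_deletion (hmono p q) {Sum.inr t} ?_ ?_
      · rcases q with _ | q
        · refine hfalse fun F hF => ?_
          have := hF.card_right
          rw [card_insert_inter ht] at this
          simp at this
        · have := ih A (insert t B) p q hA hB' (by omega)
          rw [Finset.card_insert_of_notMem htB, ← add_assoc, add_right_comm q] at this
          convert this using 3 with F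
          rw [← biFace_insert_right ht htA, ← Finset.insert_eq, Finset.toLeft_insert_inr,
            Finset.toRight_insert_inr]
      refine .of_stars_of_deletion ((hmono p q).deletion _)
        ((Finset.powersetCard p W).image fun I => I.disjSum ∅) ?_ ?_ ?_
      · simp only [Finset.mem_image, Finset.mem_powersetCard]
        rintro _ ⟨I, ⟨hI, hIp⟩, rfl⟩ _ ⟨J, ⟨hJ, hJp⟩, rfl⟩ hne ⟨h, -⟩
        refine hne ?_
        have hsub : I ∪ J ⊆ insert t W ∩ (I ∪ J) := by grind
        have hle : (I ∪ J).card ≤ p := (Finset.card_le_card hsub).trans <| by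
          simpa only [Finset.toLeft_union, Finset.toLeft_disjSum] using h.card_left
        have h1 := Finset.eq_of_subset_of_card_le (Finset.subset_union_left (s₁ := I) (s₂ := J))
          (by omega)
        have h2 := Finset.eq_of_subset_of_card_le (Finset.subset_union_right (s₁ := I) (s₂ := J))
          (by omega)
        rw [h1.trans h2.symm]
      · simp only [Finset.mem_image, Finset.mem_powersetCard]
        rintro _ ⟨I, ⟨hI, hIp⟩, rfl⟩
        have hc1 : (A ∪ I).card = p + A.card := by
          rw [Finset.card_union_of_disjoint (hA.symm.mono_right hI), hIp, add_comm]
        have hc2 : (B ∪ (W \ I)).card = q + B.card := by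
          rw [Finset.card_union_of_disjoint (hB.symm.mono_right Finset.sdiff_subset),
            Finset.card_sdiff_of_subset hI]
          omega
        have := trivialSyzygies_simplex (K := K) (A ∪ I) (B ∪ (W \ I))
        rw [hc1, hc2] at this
        convert this using 3 with F
        rw [Finset.subset_disjSum, ← biFace_union_left ht htA htB hA hB hI hIp heq,
          Finset.toLeft_union, Finset.toRight_union, Finset.toLeft_disjSum,
          Finset.toRight_disjSum, Finset.empty_union]
        simp
      · rcases p with _ | p
        · refine hfalse fun F hF => ?_
          simpa using hF.2
        · have := ih (insert t A) B p q hA' hB (by omega)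
          rw [Finset.card_insert_of_notMem htA, ← add_assoc, add_right_comm] at this
          convert this using 3 with F
          rw [← biFace_cone ht htB, and_assoc]
          refine and_congr_right fun _ => and_congr (by simp) ?_
          simp only [Finset.mem_image, Finset.mem_powersetCard]
          constructor
          · intro h
            by_contra! hlt
            obtain ⟨I, hI, hIc⟩ := Finset.exists_subset_card_eq (Nat.succ_le_of_lt hlt)
            refine h _ ⟨I, ⟨hI.trans Finset.inter_subset_left, hIc⟩, rfl⟩ ?_
            rw [Finset.disjSum_subset]
            exact ⟨hI.trans Finset.inter_subset_right, Finset.empty_subset _⟩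
          · rintro h _ ⟨I, ⟨hI, hIc⟩, rfl⟩ hsub
            have := Finset.card_le_card
              (Finset.subset_inter hI (Finset.disjSum_subset.1 hsub).1)
            omega

end Bicolored

section Filtration

theorem biEsymm_inr (α K : Type*) [Fintype α] [CommRing K] (q : ℕ) :
    biEsymm α K (.inr q) = ∑ S ∈ Finset.powersetCard (q + 1) Finset.univ,
      ∏ t ∈ S, X (Function.Embedding.inr t) :=
  rfl

/-- No index carries both an `x` and a `y`. -/
def IsDisjFace {n : ℕ} (F : Finset (Fin n ⊕ Fin n)) : Prop :=
  ∀ t, Sum.inl t ∈ F → Sum.inr t ∉ F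

theorem isDisjFace_downClosed (n : ℕ) : DownClosed (IsDisjFace (n := n)) :=
  fun _ _ hFG hG t hl hr => hG t (hFG hl) (hFG hr)

/-- The complex of disjoint faces with fewer than `k` of the `y`. -/
def FaceY (n k : ℕ) (F : Finset (Fin n ⊕ Fin n)) : Prop := IsDisjFace F ∧ F.toRight.card < k

/-- The complex of disjoint faces with fewer than `k` of the `x`. -/
def FaceX (n k : ℕ) (F : Finset (Fin n ⊕ Fin n)) : Prop := IsDisjFace F ∧ F.toLeft.card < k

theorem faceY_downClosed (n k : ℕ) : DownClosed (FaceY n k) := fun F G hFG hG =>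
  ⟨isDisjFace_downClosed n F G hFG hG.1,
    (Finset.card_le_card (Finset.toRight_subset_toRight hFG)).trans_lt hG.2⟩

theorem faceX_downClosed (n k : ℕ) : DownClosed (FaceX n k) := fun F G hFG hG =>
  ⟨isDisjFace_downClosed n F G hFG hG.1,
    (Finset.card_le_card (Finset.toLeft_subset_toLeft hFG)).trans_lt hG.2⟩

theorem Bideal_le_faceIdeal {n : ℕ} {Δ : Finset (Fin n ⊕ Fin n) → Prop}
    (h : ∀ F, Δ F → IsDisjFace F) : Bideal n ≤ faceIdeal ℂ Δ := by
  rw [Bideal, Ideal.span_le]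
  rintro _ ⟨t, rfl⟩
  have := prod_X_mem_faceIdeal (K := ℂ) (Δ := Δ) (R := {Sum.inl t, Sum.inr t})
    fun hΔ => h _ hΔ t (by simp) (by simp)
  rwa [Finset.prod_pair (by simp)] at this

theorem mkB_eq_zero_of_mem {n : ℕ} {f : MvPolynomial (Fin n ⊕ Fin n) ℂ}
    (hf : f ∈ faceIdeal ℂ (IsDisjFace (n := n))) : mkB n f = 0 := by
  rw [Ideal.Quotient.mkₐ_eq_mk, Ideal.Quotient.eq_zero_iff_mem]
  refine (faceIdeal_le (N := Bideal n) fun m hm => ?_) hf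
  unfold IsDisjFace at hm
  push Not at hm
  obtain ⟨t, hl, hr⟩ := hm
  have hsub : ({Sum.inl t, Sum.inr t} : Finset (Fin n ⊕ Fin n)) ⊆ m.support := by
    simp [Finset.insert_subset_iff, Finsupp.mem_support_iff.1 hl, Finsupp.mem_support_iff.1 hr]
  refine (Bideal n).mem_of_dvd ?_ (Ideal.subset_span ⟨t, rfl⟩)
  change X (Sum.inl t) * X (Sum.inr t) ∣ _
  rw [← Finset.prod_pair (f := X) (by simp : (Sum.inl t : Fin n ⊕ Fin n) ≠ Sum.inr t),
    prod_X_eq_monomial, monomial_one_dvd_monomial_one]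
  exact (sqfree_le_iff _ _).2 hsub

theorem mkB_monomial_eq_zero {n : ℕ} {m : (Fin n ⊕ Fin n) →₀ ℕ} (hm : ¬ IsDisjFace m.support) :
    mkB n (monomial m 1) = 0 :=
  mkB_eq_zero_of_mem (monomial_mem_faceIdeal hm)

theorem prod_xv (n : ℕ) (I : Finset (Fin n)) :
    ∏ t ∈ I, xv n t = mkB n (∏ v ∈ I.map .inl, X v) := by
  simp [xv]

theorem prod_yv (n : ℕ) (J : Finset (Fin n)) :
    ∏ t ∈ J, yv n t = mkB n (∏ v ∈ J.map .inr, X v) := by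
  simp [yv]

theorem mkB_biEsymm_inl (n k : ℕ) : mkB n (biEsymm (Fin n) ℂ (.inl k)) = eX n (k + 1) := by
  simp [biEsymm, eX, xv]

theorem mkB_biEsymm_inr (n k : ℕ) : mkB n (biEsymm (Fin n) ℂ (.inr k)) = fY n (k + 1) := by
  simp [biEsymm, fY, yv]

theorem mkB_mem_FB {n k : ℕ} {f : MvPolynomial (Fin n ⊕ Fin n) ℂ}
    (hf : f ∈ faceIdeal ℂ (FaceY n k)) : mkB n f ∈ FB n k := by
  refine (faceIdeal_le (N := (FB n k).comap (mkB n)) fun m hm => ?_) hf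
  rw [Ideal.mem_comap]
  by_cases hd : IsDisjFace m.support
  · have hk : k ≤ m.support.toRight.card := not_lt.1 fun h => hm ⟨hd, h⟩
    obtain ⟨J, hJ, hJk⟩ := Finset.exists_subset_card_eq hk
    refine (FB n k).mem_of_dvd ?_ (Ideal.subset_span ⟨J, hJk, rfl⟩)
    rw [prod_yv, prod_X_eq_monomial]
    refine map_dvd (mkB n) (monomial_one_dvd_monomial_one.2 ((sqfree_le_iff _ _).2 ?_))
    rwa [Finset.map_inr_subset_iff_subset_toRight]
  · rw [mkB_monomial_eq_zero hd]
    exact zero_mem _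

theorem prod_X_inr_mem (n : ℕ) (J : Finset (Fin n)) :
    ∏ v ∈ J.map .inr, X v ∈ faceIdeal ℂ (FaceY n J.card) :=
  prod_X_mem_faceIdeal fun h => by
    have h2 := h.2
    rw [← Finset.empty_disjSum, Finset.toRight_disjSum] at h2
    exact lt_irrefl _ h2

theorem prod_X_inl_mem (n : ℕ) (I : Finset (Fin n)) :
    ∏ v ∈ I.map .inl, X v ∈ faceIdeal ℂ (FaceX n I.card) :=
  prod_X_mem_faceIdeal fun h => by
    have h2 := h.2
    rw [← Finset.disjSum_empty, Finset.toLeft_disjSum] at h2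
    exact lt_irrefl _ h2

theorem FB_le_map (n k : ℕ) :
    FB n k ≤ (faceIdeal ℂ (FaceY n k)).map (Ideal.Quotient.mk (Bideal n)) := by
  rw [FB, Ideal.span_le]
  rintro _ ⟨J, rfl, rfl⟩
  rw [prod_yv]
  exact Ideal.mem_map_of_mem _ (prod_X_inr_mem n J)

theorem mem_faceIdeal_of_mkB_mem_FB {n k : ℕ} {f : MvPolynomial (Fin n ⊕ Fin n) ℂ}
    (hf : mkB n f ∈ FB n k) : f ∈ faceIdeal ℂ (FaceY n k) :=
  (Ideal.mem_quotient_iff_mem (Bideal_le_faceIdeal fun _ h => h.1)).1 (FB_le_map n k hf)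

theorem permB_xv (n : ℕ) (σ : Equiv.Perm (Fin n)) (t : Fin n) :
    permB n σ (xv n t) = xv n (σ t) := by
  have : permB n σ (mkB n (X (Sum.inl t))) =
      (mkB n).comp (rename (Sum.map ⇑σ ⇑σ)) (X (Sum.inl t)) := rfl
  simpa [xv] using this

theorem permB_yv (n : ℕ) (σ : Equiv.Perm (Fin n)) (t : Fin n) :
    permB n σ (yv n t) = yv n (σ t) := by
  have : permB n σ (mkB n (X (Sum.inr t))) =
      (mkB n).comp (rename (Sum.map ⇑σ ⇑σ)) (X (Sum.inr t)) := rfl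
  simpa [yv] using this

theorem ev0_xv (n : ℕ) (t : Fin n) : ev0 n (xv n t) = 0 := by
  have : ev0 n (mkB n (X (Sum.inl t))) = aeval (fun _ => (0 : ℂ)) (X (Sum.inl t)) := rfl
  simpa [xv] using this

theorem ev0_yv (n : ℕ) (t : Fin n) : ev0 n (yv n t) = 0 := by
  have : ev0 n (mkB n (X (Sum.inr t))) = aeval (fun _ => (0 : ℂ)) (X (Sum.inr t)) := rfl
  simpa [yv] using this

theorem sum_prod_mem_Jn {n k : ℕ} {z : Fin n → B n} (hz : ∀ σ t, permB n σ (z t) = z (σ t))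
    (h0 : ∀ t, ev0 n (z t) = 0) :
    ∑ S ∈ Finset.powersetCard (k + 1) Finset.univ, ∏ t ∈ S, z t ∈ Jn n := by
  refine Ideal.subset_span ⟨fun σ => ?_, ?_⟩
  · rw [map_sum]
    refine Finset.sum_bij (fun S _ => S.map σ.toEmbedding) ?_ ?_ ?_ ?_
    · intro S hS
      simpa [Finset.mem_powersetCard] using hS
    · intro S _ T _ h
      exact Finset.map_injective _ h
    · intro S hS
      exact ⟨S.map σ.symm.toEmbedding, by simpa [Finset.mem_powersetCard] using hS,
        by simp [Finset.map_map]⟩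
    · intro S _
      simp [map_prod, hz]
  · rw [map_sum]
    refine Finset.sum_eq_zero fun S hS => ?_
    obtain ⟨t, ht⟩ : S.Nonempty := by
      rw [← Finset.card_pos, (Finset.mem_powersetCard.1 hS).2]
      exact Nat.succ_pos k
    rw [map_prod]
    exact Finset.prod_eq_zero ht (h0 t)

theorem mkB_biEsymm_mem_Jn (n : ℕ) (k : ℕ ⊕ ℕ) : mkB n (biEsymm (Fin n) ℂ k) ∈ Jn n := by
  rcases k with k | k
  · rw [mkB_biEsymm_inl]
    exact sum_prod_mem_Jn (permB_xv n) (ev0_xv n)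
  · rw [mkB_biEsymm_inr]
    exact sum_prod_mem_Jn (permB_yv n) (ev0_yv n)

/-- Monomials with `n - k` of the `x` and `k` of the `y` are multiples of `f_k` in `B n`. -/
theorem mkB_prod_mul_prod_mem_Jn {n q : ℕ} {L R : Finset (Fin n)} (huniv : L ∪ R = Finset.univ)
    (hR : R.card = q + 1) :
    mkB n ((∏ v ∈ L.map .inl, X v) * ∏ v ∈ R.map .inr, X v) ∈ Jn n := by
  have hsub : biEsymm (Fin n) ℂ (.inr q) - ∏ v ∈ R.map .inr, X v ∈
      faceIdeal ℂ fun F => IsDisjFace (L.map .inl ∪ F) := by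
    rw [biEsymm_inr]
    refine sum_prod_X_sub_mem (Δ := fun F => IsDisjFace (L.map .inl ∪ F)) .inr hR
      fun S hS hne h => hne ?_
    refine Finset.eq_of_subset_of_card_le (fun t ht => ?_) (by omega)
    have htu : t ∈ L ∪ R := huniv ▸ Finset.mem_univ t
    refine (Finset.mem_union.1 htu).resolve_left fun htL => ?_
    exact h t (by simpa using htL) (by simpa using ht)
  have hzero := mkB_eq_zero_of_mem
    ((monomial_mul_mem_faceIdeal (isDisjFace_downClosed n) (L.map .inl) _).2 hsub)
  rw [← prod_X_eq_monomial, mul_sub, map_sub, sub_eq_zero] at hzero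
  rw [← hzero, map_mul]
  exact (Jn n).mul_mem_left _ (mkB_biEsymm_mem_Jn n _)

theorem mkB_mem_Jn_of_mem_inf {n p q : ℕ} (hn : n = p + 1 + (q + 1))
    {f : MvPolynomial (Fin n ⊕ Fin n) ℂ}
    (hf : f ∈ faceIdeal ℂ (FaceX n (p + 1)) ⊓ faceIdeal ℂ (FaceY n (q + 1))) :
    mkB n f ∈ Jn n := by
  have hf' := faceIdeal_inf_le _ _ (faceX_downClosed n _) (faceY_downClosed n _) hf
  refine (faceIdeal_le (N := (Jn n).comap (mkB n)) fun m hm => ?_) hf'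
  rw [Ideal.mem_comap]
  by_cases hd : IsDisjFace m.support
  swap
  · rw [mkB_monomial_eq_zero hd]
    exact zero_mem _
  obtain ⟨L, R, hLR⟩ : ∃ L R, m.support = Finset.disjSum L R :=
    ⟨_, _, Finset.toLeft_disjSum_toRight.symm⟩
  have hLc : p + 1 ≤ L.card := not_lt.1 fun h => hm (Or.inl ⟨hd, by
    rwa [hLR, Finset.toLeft_disjSum]⟩)
  have hRc : q + 1 ≤ R.card := not_lt.1 fun h => hm (Or.inr ⟨hd, by
    rwa [hLR, Finset.toRight_disjSum]⟩)
  have hdisj : Disjoint L R := Finset.disjoint_left.2 fun t hl hr =>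
    hd t (hLR ▸ Finset.inl_mem_disjSum.2 hl) (hLR ▸ Finset.inr_mem_disjSum.2 hr)
  have hcard : (L ∪ R).card ≤ n := by simpa using Finset.card_le_univ (L ∪ R)
  rw [Finset.card_union_of_disjoint hdisj] at hcard
  have huniv : L ∪ R = Finset.univ := by
    rw [← Finset.card_eq_iff_eq_univ, Finset.card_union_of_disjoint hdisj, Fintype.card_fin]
    omega
  refine (Jn n).mem_of_dvd (map_dvd (mkB n) ?_)
    (mkB_prod_mul_prod_mem_Jn huniv (by omega : R.card = q + 1))
  rw [← Finset.prod_disjUnion (Finset.disjoint_map_inl_map_inr L R), prod_X_eq_monomial,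
    monomial_one_dvd_monomial_one]
  exact (sqfree_le_iff _ _).2 hLR.ge

theorem Iij_le_map_s12 {n p q : ℕ} :
    Iij n (p + 1) (q + 2) ≤
      (Ideal.span (biEsymm (Fin n) ℂ '' (biIndex p q : Set (ℕ ⊕ ℕ))) ⊔
        Ideal.span {biEsymm (Fin n) ℂ (.inr q)} ⊔ faceIdeal ℂ (FaceY n (q + 2)) ⊔
        faceIdeal ℂ (FaceX n (p + 1))).map (Ideal.Quotient.mk (Bideal n)) := by
  rw [Iij, Ideal.span_le]
  rintro _ (((⟨k, hk1, hk2, rfl⟩ | ⟨I, hI, rfl⟩) | ⟨k, hk1, hk2, rfl⟩) | ⟨J, hJ, rfl⟩)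
  · obtain ⟨k, rfl⟩ := Nat.exists_eq_add_of_le' hk1
    rw [← mkB_biEsymm_inl]
    refine Ideal.mem_map_of_mem _ (Ideal.mem_sup_left (Ideal.mem_sup_left
      (Ideal.mem_sup_left (Ideal.subset_span ⟨_, ?_, rfl⟩))))
    simpa [biIndex] using hk2
  · rw [prod_xv]
    exact Ideal.mem_map_of_mem _ (Ideal.mem_sup_right (hI ▸ prod_X_inl_mem n I))
  · obtain ⟨k, rfl⟩ := Nat.exists_eq_add_of_le' hk1
    rw [← mkB_biEsymm_inr]
    refine Ideal.mem_map_of_mem _ (Ideal.mem_sup_left (Ideal.mem_sup_left ?_))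
    rcases (by omega : k < q ∨ k = q) with h | rfl
    · refine Ideal.mem_sup_left (Ideal.subset_span ⟨_, ?_, rfl⟩)
      simpa [biIndex] using h
    · exact Ideal.mem_sup_right (Ideal.subset_span rfl)
  · rw [prod_yv]
    exact Ideal.mem_map_of_mem _
      (Ideal.mem_sup_left (Ideal.mem_sup_right (hJ ▸ prod_X_inr_mem n J)))

theorem mem_sup_of_mkB_mem_Iij {n p q : ℕ} {f : MvPolynomial (Fin n ⊕ Fin n) ℂ}
    (hf : mkB n f ∈ Iij n (p + 1) (q + 2)) :
    f ∈ Ideal.span (biEsymm (Fin n) ℂ '' (biIndex p q : Set (ℕ ⊕ ℕ))) ⊔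
        Ideal.span {biEsymm (Fin n) ℂ (.inr q)} ⊔ faceIdeal ℂ (FaceY n (q + 2)) ⊔
        faceIdeal ℂ (FaceX n (p + 1)) :=
  (Ideal.mem_quotient_iff_mem ((Bideal_le_faceIdeal fun _ h => h.1).trans le_sup_right)).1
    (Iij_le_map_s12 hf)

theorem biEsymm_inr_mem_faceIdeal (n q : ℕ) :
    biEsymm (Fin n) ℂ (.inr q) ∈ faceIdeal ℂ (FaceY n (q + 1)) := by
  rw [biEsymm_inr]
  refine Ideal.sum_mem _ fun S hS => ?_
  rw [← Finset.prod_map S, ← (Finset.mem_powersetCard.1 hS).2]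
  exact prod_X_inr_mem n S

theorem biFace_univ_of_faceX_of_faceY {n p q : ℕ} {F : Finset (Fin n ⊕ Fin n)}
    (hX : FaceX n (p + 1) F) (hY : FaceY n (q + 1) F) :
    BiFace Finset.univ ∅ ∅ p q F.toLeft F.toRight where
  left := by simp
  right := by simp
  disj t _ hl hr := hX.1 t (Finset.mem_toLeft.1 hl) (Finset.mem_toRight.1 hr)
  card_left := by simpa [Nat.lt_succ_iff] using hX.2
  card_right := by simpa [Nat.lt_succ_iff] using hY.2

theorem BiFace.faceX_and_faceY {n p q : ℕ} {F : Finset (Fin n ⊕ Fin n)}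
    (h : BiFace Finset.univ ∅ ∅ p q F.toLeft F.toRight) :
    FaceX n (p + 1) F ∧ FaceY n (q + 1) F := by
  have hd : IsDisjFace F := fun t hl hr =>
    h.disj t (Finset.mem_univ t) (Finset.mem_toLeft.2 hl) (Finset.mem_toRight.2 hr)
  exact ⟨⟨hd, Nat.lt_succ_iff.2 (by simpa using h.card_left)⟩,
    ⟨hd, Nat.lt_succ_iff.2 (by simpa using h.card_right)⟩⟩

/-- The coefficients of a combination of the `e_k` and `f_k` lying in the sum of the face ideals
can be chosen in that sum. -/
theorem exists_coeff_mem_faceIdeal {n p q : ℕ} (hn : n = p + 1 + (q + 1))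
    {a : ℕ ⊕ ℕ → MvPolynomial (Fin n ⊕ Fin n) ℂ}
    (ha : ∑ k ∈ biIndex p q, biEsymm (Fin n) ℂ k * a k ∈
      faceIdeal ℂ (FaceX n (p + 1)) ⊔ faceIdeal ℂ (FaceY n (q + 1))) :
    ∃ w u : ℕ ⊕ ℕ → MvPolynomial (Fin n ⊕ Fin n) ℂ,
      (∀ k ∈ biIndex p q, w k ∈ faceIdeal ℂ (FaceX n (p + 1))) ∧
      (∀ k ∈ biIndex p q, u k ∈ faceIdeal ℂ (FaceY n (q + 1))) ∧
      ∑ k ∈ biIndex p q, biEsymm (Fin n) ℂ k * a k =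
        ∑ k ∈ biIndex p q, biEsymm (Fin n) ℂ k * w k +
          ∑ k ∈ biIndex p q, biEsymm (Fin n) ℂ k * u k := by
  have hle : faceIdeal ℂ (FaceX n (p + 1)) ⊔ faceIdeal ℂ (FaceY n (q + 1)) ≤
      faceIdeal ℂ fun F => BiFace Finset.univ ∅ ∅ p q F.toLeft F.toRight :=
    sup_le (faceIdeal_mono fun _ h => h.faceX_and_faceY.1)
      (faceIdeal_mono fun _ h => h.faceX_and_faceY.2)
  have hge : (faceIdeal ℂ fun F => BiFace Finset.univ ∅ ∅ p q F.toLeft F.toRight) ≤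
      faceIdeal ℂ (FaceX n (p + 1)) ⊔ faceIdeal ℂ (FaceY n (q + 1)) :=
    (faceIdeal_mono fun _ h => biFace_univ_of_faceX_of_faceY h.1 h.2).trans
      (faceIdeal_and_le _ _)
  obtain ⟨d, hd⟩ := trivialSyzygies_biFace (K := ℂ) (Finset.univ : Finset (Fin n)) ∅ ∅ p q
    (by simp) (by simp) (by rw [Finset.card_univ, Fintype.card_fin]; omega) a (hle ha)
  have hex : ∀ k, ∃ w u, k ∈ biIndex p q →
      w ∈ faceIdeal ℂ (FaceX n (p + 1)) ∧ u ∈ faceIdeal ℂ (FaceY n (q + 1)) ∧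
      w + u = a k - ∑ l ∈ biIndex p q, (d k l - d l k) * biEsymm (Fin n) ℂ l := fun k => by
    by_cases hk : k ∈ biIndex p q
    · obtain ⟨w, hw, u, hu, h⟩ := Submodule.mem_sup.1 (hge (hd k hk))
      exact ⟨w, u, fun _ => ⟨hw, hu, h⟩⟩
    · exact ⟨0, 0, fun h => absurd h hk⟩
  choose w u h using hex
  refine ⟨w, u, fun k hk => (h k hk).1, fun k hk => (h k hk).2.1, ?_⟩
  rw [← sum_mul_sub_koszul _ _ d, ← Finset.sum_add_distrib]
  refine Finset.sum_congr rfl fun k hk => ?_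
  rw [← (h k hk).2.2, mul_add]

theorem mkB_mem_sup {n p q : ℕ} (hn : n = p + 1 + (q + 1))
    {f : MvPolynomial (Fin n ⊕ Fin n) ℂ} (hfY : f ∈ faceIdeal ℂ (FaceY n (q + 1)))
    (hf : f ∈ Ideal.span (biEsymm (Fin n) ℂ '' (biIndex p q : Set (ℕ ⊕ ℕ))) ⊔
        Ideal.span {biEsymm (Fin n) ℂ (.inr q)} ⊔ faceIdeal ℂ (FaceY n (q + 2)) ⊔
        faceIdeal ℂ (FaceX n (p + 1))) :
    mkB n f ∈ Jn n ⊔ FB n (q + 2) := by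
  obtain ⟨g₃, hg₃, x, hx, rfl⟩ := Submodule.mem_sup.1 hf
  obtain ⟨g₂, hg₂, y, hy, rfl⟩ := Submodule.mem_sup.1 hg₃
  obtain ⟨g₁, hg₁, c, hc, rfl⟩ := Submodule.mem_sup.1 hg₂
  obtain ⟨b, rfl⟩ := Ideal.mem_span_singleton'.1 hc
  obtain ⟨a, rfl⟩ := (Submodule.mem_span_image_finset_iff_exists_fun' _).1 hg₁
  simp only [smul_eq_mul, mul_comm (a _)] at hfY ⊢
  have hyq : y ∈ faceIdeal ℂ (FaceY n (q + 1)) :=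
    faceIdeal_mono (fun _ h => ⟨h.1, h.2.trans (Nat.lt_succ_self _)⟩) hy
  have hbq := Ideal.mul_mem_left _ b (biEsymm_inr_mem_faceIdeal n q)
  have hsx : ∑ k ∈ biIndex p q, biEsymm (Fin n) ℂ k * a k + x ∈
      faceIdeal ℂ (FaceY n (q + 1)) := by
    convert Ideal.sub_mem _ (Ideal.sub_mem _ hfY hbq) hyq using 1
    ring
  have hs : ∑ k ∈ biIndex p q, biEsymm (Fin n) ℂ k * a k ∈
      faceIdeal ℂ (FaceX n (p + 1)) ⊔ faceIdeal ℂ (FaceY n (q + 1)) := by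
    simpa using Ideal.sub_mem _ (Ideal.mem_sup_right hsx) (Ideal.mem_sup_left hx)
  obtain ⟨w, u, hw, hu, heq⟩ := exists_coeff_mem_faceIdeal hn hs
  rw [heq] at hsx ⊢
  have hwX := Ideal.sum_mem _ fun k hk => Ideal.mul_mem_left _ (biEsymm (Fin n) ℂ k) (hw k hk)
  have huY := Ideal.sum_mem _ fun k hk => Ideal.mul_mem_left _ (biEsymm (Fin n) ℂ k) (hu k hk)
  have hzY : ∑ k ∈ biIndex p q, biEsymm (Fin n) ℂ k * w k + x ∈
      faceIdeal ℂ (FaceY n (q + 1)) := by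
    convert Ideal.sub_mem _ hsx huY using 1
    ring
  have hz := mkB_mem_Jn_of_mem_inf hn ⟨Ideal.add_mem _ hwX hx, hzY⟩
  have huJ : mkB n (∑ k ∈ biIndex p q, biEsymm (Fin n) ℂ k * u k) ∈ Jn n := by
    rw [map_sum]
    refine Ideal.sum_mem _ fun k _ => ?_
    rw [map_mul]
    exact Ideal.mul_mem_right _ _ (mkB_biEsymm_mem_Jn n k)
  have hbJ : mkB n (b * biEsymm (Fin n) ℂ (.inr q)) ∈ Jn n := by
    rw [map_mul]
    exact Ideal.mul_mem_left _ _ (mkB_biEsymm_mem_Jn n _)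
  convert Ideal.add_mem _
    (Ideal.mem_sup_left (Ideal.add_mem _ (Ideal.add_mem _ hz huJ) hbJ))
    (Ideal.mem_sup_right (mkB_mem_FB hy)) using 1
  simp only [← map_add]
  congr 1
  ring

end Filtration

/-- For `n ≥ 2` and `1 ≤ i ≤ n−1`, one has
`F^i Bₙ ∩ I^n_{n−i,i+1} ⊆ Jₙ + F^{i+1} Bₙ`; equivalently, the natural `Sₙ`-module
homomorphism `φ : Rₙ^{(i)} → R^n_{n−i,i+1}` is injective. -/
theorem filtration_cap_Iij_le (n i : ℕ) (hn : 2 ≤ n) (hi1 : 1 ≤ i) (hi2 : i ≤ n - 1) :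
    FB n i ⊓ Iij n (n - i) (i + 1) ≤ Jn n ⊔ FB n (i + 1) := by
  obtain ⟨q, rfl⟩ := Nat.exists_eq_add_of_le' hi1
  obtain ⟨p, hp⟩ : ∃ p, n = p + 1 + (q + 1) := ⟨n - (q + 2), by omega⟩
  rw [show n - (q + 1) = p + 1 by omega]
  rintro P ⟨hPF, hPI⟩
  obtain ⟨f, rfl⟩ := Ideal.Quotient.mk_surjective P
  exact mkB_mem_sup hp (mem_faceIdeal_of_mkB_mem_FB hPF) (mem_sup_of_mkB_mem_Iij hPI)

end
end
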